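/- Let α ∈ (0, 2s) and M ≥ 0. There exists δ > 0 depending only on s, n, α and M such that the following holds: suppose b : [−1,0] × B_1^0 → ℝ^n satisfies sup_{t∈[−1,0]} ‖b(t,·)‖_{C^{1−2s}(B_1^0)} ≤ M and |b(t,x)| ≤ δ |x|^{1−2s+α} for all (t,x) ∈ [−1,0] × B_1^0, suppose f : [−1,0] × B_1^0 → ℝ satisfies |f(t,x)| ≤ δ |x|^{1−2s+α} for all (t,x), and suppose u is a classical solution of the extended drift–diffusion equation with drift b and right-hand side f satisfying u(0,0,0) = 0 and sup_{[−1,0]×B_1^+} |u| ≤ 1. Then there exist a vector A ∈ ℝ^n, a differentiable function D : [−1/2,0] → ℝ, and a constant C depending only on s, n, α and M, such that for all (t,x,y) ∈ [−1/2,0] × (B_{1/2}^+ ∪ B_{1/2}^0): |u(t,x,y) − A·x − D(t) − (D'(t)/(1−a)) y^{1−a}| ≤ C (|x| + y + |t|^{1/(2s)})^{1+α}. -/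

import Mathlib

open Set Filter Topology MeasureTheory
open scoped RealInnerProductSpace

noncomputable section

abbrev En (n : ℕ) := EuclideanSpace ℝ (Fin n)

/-- The open upper half ball `B_r^+`. -/
def halfBall (n : ℕ) (r : ℝ) : Set (En n × ℝ) :=
  {p | ‖p.1‖ ^ 2 + p.2 ^ 2 < r ^ 2 ∧ 0 < p.2}

/-- The closure of the upper half ball. -/
def closedHalfBall (n : ℕ) (r : ℝ) : Set (En n × ℝ) :=
  {p | ‖p.1‖ ^ 2 + p.2 ^ 2 ≤ r ^ 2 ∧ 0 ≤ p.2}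

/-- `B_r^+ ∪ B_r^0`. -/
def halfBallWithBase (n : ℕ) (r : ℝ) : Set (En n × ℝ) :=
  {p | ‖p.1‖ ^ 2 + p.2 ^ 2 < r ^ 2 ∧ 0 ≤ p.2}

/-- The flat ball `B_r^0` in `ℝⁿ`. -/
def flatBall (n : ℕ) (r : ℝ) : Set (En n) := {x | ‖x‖ < r}

/-- `(∂B_1)^+`. -/
def spherePlus (n : ℕ) : Set (En n × ℝ) := {p | ‖p.1‖ ^ 2 + p.2 ^ 2 = 1 ∧ 0 < p.2}

/-- closure of `(∂B_1)^+`. -/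
def closedSpherePlus (n : ℕ) : Set (En n × ℝ) := {p | ‖p.1‖ ^ 2 + p.2 ^ 2 = 1 ∧ 0 ≤ p.2}

/-- Second directional derivative of `u` at `p` in direction `v`. -/
def D2 {n : ℕ} (u : En n × ℝ → ℝ) (p v : En n × ℝ) : ℝ :=
  fderiv ℝ (fun q => fderiv ℝ u q v) p v

/-- The Laplacian in the `n+1` variables `(x, y)`. -/
def lap {n : ℕ} (u : En n × ℝ → ℝ) (p : En n × ℝ) : ℝ :=
  (∑ i : Fin n, D2 u p (EuclideanSpace.single i 1, 0)) + D2 u p (0, 1)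

/-- `u` is `a`-harmonic on `Ω`: it is `C²` there and `Δu + (a/y) ∂_y u = 0`. -/
def IsAHarmonicOn {n : ℕ} (a : ℝ) (u : En n × ℝ → ℝ) (Ω : Set (En n × ℝ)) : Prop :=
  ContDiffOn ℝ 2 u Ω ∧ ∀ p ∈ Ω, lap u p + (a / p.2) * fderiv ℝ u p (0, 1) = 0

/-- `lim_{y → 0⁺} y^a ∂_y w(x, y) = L`. -/
def NormalDerivLimit {n : ℕ} (a : ℝ) (w : En n × ℝ → ℝ) (x : En n) (L : ℝ) : Prop :=
  Tendsto (fun y : ℝ => y ^ a * fderiv ℝ w (x, y) (0, 1)) (𝓝[>] (0 : ℝ)) (𝓝 L)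

/-- The boundary-restriction `(t, x) ↦ u(t, x, 0)`. -/
def bdryFun {n : ℕ} (u : ℝ → En n × ℝ → ℝ) : ℝ × En n → ℝ := fun q => u q.1 (q.2, 0)

/-- A classical solution of the extended drift–diffusion equation on
`[-1,0] × closure (B_1^+)` with drift `b` and right-hand side `f`. -/
def IsExtDDSolution {n : ℕ} (a : ℝ) (b : ℝ → En n → En n) (f : ℝ → En n → ℝ)
    (u : ℝ → En n × ℝ → ℝ) : Prop :=
  ContinuousOn (fun q : ℝ × (En n × ℝ) => u q.1 q.2) (Icc (-1 : ℝ) 0 ×ˢ closedHalfBall n 1) ∧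
  (∀ t ∈ Icc (-1 : ℝ) 0, IsAHarmonicOn a (u t) (halfBall n 1)) ∧
  (∀ q ∈ Ioc (-1 : ℝ) 0 ×ˢ flatBall n 1,
      DifferentiableWithinAt ℝ (bdryFun u) (Ioc (-1 : ℝ) 0 ×ˢ flatBall n 1) q) ∧
  (∀ t x, (t, x) ∈ Ioc (-1 : ℝ) 0 ×ˢ flatBall n 1 →
      ∃ L : ℝ, NormalDerivLimit a (u t) x L ∧
        fderivWithin ℝ (bdryFun u) (Ioc (-1 : ℝ) 0 ×ˢ flatBall n 1) (t, x) (1, 0) +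
          fderivWithin ℝ (bdryFun u) (Ioc (-1 : ℝ) 0 ×ˢ flatBall n 1) (t, x) (0, b t x) -
          L = f t x)

/-- A classical solution of the localized fractional heat equation on
`[-1,0] × closure (B_1^+)`. -/
def IsFracHeatSolution {n : ℕ} (a : ℝ) (u : ℝ → En n × ℝ → ℝ) : Prop :=
  ContinuousOn (fun q : ℝ × (En n × ℝ) => u q.1 q.2) (Icc (-1 : ℝ) 0 ×ˢ closedHalfBall n 1) ∧
  (∀ t ∈ Icc (-1 : ℝ) 0, IsAHarmonicOn a (u t) (halfBall n 1)) ∧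
  (∀ t ∈ Ioc (-1 : ℝ) 0, ∀ x ∈ flatBall n 1,
      DifferentiableWithinAt ℝ (fun τ => u τ (x, 0)) (Ioc (-1 : ℝ) 0) t ∧
      NormalDerivLimit a (u t) x (derivWithin (fun τ => u τ (x, 0)) (Ioc (-1 : ℝ) 0) t))

/-- second order expansion data at 0 -/
def T2 (f : ℝ → ℝ) (m B : ℝ) : Prop :=
  ∃ f' : ℝ → ℝ, (∀ᶠ s in 𝓝 0, HasDerivAt f (f' s) s) ∧ f' 0 = m ∧ HasDerivAt f' B 0

theorem T2.hasDerivAt {f : ℝ → ℝ} {m B : ℝ} (h : T2 f m B) : HasDerivAt f m 0 := by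
  obtain ⟨f', h1, rfl, _⟩ := h
  exact h1.self_of_nhds

theorem T2.cont {f : ℝ → ℝ} {m B : ℝ} (h : T2 f m B) : ContinuousAt f 0 :=
  h.hasDerivAt.continuousAt

theorem T2.congr_val {f : ℝ → ℝ} {m B m' B' : ℝ} (h : T2 f m B) (hm : m = m') (hB : B = B') :
    T2 f m' B' := hm ▸ hB ▸ h

theorem T2.congr_ev {f g : ℝ → ℝ} {m B : ℝ} (h : T2 f m B) (hfg : ∀ᶠ s in 𝓝 0, g s = f s) :
    T2 g m B := by
  obtain ⟨f', h1, h2, h3⟩ := h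
  refine ⟨f', ?_, h2, h3⟩
  filter_upwards [h1, hfg.eventually_nhds] with s hs hs2
  exact hs.congr_of_eventuallyEq hs2

theorem T2.const (c : ℝ) : T2 (fun _ => c) 0 0 :=
  ⟨fun _ => 0, Eventually.of_forall fun s => hasDerivAt_const s c, rfl, hasDerivAt_const 0 0⟩

theorem T2.add {f g : ℝ → ℝ} {m B m' B' : ℝ} (h : T2 f m B) (k : T2 g m' B') :
    T2 (fun s => f s + g s) (m + m') (B + B') := by
  obtain ⟨f', h1, h2, h3⟩ := h
  obtain ⟨g', k1, k2, k3⟩ := k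
  refine ⟨fun s => f' s + g' s, ?_, by simp [h2, k2], h3.add k3⟩
  filter_upwards [h1, k1] with s hs ks
  exact hs.add ks

theorem T2.const_mul {f : ℝ → ℝ} {m B : ℝ} (c : ℝ) (h : T2 f m B) :
    T2 (fun s => c * f s) (c * m) (c * B) := by
  obtain ⟨f', h1, h2, h3⟩ := h
  refine ⟨fun s => c * f' s, ?_, by simp [h2], h3.const_mul c⟩
  filter_upwards [h1] with s hs
  exact hs.const_mul c

theorem T2.sub {f g : ℝ → ℝ} {m B m' B' : ℝ} (h : T2 f m B) (k : T2 g m' B') :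
    T2 (fun s => f s - g s) (m - m') (B - B') := by
  refine (h.add (k.const_mul (-1))).congr_ev ?_ |>.congr_val (by ring) (by ring)
  exact Eventually.of_forall fun s => by ring

theorem T2.mul {f g : ℝ → ℝ} {m B m' B' : ℝ} (h : T2 f m B) (k : T2 g m' B') :
    T2 (fun s => f s * g s) (m * g 0 + f 0 * m') (B * g 0 + 2 * (m * m') + f 0 * B') := by
  have hf := h.hasDerivAt
  have hg := k.hasDerivAt
  obtain ⟨f', h1, h2, h3⟩ := h
  obtain ⟨g', k1, k2, k3⟩ := k
  refine ⟨fun s => f' s * g s + f s * g' s, ?_, by simp [h2, k2], ?_⟩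
  · filter_upwards [h1, k1] with s hs ks
    exact hs.mul ks
  · have := (h3.mul hg).add (hf.mul k3)
    refine this.congr_deriv ?_
    rw [h2, k2]; ring

theorem T2.scale {f : ℝ → ℝ} {m B : ℝ} (c : ℝ) (h : T2 f m B) :
    T2 (fun s => f (c * s)) (c * m) (c ^ 2 * B) := by
  obtain ⟨f', h1, h2, h3⟩ := h
  have hl : ∀ s : ℝ, HasDerivAt (fun s => c * s) c s := fun s => by
    simpa using (hasDerivAt_id s).const_mul c
  refine ⟨fun s => c * f' (c * s), ?_, by simp [h2], ?_⟩
  · have : Tendsto (fun s : ℝ => c * s) (𝓝 0) (𝓝 0) := by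
      have := (hl 0).continuousAt.tendsto
      simpa using this
    filter_upwards [this.eventually h1] with s hs
    have := hs.comp s (hl s)
    rw [mul_comm]
    exact this
  · have h3' : HasDerivAt f' B (c * 0) := by simpa using h3
    have := (h3'.comp 0 (hl 0)).const_mul c
    refine this.congr_deriv ?_
    ring

theorem T2.quad (k l q : ℝ) : T2 (fun s => k + l * s + q * s ^ 2) l (2 * q) := by
  refine ⟨fun s => l + 2 * q * s, Eventually.of_forall fun s => ?_, by simp, ?_⟩
  · have := (((hasDerivAt_id s).const_mul l).const_add k).add (((hasDerivAt_id s).pow 2).const_mul q)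
    refine (this.congr_deriv ?_)
    simp; ring
  · have := (((hasDerivAt_id (0:ℝ)).const_mul (2 * q)).const_add l)
    refine this.congr_deriv (by simp)

theorem T2.rpow {f : ℝ → ℝ} {m B : ℝ} (h : T2 f m B) (h0 : 0 < f 0) (e : ℝ) :
    T2 (fun s => f s ^ e) (e * f 0 ^ e / f 0 * m)
      (e * (e - 1) * f 0 ^ e / f 0 ^ 2 * m ^ 2 + e * f 0 ^ e / f 0 * B) := by
  have hf := h.hasDerivAt
  obtain ⟨f', h1, h2, h3⟩ := h
  refine ⟨fun s => f' s * e * f s ^ (e - 1), ?_, ?_, ?_⟩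
  · filter_upwards [h1, hf.continuousAt.eventually (lt_mem_nhds h0)] with s hs hs0
    exact hs.rpow_const (Or.inl hs0.ne')
  · simp only [h2, Real.rpow_sub_one h0.ne']; ring
  · have := (h3.mul_const e).mul (hf.rpow_const (p := e - 1) (Or.inl h0.ne'))
    refine this.congr_deriv ?_
    have e2 : f 0 ^ (e - 1 - 1) = f 0 ^ e / f 0 ^ 2 := by
      rw [Real.rpow_sub_one h0.ne', Real.rpow_sub_one h0.ne']; field_simp
    simp only [h2, e2, Real.rpow_sub_one h0.ne']
    ring

/-- touching -/
theorem T2.touch {f g : ℝ → ℝ} {m B m' B' : ℝ} (h : T2 f m B) (k : T2 g m' B')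
    (hle : ∀ᶠ s in 𝓝 0, f s - f 0 ≤ g s - g 0) : m = m' ∧ B ≤ B' := by
  have H := k.sub h
  have hmin : IsLocalMin (fun s => g s - f s) 0 := by
    filter_upwards [hle] with s hs
    linarith
  have hm := hmin.hasDerivAt_eq_zero H.hasDerivAt
  refine ⟨by linarith, ?_⟩
  by_contra hB
  push Not at hB
  obtain ⟨F, h1, h2, h3⟩ := H
  have hF0 : F 0 = 0 := by linarith
  have h4 : ∀ᶠ s in 𝓝[>] (0:ℝ), F s < 0 := by
    have := (hasDerivAt_iff_tendsto_slope.1 h3).eventually (gt_mem_nhds (show B' - B < 0 by linarith))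
    have h5 : ∀ᶠ s in 𝓝[>] (0:ℝ), slope F 0 s < 0 :=
      this.filter_mono (nhdsWithin_mono _ fun x hx => ne_of_gt hx)
    filter_upwards [h5, self_mem_nhdsWithin] with s hs hs0
    rw [slope_def_field, hF0] at hs
    have hs0' : (0:ℝ) < s := hs0
    rw [sub_zero, sub_zero, div_neg_iff] at hs
    rcases hs with hs | hs
    · linarith [hs.2]
    · exact hs.1
  have h6 : ∀ᶠ s in 𝓝[>] (0:ℝ), HasDerivAt (fun s => g s - f s) (F s) s :=
    nhdsWithin_le_nhds (s := Ioi (0:ℝ)) h1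
  have h7 : ∀ᶠ s in 𝓝[>] (0:ℝ), g 0 - f 0 ≤ g s - f s :=
    nhdsWithin_le_nhds (s := Ioi (0:ℝ)) hmin
  obtain ⟨ε, hε, hsub⟩ := mem_nhdsGT_iff_exists_Ioo_subset.1 ((h4.and (h6.and h7)))
  have hε' : (0:ℝ) < ε := hε
  have hd0 := h1.self_of_nhds
  obtain ⟨c, hc, hc2⟩ := exists_hasDerivAt_eq_slope (fun s => g s - f s) F (half_pos hε')
    (by
      intro s hs
      rcases hs.1.eq_or_lt with h | h
      · rw [← h]; exact hd0.continuousAt.continuousWithinAt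
      · exact (hsub ⟨h, lt_of_le_of_lt hs.2 (by linarith)⟩).2.1.continuousAt.continuousWithinAt)
    (fun s hs => (hsub ⟨hs.1, lt_trans hs.2 (by linarith)⟩).2.1)
  have a1 := (hsub (show c ∈ Ioo 0 ε from ⟨hc.1, lt_trans hc.2 (by linarith)⟩)).1
  have a2 := (hsub (show ε/2 ∈ Ioo 0 ε from ⟨half_pos hε', by linarith⟩)).2.2
  rw [hc2] at a1
  rw [div_neg_iff] at a1
  rcases a1 with h | h
  · linarith [h.2]
  · linarith [h.1]

structure ClassU (n : ℕ) (σ T R δ θ : ℝ) (u : ℝ → En n → ℝ → ℝ) : Prop where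
  cont : ContinuousOn (fun q : ℝ × En n × ℝ => u q.1 q.2.1 q.2.2)
    {q | -T ≤ q.1 ∧ q.1 ≤ 0 ∧ ‖q.2.1‖ < R ∧ 0 ≤ q.2.2 ∧ q.2.2 < R}
  int : ∀ t ∈ Icc (-T) 0, ∀ x : En n, ‖x‖ < R → ∀ y, 0 < y → y < R →
    ∃ (m B : En n → ℝ) (my By : ℝ), (∀ h, T2 (fun s => u t (x + s • h) y) (m h) (B h)) ∧
      T2 (fun s => u t x (y + s)) my By ∧
      ∀ b : OrthonormalBasis (Fin n) ℝ (En n), (∑ i, B (b i)) + By + (1 - σ) / y * my = 0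
  bdry : ∀ t ∈ Ioc (-T) 0, ∀ x : En n, ‖x‖ < R → ∃ (τ l : ℝ) (p : En n),
    HasDerivWithinAt (fun t' => u t' x 0) τ (Iic t) t ∧
    (∀ h, HasDerivAt (fun s : ℝ => u t (x + s • h) 0) ⟪p, h⟫ 0) ∧
    Tendsto (fun y => (u t x y - u t x 0) / y ^ σ) (𝓝[>] 0) (𝓝 l) ∧
    |τ - σ * l| ≤ δ * ‖x‖ ^ θ * (1 + ‖p‖)

structure ClassA (n : ℕ) (σ T R Z δ : ℝ) (V : ℝ → En n → En n → ℝ → ℝ) : Prop where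
  cont : ContinuousOn (fun q : ℝ × En n × En n × ℝ => V q.1 q.2.1 q.2.2.1 q.2.2.2)
    {q | -T ≤ q.1 ∧ q.1 ≤ 0 ∧ ‖q.2.1‖ < R ∧ ‖q.2.2.1‖ < Z ∧ 0 ≤ q.2.2.2 ∧ q.2.2.2 < R}
  int : ∀ t ∈ Icc (-T) 0, ∀ x : En n, ‖x‖ < R → ∀ ξ : En n, ‖ξ‖ < Z → ∀ y, 0 < y → y < R →
    ∃ (m B : En n → ℝ) (my By : ℝ), (∀ h, T2 (fun s => V t (x + s • h) ξ y) (m h) (B h)) ∧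
      T2 (fun s => V t x ξ (y + s)) my By ∧
      ∀ b : OrthonormalBasis (Fin n) ℝ (En n), (∑ i, B (b i)) + By + (1 - σ) / y * my = 0
  bdry : ∀ t ∈ Ioc (-T) 0, ∀ x : En n, ‖x‖ < R → ∀ ξ : En n, ‖ξ‖ < Z →
    ∃ (τ l : ℝ) (p q : En n),
    HasDerivWithinAt (fun t' => V t' x ξ 0) τ (Iic t) t ∧
    (∀ h, HasDerivAt (fun s : ℝ => V t (x + s • h) ξ 0) ⟪p, h⟫ 0) ∧
    (∀ h, HasDerivAt (fun s : ℝ => V t x (ξ + s • h) 0) ⟪q, h⟫ 0) ∧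
    Tendsto (fun y => (V t x ξ y - V t x ξ 0) / y ^ σ) (𝓝[>] 0) (𝓝 l) ∧
    |τ - σ * l| ≤ δ * (1 + ‖p‖ + ‖q‖)

theorem trace_onb {n : ℕ} (Q : En n →L[ℝ] En n →L[ℝ] ℝ) (b : OrthonormalBasis (Fin n) ℝ (En n)) :
    ∑ i, Q (b i) (b i) = ∑ i, Q (EuclideanSpace.single i 1) (EuclideanSpace.single i 1) := by
  set c := EuclideanSpace.basisFun (Fin n) ℝ with hc
  let S : En n →ₗ[ℝ] En n :=
    { toFun := fun h => ∑ j, (Q h (c j)) • c j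
      map_add' := fun h k => by simp [add_smul, Finset.sum_add_distrib]
      map_smul' := fun r h => by simp [Finset.smul_sum, smul_smul] }
  have hS : ∀ h k : En n, ⟪k, S h⟫ = Q h k := by
    intro h k
    have : S h = ∑ j, (Q h (c j)) • c j := rfl
    rw [this, inner_sum]
    conv_rhs => rw [← c.sum_repr k]
    rw [map_sum]
    refine Finset.sum_congr rfl fun j _ => ?_
    rw [inner_smul_right, map_smul, c.repr_apply_apply, real_inner_comm, smul_eq_mul, mul_comm]
  have h1 := LinearMap.trace_eq_sum_inner S b
  have h2 := LinearMap.trace_eq_sum_inner S c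
  rw [h1] at h2
  simp only [hS] at h2
  rw [h2]
  simp [hc]

theorem T2_line {F : Type*} [NormedAddCommGroup F] [NormedSpace ℝ F] {f : F → ℝ} {p : F}
    (hf : ContDiffAt ℝ 2 f p) (v : F) :
    T2 (fun s : ℝ => f (p + s • v)) (fderiv ℝ f p v) (fderiv ℝ (fderiv ℝ f) p v v) := by
  have hl : ∀ s : ℝ, HasDerivAt (fun s : ℝ => p + s • v) v s := fun s => by
    simpa using ((hasDerivAt_id s).smul_const v).const_add p
  refine ⟨fun s => fderiv ℝ f (p + s • v) v, ?_, by simp, ?_⟩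
  · have h1 : ∀ᶠ q in 𝓝 p, ContDiffAt ℝ 2 f q := hf.eventually (by simp)
    have h2 : Tendsto (fun s : ℝ => p + s • v) (𝓝 0) (𝓝 p) := by
      have := (hl 0).continuousAt.tendsto; simpa using this
    filter_upwards [h2.eventually h1] with s hs
    exact (hs.differentiableAt (by simp)).hasFDerivAt.comp_hasDerivAt s (hl s)
  · have h1 : ContDiffAt ℝ 1 (fderiv ℝ f) p := hf.fderiv_right (by norm_num)
    have h2 : HasFDerivAt (fderiv ℝ f) (fderiv ℝ (fderiv ℝ f) p) (p + (0:ℝ) • v) := by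
      simpa using (h1.differentiableAt (by simp)).hasFDerivAt
    have h3 := h2.comp_hasDerivAt (0:ℝ) (hl 0)
    have := (ContinuousLinearMap.apply ℝ ℝ v).hasFDerivAt.comp_hasDerivAt (0:ℝ) h3
    exact this

theorem D2_eq {n : ℕ} {f : En n × ℝ → ℝ} {p : En n × ℝ}
    (hf : ContDiffAt ℝ 2 f p) (v : En n × ℝ) : D2 f p v = fderiv ℝ (fderiv ℝ f) p v v := by
  have h1 : ContDiffAt ℝ 1 (fderiv ℝ f) p := hf.fderiv_right (by norm_num)
  have := (ContinuousLinearMap.apply ℝ ℝ v).hasFDerivAt.comp p (h1.differentiableAt (by simp)).hasFDerivAt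
  unfold D2
  have h2 : (fun q => fderiv ℝ f q v) = (ContinuousLinearMap.apply ℝ ℝ v) ∘ (fderiv ℝ f) := rfl
  rw [h2, this.fderiv]
  rfl

theorem halfBall_open (n : ℕ) (r : ℝ) : IsOpen (halfBall n r) := by
  have h1 : IsOpen {p : En n × ℝ | ‖p.1‖ ^ 2 + p.2 ^ 2 < r ^ 2} :=
    isOpen_lt (by fun_prop) (by fun_prop)
  have h2 : IsOpen {p : En n × ℝ | 0 < p.2} := isOpen_lt (by fun_prop) (by fun_prop)
  exact h1.inter h2

theorem normal_limit {σ : ℝ} (hσ : 0 < σ) {g g' : ℝ → ℝ} {L ε : ℝ} (hε : 0 < ε)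
    (hd : ∀ y ∈ Ioo 0 ε, HasDerivAt g (g' y) y) (hc : ContinuousWithinAt g (Ici 0) 0)
    (hL : Tendsto (fun y : ℝ => y ^ (1 - σ) * g' y) (𝓝[>] (0 : ℝ)) (𝓝 L)) :
    Tendsto (fun y => (g y - g 0) / y ^ σ) (𝓝[>] 0) (𝓝 (L / σ)) := by
  have hev : ∀ᶠ y in 𝓝[>] (0:ℝ), y ∈ Ioo 0 ε := Ioo_mem_nhdsGT hε
  refine HasDerivAt.lhopital_zero_nhdsGT (f' := g') (g' := fun y => σ * y ^ (σ - 1)) ?_ ?_ ?_ ?_ ?_ ?_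
  · filter_upwards [hev] with y hy
    exact (hd y hy).sub_const _
  · filter_upwards [hev] with y hy
    exact Real.hasDerivAt_rpow_const (Or.inl hy.1.ne')
  · filter_upwards [hev] with y hy
    have := Real.rpow_pos_of_pos hy.1 (σ - 1)
    positivity
  · have := (hc.mono Ioi_subset_Ici_self).tendsto.sub_const (g 0)
    simpa using this
  · have := ((Real.continuousAt_rpow_const 0 σ (Or.inr hσ.le)).tendsto).mono_left
      (nhdsWithin_le_nhds (s := Ioi (0:ℝ)))
    simpa [Real.zero_rpow hσ.ne'] using this
  · have := hL.div_const σ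
    refine this.congr' ?_
    filter_upwards [hev] with y hy
    rw [show (1 - σ) = -(σ - 1) by ring, Real.rpow_neg hy.1.le]
    have := Real.rpow_pos_of_pos hy.1 (σ - 1)
    field_simp

theorem classU_of_sol {n : ℕ} {σ δ θ : ℝ} (hσ : 0 < σ) (hδ : 0 ≤ δ)
    {b : ℝ → En n → En n} {f : ℝ → En n → ℝ} {u : ℝ → En n × ℝ → ℝ}
    (hb : ∀ t ∈ Icc (-1 : ℝ) 0, ∀ x ∈ flatBall n 1, ‖b t x‖ ≤ δ * ‖x‖ ^ θ)
    (hf : ∀ t ∈ Icc (-1 : ℝ) 0, ∀ x ∈ flatBall n 1, |f t x| ≤ δ * ‖x‖ ^ θ)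
    (hu : IsExtDDSolution (1 - σ) b f u) :
    ClassU n σ 1 (1/2) δ θ (fun t x y => u t (x, y)) := by
  obtain ⟨h1, h2, h3, h4⟩ := hu
  have hmem : ∀ x : En n, ‖x‖ < 1/2 → ∀ y : ℝ, 0 ≤ y → y < 1/2 → ‖x‖ ^ 2 + y ^ 2 < 1 ^ 2 := by
    intro x hx y hy hy2
    have := norm_nonneg x
    nlinarith
  have hmc : ∀ x : En n, ‖x‖ < 1/2 → ∀ y : ℝ, 0 ≤ y → y < 1/2 → (x, y) ∈ closedHalfBall n 1 :=
    fun x hx y hy hy2 => ⟨(hmem x hx y hy hy2).le, hy⟩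
  have hmo : ∀ x : En n, ‖x‖ < 1/2 → ∀ y : ℝ, 0 < y → y < 1/2 → (x, y) ∈ halfBall n 1 :=
    fun x hx y hy hy2 => ⟨(hmem x hx y hy.le hy2), hy⟩
  constructor
  · refine ContinuousOn.comp (g := fun q : ℝ × (En n × ℝ) => u q.1 q.2)
      (f := fun q : ℝ × En n × ℝ => (q.1, (q.2.1, q.2.2))) h1 (by fun_prop) ?_
    rintro ⟨t, x, y⟩ ⟨ha, hb, hc, hd, he⟩
    exact ⟨⟨ha, hb⟩, hmc x hc y hd he⟩
  · intro t ht x hx y hy hy2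
    obtain ⟨hC, hE⟩ := h2 t ht
    have hp := hmo x hx y hy hy2
    have hCA : ContDiffAt ℝ 2 (u t) (x, y) := hC.contDiffAt ((halfBall_open n 1).mem_nhds hp)
    refine ⟨fun h => fderiv ℝ (u t) (x, y) (h, 0),
      fun h => fderiv ℝ (fderiv ℝ (u t)) (x, y) (h, 0) (h, 0), fderiv ℝ (u t) (x, y) (0, 1),
      fderiv ℝ (fderiv ℝ (u t)) (x, y) (0, 1) (0, 1), ?_, ?_, ?_⟩
    · intro h
      have := T2_line hCA (h, 0)
      simpa using this
    · have := T2_line hCA (0, 1)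
      simpa using this
    · intro b
      have hE := hE (x, y) hp
      simp only [lap, D2_eq hCA] at hE
      let Q : En n →L[ℝ] En n →L[ℝ] ℝ :=
        ((fderiv ℝ (fderiv ℝ (u t)) (x, y)).comp (ContinuousLinearMap.inl ℝ (En n) ℝ)).bilinearComp
          (ContinuousLinearMap.id ℝ (En n)) (ContinuousLinearMap.inl ℝ (En n) ℝ)
      have := trace_onb Q b
      simp only [Q, ContinuousLinearMap.bilinearComp_apply, ContinuousLinearMap.comp_apply,
        ContinuousLinearMap.inl_apply, ContinuousLinearMap.id_apply] at this
      rw [this]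
      exact hE
  · intro t ht x hx
    have hS : (t, x) ∈ Ioc (-1 : ℝ) 0 ×ˢ flatBall n 1 := ⟨ht, show ‖x‖ < 1 by linarith⟩
    have hx1 : x ∈ flatBall n 1 := hS.2
    have htI : t ∈ Icc (-1:ℝ) 0 := ⟨ht.1.le, ht.2⟩
    obtain ⟨L, hL, hE⟩ := h4 t x hS
    have hD := (h3 _ hS).hasFDerivWithinAt
    set F := fderivWithin ℝ (bdryFun u) (Ioc (-1 : ℝ) 0 ×ˢ flatBall n 1) (t, x) with hF
    set p : En n := (InnerProductSpace.toDual ℝ (En n)).symm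
      (F.comp (ContinuousLinearMap.inr ℝ ℝ (En n))) with hp
    have hpi : ∀ h, ⟪p, h⟫ = F (0, h) := by
      intro h
      rw [hp, InnerProductSpace.toDual_symm_apply]; rfl
    refine ⟨F (1, 0), L / σ, p, ?_, ?_, ?_, ?_⟩
    · have hl : HasDerivWithinAt (fun t' : ℝ => (t', x)) (1, 0) (Ioc (-1) t) t :=
        ((hasDerivAt_id t).prodMk (hasDerivAt_const t x)).hasDerivWithinAt
      have := hD.comp_hasDerivWithinAt t hl
        (show MapsTo (fun t' : ℝ => (t', x)) (Ioc (-1) t) (Ioc (-1 : ℝ) 0 ×ˢ flatBall n 1) from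
          fun t' h => ⟨⟨h.1, h.2.trans ht.2⟩, hS.2⟩)
      refine (this.mono_of_mem_nhdsWithin ?_)
      exact Ioc_mem_nhdsLE ht.1
    · intro h
      rw [hpi]
      have hl : HasDerivAt (fun s : ℝ => (t, x + s • h)) ((0:ℝ), h) 0 := by
        have : HasDerivAt (fun s : ℝ => x + s • h) h 0 := by
          simpa using ((hasDerivAt_id (0:ℝ)).smul_const h).const_add x
        exact (hasDerivAt_const (0:ℝ) t).prodMk this
      have hev : ∀ᶠ s in 𝓝 (0:ℝ), ‖x + s • h‖ < 1 := by
        have : ContinuousAt (fun s : ℝ => ‖x + s • h‖) 0 := by fun_prop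
        refine this.eventually (gt_mem_nhds ?_)
        simpa using (show ‖x‖ < 1 from hS.2)
      have hD' : HasFDerivWithinAt (bdryFun u) F (Ioc (-1 : ℝ) 0 ×ˢ flatBall n 1) (t, x + (0:ℝ) • h) := by
        simpa using hD
      have := hD'.comp_hasDerivWithinAt (0:ℝ) (s := {s : ℝ | ‖x + s • h‖ < 1})
        hl.hasDerivWithinAt
        (show MapsTo (fun s : ℝ => (t, x + s • h)) {s : ℝ | ‖x + s • h‖ < 1}
          (Ioc (-1 : ℝ) 0 ×ˢ flatBall n 1) from fun s hs => ⟨ht, hs⟩)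
      exact this.hasDerivAt hev
    · refine normal_limit (g := fun y => u t (x, y)) hσ (half_pos one_pos)
        (g' := fun y => fderiv ℝ (u t) (x, y) (0, 1)) ?_ ?_ hL
      · intro y hy
        have hp := hmo x hx y hy.1 hy.2
        have hC := ((h2 t htI).1.contDiffAt ((halfBall_open n 1).mem_nhds hp)).differentiableAt (by simp)
        have hl : HasDerivAt (fun y : ℝ => (x, y)) ((0 : En n), (1:ℝ)) y :=
          (hasDerivAt_const y x).prodMk (hasDerivAt_id y)
        exact hC.hasFDerivAt.comp_hasDerivAt y hl
      · have := h1 (t, (x, 0)) ⟨htI, hmc x hx 0 le_rfl (by norm_num)⟩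
        have h5 : ContinuousWithinAt (fun y : ℝ => (t, (x, y))) (Ico 0 (1/2)) 0 := by fun_prop
        have h6 := ContinuousWithinAt.comp (f := fun y : ℝ => (t, (x, y))) (x := (0:ℝ)) this h5 (fun y hy => ⟨htI, hmc x hx y hy.1 hy.2⟩)
        refine h6.mono_of_mem_nhdsWithin ?_
        exact Ico_mem_nhdsGE (by norm_num)
    · have hE2 : F (1, 0) - σ * (L / σ) = f t x - ⟪p, b t x⟫ := by
        rw [hpi, mul_div_cancel₀ _ hσ.ne']; linarith
      rw [hE2]
      have k1 := hb t htI x hx1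
      have k2 := hf t htI x hx1
      have k3 := abs_real_inner_le_norm p (b t x)
      have k4 := mul_le_mul_of_nonneg_left k1 (norm_nonneg p)
      have := abs_sub (f t x) ⟪p, b t x⟫
      linarith

theorem ClassU.mono {n : ℕ} {σ T R δ θ T' R' : ℝ} {u : ℝ → En n → ℝ → ℝ}
    (h : ClassU n σ T R δ θ u) (hT : T' ≤ T) (hR : R' ≤ R) : ClassU n σ T' R' δ θ u := by
  refine ⟨h.cont.mono ?_, ?_, ?_⟩
  · rintro ⟨t, x, y⟩ ⟨a, b, c, d, e⟩
    simp only at a b c d e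
    exact ⟨by simp only; linarith, b, lt_of_lt_of_le c hR, d, lt_of_lt_of_le e hR⟩
  · intro t ht x hx y hy hy2
    exact h.int t ⟨by linarith [ht.1], ht.2⟩ x (by linarith) y hy (by linarith)
  · intro t ht x hx
    exact h.bdry t ⟨by linarith [ht.1], ht.2⟩ x (by linarith)

theorem ClassU.mono_delta {n : ℕ} {σ T R δ θ δ' : ℝ} {u : ℝ → En n → ℝ → ℝ}
    (h : ClassU n σ T R δ θ u) (hδ : δ ≤ δ') : ClassU n σ T R δ' θ u := by
  refine ⟨h.cont, h.int, ?_⟩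
  intro t ht x hx
  obtain ⟨τ, l, p, h1, h2, h3, h4⟩ := h.bdry t ht x hx
  refine ⟨τ, l, p, h1, h2, h3, h4.trans ?_⟩
  have := Real.rpow_nonneg (norm_nonneg x) θ
  gcongr

theorem ClassU.theta_zero {n : ℕ} {σ T R δ θ : ℝ} {u : ℝ → En n → ℝ → ℝ}
    (h : ClassU n σ T R δ θ u) (hδ : 0 ≤ δ) (hθ : 0 ≤ θ) (hR : R ≤ 1) : ClassU n σ T R δ 0 u := by
  refine ⟨h.cont, h.int, ?_⟩
  intro t ht x hx
  obtain ⟨τ, l, p, h1, h2, h3, h4⟩ := h.bdry t ht x hx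
  refine ⟨τ, l, p, h1, h2, h3, h4.trans ?_⟩
  have : ‖x‖ ^ θ ≤ 1 := Real.rpow_le_one (norm_nonneg x) (by linarith) hθ
  rw [Real.rpow_zero]
  gcongr

theorem T2.neg {f : ℝ → ℝ} {m B : ℝ} (h : T2 f m B) : T2 (fun s => - f s) (-m) (-B) := by
  have := h.const_mul (-1)
  simpa using this

theorem ClassU.neg {n : ℕ} {σ T R δ θ : ℝ} {u : ℝ → En n → ℝ → ℝ}
    (h : ClassU n σ T R δ θ u) : ClassU n σ T R δ θ (fun t x y => - u t x y) := by
  refine ⟨h.cont.neg, ?_, ?_⟩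
  · intro t ht x hx y hy hy2
    obtain ⟨m, B, my, By, h1, h2, h3⟩ := h.int t ht x hx y hy hy2
    refine ⟨fun h => - m h, fun h => - B h, -my, -By, fun h => (h1 h).neg, h2.neg, ?_⟩
    intro b
    have := h3 b
    rw [Finset.sum_neg_distrib]
    linarith
  · intro t ht x hx
    obtain ⟨τ, l, p, h1, h2, h3, h4⟩ := h.bdry t ht x hx
    refine ⟨-τ, -l, -p, h1.neg, fun h => ?_, ?_, ?_⟩
    · rw [inner_neg_left]; exact (h2 h).neg
    · refine h3.neg.congr fun y => ?_
      ring
    · rw [norm_neg, show -τ - σ * -l = -(τ - σ * l) by ring, abs_neg]; exact h4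

theorem ClassU.toA {n : ℕ} {σ T R Z δ : ℝ} {u : ℝ → En n → ℝ → ℝ}
    (h : ClassU n σ T R δ 0 u) : ClassA n σ T R Z δ (fun t x _ y => u t x y) := by
  refine ⟨?_, ?_, ?_⟩
  · refine ContinuousOn.comp (g := fun q : ℝ × En n × ℝ => u q.1 q.2.1 q.2.2)
      (f := fun q : ℝ × En n × En n × ℝ => (q.1, q.2.1, q.2.2.2)) h.cont (by fun_prop) ?_
    rintro ⟨t, x, ξ, y⟩ ⟨a, b, c, _, d, e⟩
    exact ⟨a, b, c, d, e⟩
  · intro t ht x hx ξ _ y hy hy2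
    exact h.int t ht x hx y hy hy2
  · intro t ht x hx ξ _
    obtain ⟨τ, l, p, h1, h2, h3, h4⟩ := h.bdry t ht x hx
    refine ⟨τ, l, p, 0, h1, h2, fun h => ?_, h3, ?_⟩
    · simpa using hasDerivAt_const (0:ℝ) (u t x 0)
    · simpa using h4

theorem onb_smul {n : ℕ} {μ : ℝ} (hμ : μ = 1 ∨ μ = -1) (b : OrthonormalBasis (Fin n) ℝ (En n)) :
    ∃ b' : OrthonormalBasis (Fin n) ℝ (En n), ∀ i, b' i = μ • b i := by
  rcases hμ with rfl | rfl
  · exact ⟨b, by simp⟩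
  · exact ⟨b.map (LinearIsometryEquiv.neg ℝ), by simp⟩

theorem ClassU.pair {n : ℕ} {σ T R₀ δ R Z c ε μ : ℝ} {u : ℝ → En n → ℝ → ℝ} {ξ₀ : En n}
    (h : ClassU n σ T R₀ δ 0 u) (hδ : 0 ≤ δ) (hc : 0 < c) (hε : ε = 1 ∨ ε = -1)
    (hμ : μ = 1 ∨ μ = -1) (hR : R + ‖ξ₀‖ + Z ≤ R₀) (hR2 : R ≤ R₀) :
    ClassA n σ T R Z (δ * (2 * c + 1)) (fun t x ξ y =>
      c * (u t (x + (ξ₀ + ξ)) y + ε * u t (μ • (x - (ξ₀ + ξ))) y)) := by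
  have hμ1 : |μ| = 1 := by rcases hμ with rfl | rfl <;> simp
  have hε1 : |ε| = 1 := by rcases hε with rfl | rfl <;> simp
  have hμ2 : μ * μ = 1 := by rcases hμ with rfl | rfl <;> norm_num
  have hε2 : ε * ε = 1 := by rcases hε with rfl | rfl <;> norm_num
  have n1 : ∀ x ξ : En n, ‖x‖ < R → ‖ξ‖ < Z → ‖x + (ξ₀ + ξ)‖ < R₀ := by
    intro x ξ hx hξ
    have := norm_add_le x (ξ₀ + ξ)
    have := norm_add_le ξ₀ ξ
    linarith
  have n2 : ∀ x ξ : En n, ‖x‖ < R → ‖ξ‖ < Z → ‖μ • (x - (ξ₀ + ξ))‖ < R₀ := by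
    intro x ξ hx hξ
    have := norm_sub_le x (ξ₀ + ξ)
    have := norm_add_le ξ₀ ξ
    rw [norm_smul, Real.norm_eq_abs, hμ1]
    linarith
  refine ⟨?_, ?_, ?_⟩
  · refine continuousOn_const.mul (ContinuousOn.add ?_ (continuousOn_const.mul ?_))
    · refine ContinuousOn.comp (g := fun q : ℝ × En n × ℝ => u q.1 q.2.1 q.2.2)
        (f := fun q : ℝ × En n × En n × ℝ => (q.1, q.2.1 + (ξ₀ + q.2.2.1), q.2.2.2)) h.cont (by fun_prop) ?_
      rintro ⟨t, x, ξ, y⟩ ⟨a, b, c, z, d, e⟩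
      exact ⟨a, b, n1 x ξ c z, d, lt_of_lt_of_le e hR2⟩
    · refine ContinuousOn.comp (g := fun q : ℝ × En n × ℝ => u q.1 q.2.1 q.2.2)
        (f := fun q : ℝ × En n × En n × ℝ => (q.1, μ • (q.2.1 - (ξ₀ + q.2.2.1)), q.2.2.2)) h.cont (by fun_prop) ?_
      rintro ⟨t, x, ξ, y⟩ ⟨a, b, c, z, d, e⟩
      exact ⟨a, b, n2 x ξ c z, d, lt_of_lt_of_le e hR2⟩
  · intro t ht x hx ξ hξ y hy hy2
    obtain ⟨m, B, my, By, h1, h2, h3⟩ := h.int t ht _ (n1 x ξ hx hξ) y hy (by linarith)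
    obtain ⟨m', B', my', By', h1', h2', h3'⟩ := h.int t ht _ (n2 x ξ hx hξ) y hy (by linarith)
    refine ⟨fun h => c * (m h + ε * m' (μ • h)), fun h => c * (B h + ε * B' (μ • h)),
      c * (my + ε * my'), c * (By + ε * By'), fun h => ?_, ?_, ?_⟩
    · have := ((h1 h).add ((h1' (μ • h)).const_mul ε)).const_mul c
      refine this.congr_ev (Eventually.of_forall fun s => ?_)
      rw [show x + s • h + (ξ₀ + ξ) = x + (ξ₀ + ξ) + s • h by abel,
        show μ • (x + s • h - (ξ₀ + ξ)) = μ • (x - (ξ₀ + ξ)) + s • μ • h by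
          rw [smul_comm s μ h, ← smul_add]; congr 1; abel]
    · exact (h2.add (h2'.const_mul ε)).const_mul c
    · intro b
      obtain ⟨b', hb'⟩ := onb_smul hμ b
      have e1 := h3 b
      have e2 := h3' b'
      simp only [hb'] at e2
      rw [← Finset.mul_sum, Finset.sum_add_distrib, ← Finset.mul_sum]
      linear_combination c * e1 + c * ε * e2
  · intro t ht x hx ξ hξ
    obtain ⟨τ, l, p, h1, h2, h3, h4⟩ := h.bdry t ht _ (n1 x ξ hx hξ)
    obtain ⟨τ', l', p', h1', h2', h3', h4'⟩ := h.bdry t ht _ (n2 x ξ hx hξ)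
    refine ⟨c * (τ + ε * τ'), c * (l + ε * l'), c • (p + (ε * μ) • p'), c • (p - (ε * μ) • p'),
      (h1.add (h1'.const_mul ε)).const_mul c, fun h => ?_, fun h => ?_, ?_, ?_⟩
    · have := ((h2 h).add ((h2' (μ • h)).const_mul ε)).const_mul c
      refine (this.congr_deriv ?_).congr_of_eventuallyEq (Eventually.of_forall fun s => ?_)
      · rw [real_inner_smul_left, inner_add_left, real_inner_smul_left, real_inner_smul_right]; ring
      · simp only
        rw [show x + s • h + (ξ₀ + ξ) = x + (ξ₀ + ξ) + s • h by abel,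
          show μ • (x + s • h - (ξ₀ + ξ)) = μ • (x - (ξ₀ + ξ)) + s • μ • h by
            rw [smul_comm s μ h, ← smul_add]; congr 1; abel]
        rfl
    · have := ((h2 h).add ((h2' (-(μ • h))).const_mul ε)).const_mul c
      refine (this.congr_deriv ?_).congr_of_eventuallyEq (Eventually.of_forall fun s => ?_)
      · rw [real_inner_smul_left, inner_sub_left, real_inner_smul_left, inner_neg_right,
          real_inner_smul_right]; ring
      · simp only
        rw [show x + (ξ₀ + (ξ + s • h)) = x + (ξ₀ + ξ) + s • h by abel,
          show μ • (x - (ξ₀ + (ξ + s • h))) = μ • (x - (ξ₀ + ξ)) + s • -(μ • h) by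
            rw [smul_neg, smul_comm s μ h, ← smul_neg, ← smul_add]; congr 1; abel]
        rfl
    · refine ((h3.add (h3'.const_mul ε)).const_mul c).congr fun y => ?_
      ring
    · rw [Real.rpow_zero, mul_one] at h4 h4'
      set P := c • (p + (ε * μ) • p')
      set Q := c • (p - (ε * μ) • p')
      have e1 : P + Q = (2 * c) • p := by simp only [P, Q]; module
      have e2 : P - Q = (2 * c * (ε * μ)) • p' := by simp only [P, Q]; module
      have f1 : 2 * c * ‖p‖ ≤ ‖P‖ + ‖Q‖ := by
        have := norm_add_le P Q
        rwa [e1, norm_smul, Real.norm_eq_abs, abs_of_pos (by positivity)] at this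
      have f2 : 2 * c * ‖p'‖ ≤ ‖P‖ + ‖Q‖ := by
        have := norm_sub_le P Q
        rwa [e2, norm_smul, Real.norm_eq_abs, abs_mul, abs_mul ε, hε1, hμ1, mul_one, mul_one,
          abs_of_pos (by positivity)] at this
      have g1 : c * (τ + ε * τ') - σ * (c * (l + ε * l')) =
        c * ((τ - σ * l) + ε * (τ' - σ * l')) := by ring
      rw [g1, abs_mul, abs_of_pos hc]
      have g2 : |(τ - σ * l) + ε * (τ' - σ * l')| ≤ δ * (1 + ‖p‖) + δ * (1 + ‖p'‖) := by
        refine (abs_add_le _ _).trans (add_le_add h4 ?_)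
        rw [abs_mul, hε1, one_mul]; exact h4'
      have g3 := mul_le_mul_of_nonneg_left g2 hc.le
      have g4 := mul_le_mul_of_nonneg_left f1 hδ
      have g5 := mul_le_mul_of_nonneg_left f2 hδ
      have : 0 ≤ δ * (2 * c) * (‖P‖ + ‖Q‖) := by positivity
      nlinarith

theorem ClassU.config {n : ℕ} {σ T R δ θ T' R' c ρ : ℝ} {u : ℝ → En n → ℝ → ℝ}
    (h : ClassU n σ T R δ θ u) (hσ : 0 < σ) (hδ : 0 ≤ δ) (A : En n) {D e : ℝ → ℝ}
    (hD : ∀ t, HasDerivAt D (e t) t) (he : Continuous e) (hρ : 0 < ρ) (hcρ : 1 ≤ c * ρ)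
    (hc2 : c * ρ ^ σ * ρ ^ θ ≤ 1) (hT : ρ ^ σ * T' ≤ T) (hR : ρ * R' ≤ R) :
    ClassU n σ T' R' (δ * (1 + ‖A‖)) θ (fun t x y => c * (u (ρ ^ σ * t) (ρ • x) (ρ * y)
      - ⟪A, ρ • x⟫ - D (ρ ^ σ * t) - e (ρ ^ σ * t) / σ * (ρ * y) ^ σ)) := by
  have hκ : 0 < ρ ^ σ := Real.rpow_pos_of_pos hρ σ
  set κ := ρ ^ σ with hκd
  have hc : 0 < c := by
    by_contra hh
    push Not at hh
    nlinarith
  have hDc : Continuous D := continuous_iff_continuousAt.2 fun t => (hD t).continuousAt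
  have t1 : ∀ t, -T' ≤ t → t ≤ 0 → κ * t ∈ Icc (-T) 0 := by
    intro t h1 h2
    constructor <;> nlinarith
  have x1 : ∀ x : En n, ‖x‖ < R' → ‖ρ • x‖ < R := by
    intro x hx
    rw [norm_smul, Real.norm_eq_abs, abs_of_pos hρ]; nlinarith
  have y1 : ∀ y, y < R' → ρ * y < R := by intro y hy; nlinarith
  refine ⟨?_, ?_, ?_⟩
  · refine continuousOn_const.mul (ContinuousOn.sub (ContinuousOn.sub (ContinuousOn.sub ?_ ?_) ?_) ?_)
    · refine ContinuousOn.comp (g := fun q : ℝ × En n × ℝ => u q.1 q.2.1 q.2.2)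
        (f := fun q : ℝ × En n × ℝ => (κ * q.1, ρ • q.2.1, ρ * q.2.2)) h.cont (by fun_prop) ?_
      rintro ⟨t, x, y⟩ ⟨a, b, c, d, f⟩
      exact ⟨(t1 t a b).1, (t1 t a b).2, x1 x c, mul_nonneg hρ.le d, y1 y f⟩
    · fun_prop
    · fun_prop
    · refine ContinuousOn.mul (by fun_prop) ?_
      refine ContinuousOn.rpow_const (by fun_prop) fun _ _ => Or.inr hσ.le
  · intro t ht x hx y hy hy2
    obtain ⟨m, B, my, By, h1, h2, h3⟩ := h.int _ (t1 t ht.1 ht.2) _ (x1 x hx) (ρ * y) (by positivity) (y1 y hy2)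
    have hy' : 0 < (ρ * y) := by positivity
    refine ⟨fun h => c * (ρ * m h - ρ * ⟪A, h⟫), fun h => c * (ρ ^ 2 * B h),
      c * (ρ * my - e (κ * t) / σ * (σ * (ρ * y) ^ σ / (ρ * y) * ρ)),
      c * (ρ ^ 2 * By - e (κ * t) / σ * (σ * (σ - 1) * (ρ * y) ^ σ / (ρ * y) ^ 2 * ρ ^ 2)), ?_, ?_, ?_⟩
    · intro h
      have a1 := (h1 h).scale ρ
      have a2 := T2.quad ⟪A, ρ • x⟫ (ρ * ⟪A, h⟫) 0
      have a3 := T2.const (D (κ * t) + e (κ * t) / σ * (ρ * y) ^ σ)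
      refine ((((a1.sub a2).sub a3).const_mul c).congr_ev (Eventually.of_forall fun s => ?_)).congr_val
        (by ring) (by ring)
      have : ρ • (x + s • h) = ρ • x + (ρ * s) • h := by rw [smul_add, smul_smul]
      rw [this, inner_add_right, real_inner_smul_right A h]
      ring
    · have a1 := h2.scale ρ
      have a2 := (T2.quad (ρ * y) ρ 0).rpow (by simpa using hy') σ
      have a3 := a2.const_mul (e (κ * t) / σ)
      have a4 := T2.const (⟪A, ρ • x⟫ + D (κ * t))
      refine ((((a1.sub a4).sub a3).const_mul c).congr_ev (Eventually.of_forall fun s => ?_)).congr_val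
        ?_ ?_
      · rw [show ρ * (y + s) = ρ * y + ρ * s by ring]
        ring_nf
      · simp
      · simp
    · intro b
      have e1 := h3 b
      rw [← Finset.mul_sum, ← Finset.mul_sum]
      have e2 : (1 - σ) / (ρ * y) * my * ρ = (1 - σ) / y * my := by field_simp
      have e3 : e (κ * t) / σ * (σ * (σ - 1) * (ρ * y) ^ σ / (ρ * y) ^ 2 * ρ ^ 2)
        + (1 - σ) / y * (e (κ * t) / σ * (σ * (ρ * y) ^ σ / (ρ * y) * ρ)) = 0 := by
        field_simp; ring
      linear_combination c * ρ ^ 2 * e1 - c * e3 - c * ρ * e2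
  · intro t ht x hx
    have htI := t1 t ht.1.le ht.2
    have htI2 : κ * t ∈ Ioc (-T) 0 := ⟨by nlinarith [ht.1], htI.2⟩
    obtain ⟨τ, l, p, h1, h2, h3, h4⟩ := h.bdry _ htI2 _ (x1 x hx)
    refine ⟨c * (τ * κ - e (κ * t) * κ), c * (κ * l - e (κ * t) / σ * κ), (c * ρ) • (p - A), ?_, ?_, ?_, ?_⟩
    · have hl : HasDerivWithinAt (fun t : ℝ => κ * t) κ (Iic t) t := by
        simpa using ((hasDerivAt_id t).const_mul κ).hasDerivWithinAt
      have a1 := h1.comp t hl (fun t' (ht' : t' ≤ t) => mul_le_mul_of_nonneg_left ht' hκ.le)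
      have a2 := (hD (κ * t)).comp_hasDerivWithinAt t hl
      have := ((a1.sub a2).sub_const (⟪A, ρ • x⟫)).const_mul c
      refine this.congr_of_mem (fun t' _ => ?_) (le_refl t)
      simp only [mul_zero, Real.zero_rpow hσ.ne', Pi.sub_apply, Function.comp]
      ring
    · intro h
      have a1 : HasDerivAt (fun s : ℝ => u (κ * t) (ρ • x + (ρ * s) • h) 0) (⟪p, h⟫ * ρ) 0 := by
        have hl : HasDerivAt (fun s : ℝ => ρ * s) ρ 0 := by
          simpa using (hasDerivAt_id (0:ℝ)).const_mul ρ
        have : HasDerivAt (fun s : ℝ => u (κ * t) (ρ • x + s • h) 0) ⟪p, h⟫ (ρ * 0) := by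
          rw [mul_zero]; exact h2 h
        exact this.comp (0:ℝ) hl
      have a2 : HasDerivAt (fun s : ℝ => ⟪A, ρ • x⟫ + s * (ρ * ⟪A, h⟫)) (ρ * ⟪A, h⟫) 0 := by
        simpa using ((hasDerivAt_id (0:ℝ)).mul_const (ρ * ⟪A, h⟫)).const_add (⟪A, ρ • x⟫)
      have := ((a1.sub a2).sub_const (D (κ * t))).const_mul c
      refine (this.congr_deriv ?_).congr_of_eventuallyEq (Eventually.of_forall fun s => ?_)
      · rw [real_inner_smul_left, inner_sub_left]; ring
      · simp only [mul_zero, Real.zero_rpow hσ.ne', Pi.sub_apply]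
        have : ρ • (x + s • h) = ρ • x + (ρ * s) • h := by rw [smul_add, smul_smul]
        rw [this, inner_add_right, real_inner_smul_right A h]
        ring
    · have hl : Tendsto (fun y : ℝ => ρ * y) (𝓝[>] 0) (𝓝[>] 0) := by
        refine tendsto_nhdsWithin_iff.2 ⟨?_, ?_⟩
        · have : ContinuousAt (fun y : ℝ => ρ * y) 0 := by fun_prop
          have := this.tendsto
          rw [mul_zero] at this
          exact this.mono_left nhdsWithin_le_nhds
        · filter_upwards [self_mem_nhdsWithin] with y hy
          exact mul_pos hρ hy
      have a1 := (((h3.comp hl).const_mul κ).sub_const (e (κ * t) / σ * κ)).const_mul c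
      refine a1.congr' ?_
      filter_upwards [self_mem_nhdsWithin] with y hy
      have hy' : (0:ℝ) < y := hy
      simp only [Function.comp, mul_zero, Real.zero_rpow hσ.ne']
      rw [Real.mul_rpow hρ.le hy'.le, ← hκd]
      have := Real.rpow_pos_of_pos hy' σ
      field_simp
      ring
    · have e1 : c * (τ * κ - e (κ * t) * κ) - σ * (c * (κ * l - e (κ * t) / σ * κ)) =
        c * κ * (τ - σ * l) := by field_simp; ring
      rw [e1, abs_mul, abs_of_pos (by positivity)]
      have e2 : ‖p‖ ≤ ‖A‖ + ‖(c * ρ) • (p - A)‖ := by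
        rw [norm_smul, Real.norm_eq_abs, abs_of_pos (by positivity)]
        have : ‖p‖ ≤ ‖A‖ + ‖p - A‖ := by
          have := norm_add_le A (p - A)
          simpa using this
        nlinarith [norm_nonneg (p - A)]
      set P := (c * ρ) • (p - A)
      rw [norm_smul, Real.norm_eq_abs, abs_of_pos hρ, Real.mul_rpow hρ.le (norm_nonneg x)] at h4
      have hxθ := Real.rpow_nonneg (norm_nonneg x) θ
      have hρθ := Real.rpow_nonneg hρ.le θ
      calc c * κ * |τ - σ * l| ≤ c * κ * (δ * (ρ ^ θ * ‖x‖ ^ θ) * (1 + ‖p‖)) := by gcongr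
        _ = (c * κ * ρ ^ θ) * (δ * ‖x‖ ^ θ * (1 + ‖p‖)) := by ring
        _ ≤ 1 * (δ * ‖x‖ ^ θ * (1 + ‖p‖)) := by gcongr
        _ ≤ δ * ‖x‖ ^ θ * ((1 + ‖A‖) * (1 + ‖P‖)) := by
            rw [one_mul]
            gcongr
            nlinarith [norm_nonneg A, norm_nonneg P, mul_nonneg (norm_nonneg A) (norm_nonneg P)]
        _ = _ := by ring

def om (c γ σ r y : ℝ) : ℝ := r ^ γ - c * (y ^ σ * r ^ (γ - σ)) + c * (y ^ 2 * r ^ (γ - 2))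

theorem om_eq {c γ σ r y : ℝ} (hr : 0 < r) (hy : 0 ≤ y) :
    om c γ σ r y = r ^ γ * (1 - c * (y / r) ^ σ + c * (y / r) ^ 2) := by
  have h2 : r ^ (γ - 2) = r ^ γ / r ^ 2 := by
    rw [Real.rpow_sub hr]; norm_num
  unfold om
  rw [h2, Real.rpow_sub hr, Real.div_rpow hy hr.le, div_pow]
  ring

theorem rpow_neg_T2 {m d l q : ℝ} (hd : 0 < d) :
    T2 (fun s => (d + l * s + q * s ^ 2) ^ (-m)) (-m * d ^ (-m) / d * l)
      (m * (m + 1) * d ^ (-m) / d ^ 2 * l ^ 2 - 2 * m * q * d ^ (-m) / d) := by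
  have h := (T2.quad d l q).rpow (by simpa using hd) (-m)
  simp only [mul_zero, add_zero, ne_eq, OfNat.ofNat_ne_zero, not_false_eq_true, zero_pow] at h
  exact h.congr_val rfl (by ring)

theorem aux1 (z : ℝ) : z * (1 - z) ≤ 1 := by nlinarith [sq_nonneg (z - 1/2)]

theorem aux2 {g : ℝ} (h0 : 0 ≤ g) (h1 : g ≤ 1) : (2 - g) * (3 - g) ≤ 6 := by nlinarith

theorem aux3 {σ γ a b : ℝ} (hσ : 0 < σ) (hγ : σ < γ) (hγ1 : γ < 1) (a0 : 0 ≤ a) (a1 : a ≤ 1)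
    (b0 : 0 ≤ b) (b1 : b ≤ 1) : |-γ + (γ - σ) * a + (2 - γ) * b| ≤ 4 := by
  have h1 : 0 ≤ (γ - σ) * a := mul_nonneg (by linarith) a0
  have h2 : 0 ≤ (2 - γ) * b := mul_nonneg (by linarith) b0
  have h3 : (γ - σ) * a ≤ (γ - σ) * 1 := mul_le_mul_of_nonneg_left a1 (by linarith)
  have h4 : (2 - γ) * b ≤ (2 - γ) * 1 := mul_le_mul_of_nonneg_left b1 (by linarith)
  rw [abs_le]; constructor <;> linarith

theorem aux4 {e : ℝ} (h0 : 0 ≤ e) (h1 : e ≤ 1) : e ^ 2 ≤ e := by nlinarith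

set_option maxHeartbeats 2000000 in
theorem om_dir {c γ σ m r y d p l q Λ : ℝ} (hσ : 0 < σ) (hγ : σ < γ) (hγ1 : γ < 1) (hc : 0 ≤ c)
    (hc1 : c ≤ 1) (hr : 0 < r) (hr1 : r ≤ 1) (hd : 0 < d) (hrd : r ≤ d) (hy : 0 < y)
    (hcy : c = 0 ∨ y ≤ r) (hm : 0 < m) (hp : |p| ≤ 1) (hl : |l| ≤ Λ) (hq : |q| ≤ Λ) :
    ∃ M β, T2 (fun s => om c γ σ (r + p * s) y * (d + l * s + q * s ^ 2) ^ (-m)) M β ∧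
      β ≤ r ^ γ * d ^ (-m) / r ^ 2 * (p ^ 2 * (-(γ * (1 - γ)) + 7 * c) +
        (2 * m * (m + 1) * Λ ^ 2 + 12 * m * Λ) * (r / d)) := by
  have hpow : ∀ e : ℝ, T2 (fun s => (r + p * s) ^ e) (e * r ^ e / r * p)
      (e * (e - 1) * r ^ e / r ^ 2 * p ^ 2) := by
    intro e
    have h := (T2.quad r p 0).rpow (by simpa using hr) e
    simp only [mul_zero, add_zero, zero_mul] at h
    exact h
  have hom : T2 (fun s => om c γ σ (r + p * s) y)
      (γ * r ^ γ / r * p - c * (y ^ σ * ((γ - σ) * r ^ (γ - σ) / r * p)) +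
        c * (y ^ 2 * ((γ - 2) * r ^ (γ - 2) / r * p)))
      (γ * (γ - 1) * r ^ γ / r ^ 2 * p ^ 2 -
        c * (y ^ σ * ((γ - σ) * ((γ - σ) - 1) * r ^ (γ - σ) / r ^ 2 * p ^ 2)) +
        c * (y ^ 2 * ((γ - 2) * ((γ - 2) - 1) * r ^ (γ - 2) / r ^ 2 * p ^ 2))) :=
    ((hpow γ).sub (((hpow (γ - σ)).const_mul (y ^ σ)).const_mul c)).add
      (((hpow (γ - 2)).const_mul (y ^ 2)).const_mul c)
  have H := hom.mul (rpow_neg_T2 (m := m) (l := l) (q := q) hd)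
  refine ⟨_, _, H, ?_⟩
  have h2 : r ^ (γ - 2) = r ^ γ / r ^ 2 := by
    rw [Real.rpow_sub hr]; norm_num
  have hPp : 0 < r ^ γ := Real.rpow_pos_of_pos hr γ
  have hDp : 0 < d ^ (-m) := Real.rpow_pos_of_pos hd (-m)
  have hyσ : y ^ σ = (y / r) ^ σ * r ^ σ := by
    rw [Real.div_rpow hy.le hr.le]; field_simp
  have hq1 : 0 ≤ (y / r) ^ σ := Real.rpow_nonneg (by positivity) σ
  have hq1' : c * (y / r) ^ σ ≤ c := by
    rcases hcy with h | h
    · simp [h]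
    · exact mul_le_of_le_one_right hc (Real.rpow_le_one (by positivity) (by rwa [div_le_one hr]) hσ.le)
  have hq2' : c * (y / r) ^ 2 ≤ c := by
    rcases hcy with h | h
    · simp [h]
    · exact mul_le_of_le_one_right hc (pow_le_one₀ (by positivity) (by rwa [div_le_one hr]))
  have hq2 : 0 ≤ (y / r) ^ 2 := by positivity
  simp only [mul_zero, add_zero, ne_eq, OfNat.ofNat_ne_zero, not_false_eq_true, zero_pow]
  rw [om_eq hr hy.le, h2, Real.rpow_sub hr, hyσ]
  have hrσ : 0 < r ^ σ := Real.rpow_pos_of_pos hr σ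
  set P := r ^ γ
  set D := d ^ (-m)
  set q1 := (y / r) ^ σ
  set q2 := (y / r) ^ 2 with hq2d
  have hy2 : y ^ 2 = q2 * r ^ 2 := by rw [hq2d]; field_simp
  rw [hy2]
  set e := r / d with he
  have he0 : 0 < e := by positivity
  have he1 : e ≤ 1 := by rw [he, div_le_one hd]; exact hrd
  have hdr : d = r / e := by rw [he]; field_simp
  have key : (γ * (γ - 1) * P / r ^ 2 * p ^ 2 -
        c * (q1 * r ^ σ * ((γ - σ) * (γ - σ - 1) * (P / r ^ σ) / r ^ 2 * p ^ 2)) +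
        c * (q2 * r ^ 2 * ((γ - 2) * (γ - 2 - 1) * (P / r ^ 2) / r ^ 2 * p ^ 2))) * D +
      2 * ((γ * P / r * p - c * (q1 * r ^ σ * ((γ - σ) * (P / r ^ σ) / r * p)) +
        c * (q2 * r ^ 2 * ((γ - 2) * (P / r ^ 2) / r * p))) * (-m * D / d * l)) +
      P * (1 - c * q1 + c * q2) * (m * (m + 1) * D / d ^ 2 * l ^ 2 - 2 * m * q * D / d) =
      P * D / r ^ 2 * (p ^ 2 * (-(γ * (1 - γ)) + (γ - σ) * (1 - (γ - σ)) * (c * q1)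
        + (2 - γ) * (3 - γ) * (c * q2)) +
        (2 * m * (p * l) * (-γ + (γ - σ) * (c * q1) + (2 - γ) * (c * q2)) * e +
        (1 - c * q1 + c * q2) * (m * (m + 1) * l ^ 2 * e ^ 2 - 2 * m * q * (e * r)))) := by
    rw [hdr]; field_simp; ring
  rw [key]
  have k1 : (γ - σ) * (1 - (γ - σ)) ≤ 1 := aux1 _
  have g0 : 0 < γ := hσ.trans hγ
  have hcq1 : 0 ≤ c * q1 := by positivity
  have hcq2 : 0 ≤ c * q2 := by positivity
  have hΛ : 0 ≤ Λ := (abs_nonneg _).trans hl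
  apply mul_le_mul_of_nonneg_left _ (by positivity)
  have s1 : (γ - σ) * (1 - (γ - σ)) * (c * q1) ≤ c :=
    (mul_le_of_le_one_left hcq1 k1).trans hq1'
  have s2 : (2 - γ) * (3 - γ) * (c * q2) ≤ 6 * c := by
    have : (2 - γ) * (3 - γ) ≤ 6 := aux2 g0.le hγ1.le
    exact mul_le_mul this hq2' hcq2 (by norm_num)
  have s3 : p ^ 2 * (-(γ * (1 - γ)) + (γ - σ) * (1 - (γ - σ)) * (c * q1)
        + (2 - γ) * (3 - γ) * (c * q2)) ≤ p ^ 2 * (-(γ * (1 - γ)) + 7 * c) := by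
    apply mul_le_mul_of_nonneg_left _ (sq_nonneg p); linarith
  have hpl : |p * l| ≤ Λ := by
    rw [abs_mul]; exact (mul_le_of_le_one_left (abs_nonneg l) hp).trans hl
  have s4 : |-γ + (γ - σ) * (c * q1) + (2 - γ) * (c * q2)| ≤ 4 := by
    exact aux3 hσ hγ hγ1 hcq1 (hq1'.trans hc1) hcq2 (hq2'.trans hc1)
  have s5 : 2 * m * (p * l) * (-γ + (γ - σ) * (c * q1) + (2 - γ) * (c * q2)) * e ≤ 8 * m * Λ * e := by
    have : (p * l) * (-γ + (γ - σ) * (c * q1) + (2 - γ) * (c * q2)) ≤ Λ * 4 := by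
      refine (le_abs_self _).trans ?_
      rw [abs_mul]; gcongr
    have := mul_le_mul_of_nonneg_left this (show 0 ≤ 2 * m * e by positivity)
    linarith
  have hl2 : l ^ 2 ≤ Λ ^ 2 := by rw [← sq_abs]; gcongr
  have s6 : m * (m + 1) * l ^ 2 * e ^ 2 - 2 * m * q * (e * r) ≤ (m * (m + 1) * Λ ^ 2 + 2 * m * Λ) * e := by
    have a1 : m * (m + 1) * l ^ 2 * e ^ 2 ≤ m * (m + 1) * Λ ^ 2 * e := by
      have : e ^ 2 ≤ e := aux4 he0.le he1
      gcongr
    have a2 : -q * r ≤ Λ * 1 := by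
      have := neg_abs_le q
      gcongr
      linarith
    have := mul_le_mul_of_nonneg_left a2 (show 0 ≤ 2 * m * e by positivity)
    linarith
  have s7 : (1 - c * q1 + c * q2) * (m * (m + 1) * l ^ 2 * e ^ 2 - 2 * m * q * (e * r)) ≤
      2 * ((m * (m + 1) * Λ ^ 2 + 2 * m * Λ) * e) := by
    have b0 : 0 ≤ 1 - c * q1 + c * q2 := by linarith
    have b1 : 1 - c * q1 + c * q2 ≤ 2 := by linarith
    calc _ ≤ (1 - c * q1 + c * q2) * ((m * (m + 1) * Λ ^ 2 + 2 * m * Λ) * e) := by gcongr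
      _ ≤ _ := by gcongr
  linarith

set_option maxHeartbeats 2000000 in
theorem om_y {c γ σ m r y d Λ : ℝ} (hσ : 0 < σ) (hγ : σ < γ) (hγ1 : γ < 1) (hc : 0 ≤ c)
    (hc1 : c ≤ 1) (hr : 0 < r) (hr1 : r ≤ 1) (hd : 0 < d) (hrd : r ≤ d) (hy : 0 < y)
    (hcy : c = 0 ∨ y ≤ r) (hm : 0 < m) (hΛ : 0 ≤ Λ) (hy1 : 2 * y ≤ 1) :
    ∃ M β, T2 (fun s => om c γ σ r (y + s) * (d + (-2 * Λ * y) * s + (-Λ) * s ^ 2) ^ (-m)) M β ∧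
      β + (1 - σ) / y * M ≤ r ^ γ * d ^ (-m) / r ^ 2 * (4 * c +
        (2 * m * (m + 1) * Λ ^ 2 + 16 * m * Λ) * (r / d)) := by
  have hpow : T2 (fun s => (y + s) ^ σ) (σ * y ^ σ / y) (σ * (σ - 1) * y ^ σ / y ^ 2) := by
    have h := (T2.quad y 1 0).rpow (by simpa using hy) σ
    simp only [mul_zero, add_zero, zero_mul, one_mul, one_pow, mul_one] at h
    exact h
  have hsq : T2 (fun s => (y + s) ^ 2) (2 * y) 2 := by
    refine ((T2.quad (y ^ 2) (2 * y) 1).congr_ev (Eventually.of_forall fun s => ?_)).congr_val rfl (by norm_num)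
    ring
  have hom : T2 (fun s => om c γ σ r (y + s))
      (0 - c * (r ^ (γ - σ) * (σ * y ^ σ / y)) + c * (r ^ (γ - 2) * (2 * y)))
      (0 - c * (r ^ (γ - σ) * (σ * (σ - 1) * y ^ σ / y ^ 2)) + c * (r ^ (γ - 2) * 2)) := by
    have := ((T2.const (r ^ γ)).sub ((hpow.const_mul (r ^ (γ - σ))).const_mul c)).add
      ((hsq.const_mul (r ^ (γ - 2))).const_mul c)
    refine this.congr_ev (Eventually.of_forall fun s => ?_)
    unfold om; ring
  have H := hom.mul (rpow_neg_T2 (m := m) (l := -2 * Λ * y) (q := -Λ) hd)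
  refine ⟨_, _, H, ?_⟩
  have h2 : r ^ (γ - 2) = r ^ γ / r ^ 2 := by
    rw [Real.rpow_sub hr]; norm_num
  have hPp : 0 < r ^ γ := Real.rpow_pos_of_pos hr γ
  have hDp : 0 < d ^ (-m) := Real.rpow_pos_of_pos hd (-m)
  have hyσ : y ^ σ = (y / r) ^ σ * r ^ σ := by
    rw [Real.div_rpow hy.le hr.le]; field_simp
  have hq1 : 0 ≤ (y / r) ^ σ := Real.rpow_nonneg (by positivity) σ
  have hq1' : c * (y / r) ^ σ ≤ c := by
    rcases hcy with h | h
    · simp [h]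
    · exact mul_le_of_le_one_right hc (Real.rpow_le_one (by positivity) (by rwa [div_le_one hr]) hσ.le)
  have hq2' : c * (y / r) ^ 2 ≤ c := by
    rcases hcy with h | h
    · simp [h]
    · exact mul_le_of_le_one_right hc (pow_le_one₀ (by positivity) (by rwa [div_le_one hr]))
  have hq2 : 0 ≤ (y / r) ^ 2 := by positivity
  simp only [mul_zero, add_zero, ne_eq, OfNat.ofNat_ne_zero, not_false_eq_true, zero_pow]
  rw [om_eq hr hy.le, h2, Real.rpow_sub hr, hyσ]
  have hrσ : 0 < r ^ σ := Real.rpow_pos_of_pos hr σ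
  set P := r ^ γ
  set D := d ^ (-m)
  set q1 := (y / r) ^ σ
  set q2 := (y / r) ^ 2 with hq2d
  have hy2 : q2 = y ^ 2 / r ^ 2 := by rw [hq2d, div_pow]
  set e := r / d with he
  have he0 : 0 < e := by positivity
  have he1 : e ≤ 1 := by rw [he, div_le_one hd]; exact hrd
  have hdr : d = r / e := by rw [he]; field_simp
  have key : (0 - c * (P / r ^ σ * (σ * (σ - 1) * (q1 * r ^ σ) / y ^ 2)) + c * (P / r ^ 2 * 2)) * D +
          2 * ((0 - c * (P / r ^ σ * (σ * (q1 * r ^ σ) / y)) + c * (P / r ^ 2 * (2 * y))) *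
              (-m * D / d * (-2 * Λ * y))) +
        P * (1 - c * q1 + c * q2) * (m * (m + 1) * D / d ^ 2 * (-2 * Λ * y) ^ 2 - 2 * m * -Λ * D / d) +
      (1 - σ) / y *
        ((0 - c * (P / r ^ σ * (σ * (q1 * r ^ σ) / y)) + c * (P / r ^ 2 * (2 * y))) * D +
          P * (1 - c * q1 + c * q2) * (-m * D / d * (-2 * Λ * y))) =
      P * D / r ^ 2 * (2 * (2 - σ) * c + (4 * m * Λ * (-σ * (c * q1) + 2 * (c * q2)) * (e * r)
        + (1 - c * q1 + c * q2) * (m * (m + 1) * (Λ * (2 * y)) ^ 2 * e ^ 2 + 2 * m * Λ * (e * r)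
          + 2 * (1 - σ) * m * Λ * (e * r)))) := by
    rw [hdr, hy2]; field_simp; ring
  rw [key]
  have hcq1 : 0 ≤ c * q1 := by positivity
  have hcq2 : 0 ≤ c * q2 := by positivity
  apply mul_le_mul_of_nonneg_left _ (by positivity)
  have er : e * r ≤ e := mul_le_of_le_one_right he0.le hr1
  have er0 : 0 ≤ e * r := by positivity
  have s1 : 2 * (2 - σ) * c ≤ 4 * c :=
    mul_le_mul_of_nonneg_right (by linarith) hc
  have s2 : 4 * m * Λ * (-σ * (c * q1) + 2 * (c * q2)) * (e * r) ≤ 4 * m * Λ * 2 * e := by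
    have : -σ * (c * q1) + 2 * (c * q2) ≤ 2 := by
      have := mul_nonneg hσ.le hcq1
      linarith
    calc _ ≤ 4 * m * Λ * 2 * (e * r) := by gcongr
      _ ≤ _ := by gcongr
  have s6 : m * (m + 1) * (Λ * (2 * y)) ^ 2 * e ^ 2 + 2 * m * Λ * (e * r) + 2 * (1 - σ) * m * Λ * (e * r)
      ≤ (m * (m + 1) * Λ ^ 2 + 4 * m * Λ) * e := by
    have a1 : m * (m + 1) * (Λ * (2 * y)) ^ 2 * e ^ 2 ≤ m * (m + 1) * Λ ^ 2 * e := by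
      have : e ^ 2 ≤ e := aux4 he0.le he1
      have : Λ * (2 * y) ≤ Λ := mul_le_of_le_one_right hΛ hy1
      gcongr
    have a2 : 2 * m * Λ * (e * r) ≤ 2 * m * Λ * e := by gcongr
    have a3 : 2 * (1 - σ) * m * Λ * (e * r) ≤ 2 * 1 * m * Λ * e := by
      have : 0 ≤ 1 - σ := by linarith
      gcongr
      linarith
    linarith
  have s7 : (1 - c * q1 + c * q2) * (m * (m + 1) * (Λ * (2 * y)) ^ 2 * e ^ 2 + 2 * m * Λ * (e * r)
          + 2 * (1 - σ) * m * Λ * (e * r)) ≤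
      2 * ((m * (m + 1) * Λ ^ 2 + 4 * m * Λ) * e) := by
    have b0 : 0 ≤ 1 - c * q1 + c * q2 := by linarith
    have b1 : 1 - c * q1 + c * q2 ≤ 2 := by linarith
    calc _ ≤ (1 - c * q1 + c * q2) * ((m * (m + 1) * Λ ^ 2 + 4 * m * Λ) * e) := by gcongr
      _ ≤ _ := by gcongr
  linarith

theorem refl_basis {n : ℕ} (w : En n) (hw : ‖w‖ = 1) (b : OrthonormalBasis (Fin n) ℝ (En n)) :
    ∃ b' : OrthonormalBasis (Fin n) ℝ (En n), ∀ i, b' i = b i - (2 * ⟪w, b i⟫) • w := by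
  refine ⟨b.map (ℝ ∙ w)ᗮ.reflection, fun i => ?_⟩
  rw [OrthonormalBasis.map_apply, Submodule.reflection_orthogonal_apply,
    Submodule.reflection_singleton_apply]
  simp only [hw]
  rw [neg_sub]
  congr 1
  simp [two_smul, two_mul, add_smul]

set_option maxHeartbeats 1000000 in
theorem hl_int {n : ℕ} {σ γ m c Λ T R Z δ K ρ₁ d₀ d r t y : ℝ} {V : ℝ → En n → En n → ℝ → ℝ}
    {x ρ ξ₁ ξ₂ : En n} (hV : ClassA n σ T R Z δ V) (hσ : 0 < σ) (hγ : σ < γ) (hγ1 : γ < 1)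
    (hc : 0 ≤ c) (hc1 : c ≤ 1) (hm : 0 < m) (hΛ : 0 ≤ Λ) (hK : 0 < K)
    (ht : t ∈ Icc (-T) 0) (hx1 : ‖x + ρ‖ < R) (hx2 : ‖x - ρ‖ < R) (hξ₁ : ‖ξ₁‖ < Z) (hξ₂ : ‖ξ₂‖ < Z)
    (hy : 0 < y) (hyR : y < R) (hρ : ρ ≠ 0) (hr : r = ‖ρ‖ + ρ₁) (hr0 : 0 < r) (hr1 : r ≤ 1)
    (hd : d = d₀ - Λ * (‖x‖ ^ 2 + y ^ 2)) (hd0 : 0 < d) (hrd : r ≤ d) (hx : 2 * ‖x‖ ≤ 1)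
    (hy2 : 2 * y ≤ 1) (hcy : c = 0 ∨ y ≤ r)
    (touch : ∀ᶠ z : En n × En n × ℝ in 𝓝 (x, ρ, y),
      (V t (z.1 + z.2.1) ξ₁ z.2.2 - V t (z.1 - z.2.1) ξ₂ z.2.2)
        - (V t (x + ρ) ξ₁ y - V t (x - ρ) ξ₂ y) ≤
      K * (om c γ σ (‖z.2.1‖ + ρ₁) z.2.2 * (d₀ - Λ * (‖z.1‖ ^ 2 + z.2.2 ^ 2)) ^ (-m)) -
      K * (om c γ σ (‖ρ‖ + ρ₁) y * (d₀ - Λ * (‖x‖ ^ 2 + y ^ 2)) ^ (-m))) :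
    0 ≤ -(γ * (1 - γ)) + 11 * c + (n * (2 * m * (m + 1) * Λ ^ 2 + 12 * m * Λ) +
      (2 * m * (m + 1) * Λ ^ 2 + 16 * m * Λ)) * (r / d) := by
  obtain ⟨m₁, B₁, my₁, By₁, h1, h1y, h1b⟩ := hV.int t ht _ hx1 ξ₁ hξ₁ y hy hyR
  obtain ⟨m₂, B₂, my₂, By₂, h2, h2y, h2b⟩ := hV.int t ht _ hx2 ξ₂ hξ₂ y hy hyR
  have hρn : 0 < ‖ρ‖ := norm_pos_iff.2 hρ
  set w : En n := ‖ρ‖⁻¹ • ρ with hw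
  have hwn : ‖w‖ = 1 := by rw [hw, norm_smul, norm_inv, norm_norm, inv_mul_cancel₀ hρn.ne']
  have hρw : ρ = ‖ρ‖ • w := by rw [hw, smul_smul, mul_inv_cancel₀ hρn.ne', one_smul]
  set b := EuclideanSpace.basisFun (Fin n) ℝ
  obtain ⟨b', hb'⟩ := refl_basis w hwn b
  set p : Fin n → ℝ := fun i => ⟪w, b i⟫ with hp
  have hp2 : ∑ i, (p i) ^ 2 = 1 := by
    have := b.sum_sq_inner_left w
    rw [hwn] at this
    simpa using this
  have hp1 : ∀ i, |p i| ≤ 1 := by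
    intro i
    have := abs_real_inner_le_norm w (b i)
    rwa [hwn, b.norm_eq_one, mul_one] at this
  set v : Fin n → En n := fun i => b i - p i • w with hv
  have hvn : ∀ i, ‖v i‖ ≤ 1 := by
    intro i
    have : ‖v i‖ ^ 2 = 1 - (p i) ^ 2 := by
      rw [hv]
      simp only
      rw [norm_sub_sq_real, b.norm_eq_one, real_inner_smul_right, norm_smul, hwn, real_inner_comm]
      simp only [hp, Real.norm_eq_abs, mul_one, sq_abs]
      ring
    have h3 : ‖v i‖ ^ 2 ≤ 1 := by rw [this]; nlinarith [sq_nonneg (p i)]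
    exact (sq_le_one_iff₀ (norm_nonneg _)).1 h3
  have hdir : ∀ i, B₁ (b i) - B₂ (b' i) ≤ K * (r ^ γ * d ^ (-m) / r ^ 2 * ((p i) ^ 2 * (-(γ * (1 - γ)) + 7 * c) +
        (2 * m * (m + 1) * Λ ^ 2 + 12 * m * Λ) * (r / d))) := by
    intro i
    have hl : |-2 * Λ * ⟪x, v i⟫| ≤ Λ := by
      have a1 := abs_real_inner_le_norm x (v i)
      have a2 : ‖x‖ * ‖v i‖ ≤ ‖x‖ := mul_le_of_le_one_right (norm_nonneg x) (hvn i)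
      rw [abs_mul, abs_mul, abs_neg, abs_two, abs_of_nonneg hΛ]
      have : Λ * (2 * |⟪x, v i⟫|) ≤ Λ * 1 := by gcongr; linarith
      linarith
    have hq : |-Λ * ‖v i‖ ^ 2| ≤ Λ := by
      rw [abs_mul, abs_neg, abs_of_nonneg hΛ, abs_of_nonneg (by positivity)]
      exact mul_le_of_le_one_right hΛ (pow_le_one₀ (norm_nonneg _) (hvn i))
    obtain ⟨M, β, hT, hβ⟩ := om_dir hσ hγ hγ1 hc hc1 hr0 hr1 hd0 hrd hy hcy hm (hp1 i) hl hq
    refine (((h1 (b i)).sub (h2 (b' i))).touch (hT.const_mul K) ?_).2.trans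
      (mul_le_mul_of_nonneg_left hβ hK.le)
    have hcont : Tendsto (fun s : ℝ => ((x + s • v i, ρ + (s * p i) • w, y) : En n × En n × ℝ)) (𝓝 0)
        (𝓝 (x, ρ, y)) := by
      have : ContinuousAt (fun s : ℝ => ((x + s • v i, ρ + (s * p i) • w, y) : En n × En n × ℝ)) 0 := by
        fun_prop
      simpa using this.tendsto
    have hpos : ∀ᶠ s : ℝ in 𝓝 0, 0 < ‖ρ‖ + s * p i := by
      have : ContinuousAt (fun s : ℝ => ‖ρ‖ + s * p i) 0 := by fun_prop
      exact this.eventually (lt_mem_nhds (by simpa using hρn))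
    filter_upwards [hcont.eventually touch, hpos] with s hs hs2
    have e1 : x + s • v i + (ρ + (s * p i) • w) = x + ρ + s • b i := by
      simp only [hv]; module
    have e2 : x + s • v i - (ρ + (s * p i) • w) = x - ρ + s • b' i := by
      rw [hb']; simp only [hv, hp]; module
    have e3 : ‖ρ + (s * p i) • w‖ = ‖ρ‖ + s * p i := by
      conv_lhs => rw [hρw, ← add_smul]
      rw [norm_smul, hwn, mul_one, Real.norm_eq_abs, abs_of_pos hs2]
    have e4 : d₀ - Λ * (‖x + s • v i‖ ^ 2 + y ^ 2) =
        d + -2 * Λ * ⟪x, v i⟫ * s + -Λ * ‖v i‖ ^ 2 * s ^ 2 := by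
      rw [norm_add_sq_real, real_inner_smul_right, norm_smul, Real.norm_eq_abs, mul_pow, sq_abs, hd]
      ring
    have e5 : ‖ρ‖ + s * p i + ρ₁ = r + p i * s := by rw [hr]; ring
    rw [e1, e2, e3, e4, e5, ← hr, ← hd] at hs
    simpa using hs
  have hydir : (By₁ - By₂) + (1 - σ) / y * (my₁ - my₂) ≤ K * (r ^ γ * d ^ (-m) / r ^ 2 * (4 * c +
        (2 * m * (m + 1) * Λ ^ 2 + 16 * m * Λ) * (r / d))) := by
    obtain ⟨M, β, hT, hβ⟩ := om_y hσ hγ hγ1 hc hc1 hr0 hr1 hd0 hrd hy hcy hm hΛ hy2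
    obtain ⟨k1, k2⟩ := (h1y.sub h2y).touch (hT.const_mul K) (by
      have hcont : Tendsto (fun s : ℝ => ((x, ρ, y + s) : En n × En n × ℝ)) (𝓝 0)
          (𝓝 (x, ρ, y)) := by
        have : ContinuousAt (fun s : ℝ => ((x, ρ, y + s) : En n × En n × ℝ)) 0 := by
          fun_prop
        simpa using this.tendsto
      filter_upwards [hcont.eventually touch] with s hs
      have e4 : d₀ - Λ * (‖x‖ ^ 2 + (y + s) ^ 2) =
          d + -2 * Λ * y * s + -Λ * s ^ 2 := by
        rw [hd]; ring
      rw [e4, ← hr, ← hd] at hs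
      simpa using hs)
    have := mul_le_mul_of_nonneg_left hβ hK.le
    rw [k1]
    linarith
  have hsum := Finset.sum_le_sum fun i (_ : i ∈ Finset.univ) => hdir i
  rw [Finset.sum_sub_distrib, ← Finset.mul_sum, ← Finset.mul_sum, Finset.sum_add_distrib,
    ← Finset.sum_mul, hp2, Finset.sum_const, Finset.card_univ, Fintype.card_fin, nsmul_eq_mul] at hsum
  have q1 := h1b b
  have q2 := h2b b'
  have hfin : 0 ≤ K * (r ^ γ * d ^ (-m) / r ^ 2) * (-(γ * (1 - γ)) + 11 * c + (n * (2 * m * (m + 1) * Λ ^ 2 + 12 * m * Λ) +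
      (2 * m * (m + 1) * Λ ^ 2 + 16 * m * Λ)) * (r / d)) := by
    linarith
  have hPp : 0 < r ^ γ := Real.rpow_pos_of_pos hr0 γ
  have hDp : 0 < d ^ (-m) := Real.rpow_pos_of_pos hd0 (-m)
  exact nonneg_of_mul_nonneg_right hfin (by positivity)

theorem deriv_le_right {f g : ℝ → ℝ} {a b : ℝ} (hf : HasDerivAt f a 0) (hg : HasDerivAt g b 0)
    (h : ∀ᶠ s in 𝓝[>] (0:ℝ), f s - f 0 ≤ g s - g 0) : a ≤ b := by
  have h1 := (hasDerivWithinAt_iff_tendsto_slope' (s := Ioi (0:ℝ)) (by simp)).1 hf.hasDerivWithinAt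
  have h2 := (hasDerivWithinAt_iff_tendsto_slope' (s := Ioi (0:ℝ)) (by simp)).1 hg.hasDerivWithinAt
  refine le_of_tendsto_of_tendsto h1 h2 ?_
  filter_upwards [h, self_mem_nhdsWithin] with s hs hs0
  rw [slope_def_field, slope_def_field]
  have : (0:ℝ) < s := hs0
  rw [sub_zero]
  gcongr

theorem deriv_le_left {f g : ℝ → ℝ} {a b t : ℝ} (hf : HasDerivWithinAt f a (Iic t) t)
    (hg : HasDerivAt g b t) (h : ∀ᶠ s in 𝓝[<] t, f s - f t ≤ g s - g t) : b ≤ a := by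
  have h1 := (hasDerivWithinAt_iff_tendsto_slope' (s := Iio t) (by simp)).1
    (hf.mono Iio_subset_Iic_self)
  have h2 := (hasDerivWithinAt_iff_tendsto_slope' (s := Iio t) (by simp)).1 hg.hasDerivWithinAt
  refine le_of_tendsto_of_tendsto h2 h1 ?_
  filter_upwards [h, self_mem_nhdsWithin] with s hs hs0
  rw [slope_def_field, slope_def_field]
  have : s < t := hs0
  exact div_le_div_of_nonpos_of_le (by linarith) hs

theorem flux_lim {σ : ℝ} (hσ : 0 < σ) (hσ1 : σ < 1) {A C : ℝ → ℝ} {A' : ℝ} (hA : HasDerivAt A A' 0)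
    (hC : ContinuousAt C 0) :
    Tendsto (fun y => ((A y + y ^ σ * C y) - (A 0 + 0 ^ σ * C 0)) / y ^ σ) (𝓝[>] 0) (𝓝 (C 0)) := by
  have h1 := (hasDerivWithinAt_iff_tendsto_slope' (s := Ioi (0:ℝ)) (by simp)).1 hA.hasDerivWithinAt
  have h2 : Tendsto (fun y : ℝ => y ^ (1 - σ)) (𝓝[>] 0) (𝓝 0) := by
    have := ((Real.continuousAt_rpow_const 0 (1 - σ) (Or.inr (by linarith))).tendsto).mono_left
      (nhdsWithin_le_nhds (s := Ioi (0:ℝ)))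
    simpa [Real.zero_rpow (show (1 - σ) ≠ 0 by linarith)] using this
  have h3 := (h1.mul h2).add (hC.tendsto.mono_left (nhdsWithin_le_nhds (s := Ioi (0:ℝ))))
  rw [mul_zero, zero_add] at h3
  refine h3.congr' ?_
  filter_upwards [self_mem_nhdsWithin] with y hy
  have hy' : (0:ℝ) < y := hy
  have := Real.rpow_pos_of_pos hy' σ
  rw [slope_def_field, Real.rpow_sub hy', Real.rpow_one, Real.zero_rpow hσ.ne', sub_zero]
  field_simp
  ring

theorem norm_le_of_inner {n : ℕ} {p : En n} {C : ℝ} (hC : 0 ≤ C) (h : ∀ v, ⟪p, v⟫ ≤ C * ‖v‖) :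
    ‖p‖ ≤ C := by
  have := h p
  rw [real_inner_self_eq_norm_sq, sq] at this
  rcases (norm_nonneg p).eq_or_lt with h0 | h0
  · rwa [← h0]
  · exact le_of_mul_le_mul_right this h0

theorem grad_cmp {γ m r d : ℝ} (hr : 0 < r) (hd : 0 < d) (K Λ a l q : ℝ) :
    HasDerivAt (fun s : ℝ => K * ((r + s * a) ^ γ * (d - Λ * (s * l + s ^ 2 * q)) ^ (-m)))
      (K * (a * γ * r ^ (γ - 1) * d ^ (-m) + r ^ γ * (-(Λ * l) * (-m) * d ^ (-m - 1)))) 0 := by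
  have h1 : HasDerivAt (fun s : ℝ => r + s * a) a 0 := by
    simpa using ((hasDerivAt_id (0:ℝ)).mul_const a).const_add r
  have h2 : HasDerivAt (fun s : ℝ => d - Λ * (s * l + s ^ 2 * q)) (-(Λ * l)) 0 := by
    have := ((((hasDerivAt_id (0:ℝ)).mul_const l).add
      (((hasDerivAt_id (0:ℝ)).pow 2).mul_const q)).const_mul Λ).const_sub d
    simpa using this
  have h3 := h1.rpow_const (p := γ) (by left; simpa using hr.ne')
  have h4 := h2.rpow_const (p := -m) (by left; simpa using hd.ne')
  have := (h3.mul h4).const_mul K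
  simpa using this

/-- difference functional -/
def HF {n : ℕ} (V : ℝ → En n → En n → ℝ → ℝ) (z : ℝ × En n × En n × En n × En n × ℝ) : ℝ :=
  V z.1 (z.2.1 + z.2.2.1) z.2.2.2.1 z.2.2.2.2.2 - V z.1 (z.2.1 - z.2.2.1) z.2.2.2.2.1 z.2.2.2.2.2

/-- barrier -/
def HPhi {n : ℕ} (k K c γ σ T Λ m ρ₁ : ℝ) (z : ℝ × En n × En n × En n × En n × ℝ) : ℝ :=
  k * (‖z.2.2.2.1‖ ^ 2 + ‖z.2.2.2.2.1‖ ^ 2) +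
  K * (om c γ σ (‖z.2.2.1‖ + ρ₁) z.2.2.2.2.2 *
    (T + z.1 - Λ * (‖z.2.1‖ ^ 2 + z.2.2.2.2.2 ^ 2)) ^ (-m))

theorem om_zero {c γ σ r : ℝ} (hσ : 0 < σ) : om c γ σ r 0 = r ^ γ := by
  unfold om
  rw [Real.zero_rpow hσ.ne']
  simp

set_option maxHeartbeats 1000000 in
theorem hl_bd {n : ℕ} {σ γ m c Λ T R Z δ K k ρ₁ d r t : ℝ} {V : ℝ → En n → En n → ℝ → ℝ}
    {x ρ ξ₁ ξ₂ : En n} (hV : ClassA n σ T R Z δ V) (hσ : 0 < σ) (hσ1 : σ < 1) (hγ : 0 < γ)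
    (hγ1 : γ ≤ 1) (hm : 0 < m) (hΛ : 0 ≤ Λ) (hK : 0 < K) (hk : 0 ≤ k) (hδ : 0 ≤ δ)
    (ht : t ∈ Ioc (-T) 0) (hx1 : ‖x + ρ‖ < R) (hx2 : ‖x - ρ‖ < R) (hξ₁ : ‖ξ₁‖ < Z) (hξ₂ : ‖ξ₂‖ < Z)
    (hρ₁ : 0 ≤ ρ₁) (hr : r = ‖ρ‖ + ρ₁) (hr0 : 0 < r)
    (hd : d = T + t - Λ * ‖x‖ ^ 2) (hd0 : 0 < d) (hrd : r ≤ d) (hx : 2 * ‖x‖ ≤ 1)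
    (touch : ∀ᶠ z : ℝ × En n × En n × En n × En n × ℝ in 𝓝 (t, x, ρ, ξ₁, ξ₂, 0),
      z.1 ≤ t → 0 ≤ z.2.2.2.2.2 → HF V z - HF V (t, x, ρ, ξ₁, ξ₂, 0) ≤
      HPhi k K c γ σ T Λ m ρ₁ z - HPhi k K c γ σ T Λ m ρ₁ (t, x, ρ, ξ₁, ξ₂, 0)) :
    -(m * K * r ^ γ * d ^ (-m) / d) ≤ -(σ * c * K * r ^ (γ - σ) * d ^ (-m)) +
      δ * (2 + 2 * (K * r ^ γ * d ^ (-m) * (1 + m * Λ) / r) + 4 * k * Z) := by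
  obtain ⟨τ1, l1, p1, q1, hτ1, hp1, hq1, hl1, he1⟩ := hV.bdry t ht _ hx1 ξ₁ hξ₁
  obtain ⟨τ2, l2, p2, q2, hτ2, hp2, hq2, hl2, he2⟩ := hV.bdry t ht _ hx2 ξ₂ hξ₂
  have hP : 0 < r ^ γ := Real.rpow_pos_of_pos hr0 _
  have hD : 0 < d ^ (-m) := Real.rpow_pos_of_pos hd0 _
  have hdm : d ^ (-m - 1) = d ^ (-m) / d := by rw [Real.rpow_sub hd0, Real.rpow_one]
  have hrg : r ^ (γ - 1) = r ^ γ / r := by rw [Real.rpow_sub hr0, Real.rpow_one]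
  -- time
  have htime : -(m * K * r ^ γ * d ^ (-m) / d) ≤ τ1 - τ2 := by
    have hg : HasDerivAt (fun t' : ℝ => K * (r ^ γ * (T + t' - Λ * ‖x‖ ^ 2) ^ (-m)))
        (K * (r ^ γ * (1 * (-m) * (T + t - Λ * ‖x‖ ^ 2) ^ (-m - 1)))) t := by
      have h1 : HasDerivAt (fun t' : ℝ => T + t' - Λ * ‖x‖ ^ 2) 1 t :=
        ((hasDerivAt_id t).const_add T).sub_const _
      exact ((h1.rpow_const (p := -m) (by left; rw [← hd]; exact hd0.ne')).const_mul _).const_mul K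
    have := deriv_le_left (hτ1.sub hτ2) hg (by
      have hc : Tendsto (fun t' : ℝ => ((t', x, ρ, ξ₁, ξ₂, 0) : ℝ × En n × En n × En n × En n × ℝ))
          (𝓝[<] t) (𝓝 (t, x, ρ, ξ₁, ξ₂, 0)) := by
        have : ContinuousAt (fun t' : ℝ =>
          ((t', x, ρ, ξ₁, ξ₂, 0) : ℝ × En n × En n × En n × En n × ℝ)) t := by fun_prop
        exact this.tendsto.mono_left nhdsWithin_le_nhds
      filter_upwards [hc.eventually touch, self_mem_nhdsWithin] with s hs hst
      have h1 := hs (le_of_lt hst) le_rfl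
      simp only [HF, HPhi, om_zero hσ, ← hr] at h1
      simp only [Pi.sub_apply]
      norm_num at h1 ⊢
      linarith)
    refine le_trans (le_of_eq ?_) this
    rw [← hd, hdm]
    ring
  -- flux
  have hflux : l1 - l2 ≤ -(c * K * r ^ (γ - σ) * d ^ (-m)) := by
    have hgd : HasDerivAt (fun y : ℝ => (d - Λ * y ^ 2) ^ (-m)) 0 0 := by
      have h2 : HasDerivAt (fun y : ℝ => d - Λ * y ^ 2) 0 0 := by
        simpa using (((hasDerivAt_id (0:ℝ)).pow 2).const_mul Λ).const_sub d
      simpa using h2.rpow_const (p := -m) (by left; simpa using hd0.ne')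
    have hA : HasDerivAt (fun y : ℝ => K * ((r ^ γ + c * (y ^ 2 * r ^ (γ - 2))) *
        (d - Λ * y ^ 2) ^ (-m))) 0 0 := by
      have h2 : HasDerivAt (fun y : ℝ => r ^ γ + c * (y ^ 2 * r ^ (γ - 2))) 0 0 := by
        simpa using ((((hasDerivAt_id (0:ℝ)).pow 2).mul_const (r ^ (γ - 2))).const_mul c).const_add
          (r ^ γ)
      simpa using (h2.mul hgd).const_mul K
    have hC : ContinuousAt (fun y : ℝ => -(c * K * r ^ (γ - σ)) * (d - Λ * y ^ 2) ^ (-m)) 0 :=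
      (hgd.const_mul _).continuousAt
    have hlim := flux_lim hσ hσ1 hA hC
    have h0 : -(c * K * r ^ (γ - σ)) * (d - Λ * (0:ℝ) ^ 2) ^ (-m) =
        -(c * K * r ^ (γ - σ) * d ^ (-m)) := by
      norm_num
    rw [h0] at hlim
    refine le_of_tendsto_of_tendsto (hl1.sub hl2) hlim ?_
    have hc : Tendsto (fun y : ℝ => ((t, x, ρ, ξ₁, ξ₂, y) : ℝ × En n × En n × En n × En n × ℝ))
        (𝓝[>] 0) (𝓝 (t, x, ρ, ξ₁, ξ₂, 0)) := by
      have : ContinuousAt (fun y : ℝ =>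
        ((t, x, ρ, ξ₁, ξ₂, y) : ℝ × En n × En n × En n × En n × ℝ)) 0 := by fun_prop
      exact this.tendsto.mono_left nhdsWithin_le_nhds
    filter_upwards [hc.eventually touch, self_mem_nhdsWithin] with y hy hy0
    have hy0' : (0:ℝ) < y := hy0
    have h1 := hy le_rfl hy0'.le
    simp only [HF, HPhi, om_zero hσ, ← hr] at h1
    rw [← sub_div]
    have hyσ := Real.rpow_pos_of_pos hy0' σ
    refine (div_le_div_iff_of_pos_right hyσ).2 ?_
    have e1 : T + t - Λ * (‖x‖ ^ 2 + y ^ 2) = d - Λ * y ^ 2 := by rw [hd]; ring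
    have e2 : T + t - Λ * (‖x‖ ^ 2 + (0:ℝ) ^ 2) = d := by rw [hd]; ring
    rw [e1, e2] at h1
    unfold om at h1
    rw [Real.zero_rpow hσ.ne']
    have e3 : d - Λ * (0:ℝ) ^ 2 = d := by ring
    rw [e3]
    linarith
  -- gradients
  have hgb : ∀ h : En n, K * ((‖h‖ / 2) * γ * r ^ (γ - 1) * d ^ (-m) + r ^ γ *
      (-(Λ * ⟪x, h⟫) * (-m) * d ^ (-m - 1))) ≤
      (K * r ^ γ * d ^ (-m) * (1 + m * Λ) / r) * ‖h‖ := by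
    intro h
    have h1 : ⟪x, h⟫ ≤ ‖h‖ := by
      have := real_inner_le_norm x h
      have : ‖x‖ * ‖h‖ ≤ 1 * ‖h‖ := by gcongr; linarith [norm_nonneg x]
      linarith
    have h2 : ‖h‖ / 2 * γ ≤ ‖h‖ := by
      have := mul_le_of_le_one_right (norm_nonneg h) hγ1
      linarith [mul_nonneg (norm_nonneg h) hγ.le]
    have h3 : d ^ (-m) / d ≤ d ^ (-m) / r := by gcongr
    rw [hdm, hrg]
    calc K * ((‖h‖ / 2) * γ * (r ^ γ / r) * d ^ (-m) + r ^ γ *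
      (-(Λ * ⟪x, h⟫) * (-m) * (d ^ (-m) / d))) = K * ((‖h‖ / 2 * γ) * (r ^ γ / r) * d ^ (-m) + r ^ γ *
      (m * Λ * ⟪x, h⟫ * (d ^ (-m) / d))) := by ring
      _ ≤ K * (‖h‖ * (r ^ γ / r) * d ^ (-m) + r ^ γ * (m * Λ * ‖h‖ * (d ^ (-m) / r))) := by
        gcongr
      _ = _ := by ring
  have hG0 : 0 ≤ K * r ^ γ * d ^ (-m) * (1 + m * Λ) / r := by positivity
  have hgrad : ∀ (e : ℝ) (_ : e = 1 ∨ e = -1) (h : En n) (f : ℝ → ℝ) (a : ℝ), HasDerivAt f a 0 →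
      (∀ s, f s = HF V (t, x + (s / 2) • h, ρ + (e * s / 2) • h, ξ₁, ξ₂, 0)) →
      a ≤ (K * r ^ γ * d ^ (-m) * (1 + m * Λ) / r) * ‖h‖ := by
    intro e he h f a hf hfs
    refine le_trans ?_ (hgb h)
    refine deriv_le_right hf (grad_cmp (γ := γ) (m := m) hr0 hd0 K Λ (‖h‖ / 2) ⟪x, h⟫ (‖h‖ ^ 2 / 4)) ?_
    have hc : Tendsto (fun s : ℝ => ((t, x + (s / 2) • h, ρ + (e * s / 2) • h, ξ₁, ξ₂, 0) :
        ℝ × En n × En n × En n × En n × ℝ)) (𝓝[>] 0) (𝓝 (t, x, ρ, ξ₁, ξ₂, 0)) := by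
      have : ContinuousAt (fun s : ℝ => ((t, x + (s / 2) • h, ρ + (e * s / 2) • h, ξ₁, ξ₂, 0) :
        ℝ × En n × En n × En n × En n × ℝ)) 0 := by fun_prop
      have := this.tendsto.mono_left (nhdsWithin_le_nhds (s := Ioi (0:ℝ)))
      simpa using this
    have hpos : ∀ᶠ s : ℝ in 𝓝[>] 0, 0 < d - Λ * (s * ⟪x, h⟫ + s ^ 2 * (‖h‖ ^ 2 / 4)) := by
      have : ContinuousAt (fun s : ℝ => d - Λ * (s * ⟪x, h⟫ + s ^ 2 * (‖h‖ ^ 2 / 4))) 0 := by fun_prop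
      have := this.tendsto.mono_left (nhdsWithin_le_nhds (s := Ioi (0:ℝ)))
      exact this.eventually (lt_mem_nhds (by simpa using hd0))
    filter_upwards [hc.eventually touch, hpos, self_mem_nhdsWithin] with s hs hp hs0
    have hs0' : (0:ℝ) < s := hs0
    have h1 := hs le_rfl le_rfl
    rw [← hfs s] at h1
    have hf0 : HF V (t, x, ρ, ξ₁, ξ₂, 0) = f 0 := by rw [hfs 0]; simp
    rw [hf0] at h1
    refine h1.trans ?_
    simp only [HPhi, om_zero hσ, ← hr]
    have e1 : T + t - Λ * (‖x + (s / 2) • h‖ ^ 2 + (0:ℝ) ^ 2) =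
        d - Λ * (s * ⟪x, h⟫ + s ^ 2 * (‖h‖ ^ 2 / 4)) := by
      rw [hd, norm_add_sq_real, norm_smul, real_inner_smul_right, Real.norm_eq_abs,
        abs_of_pos (by positivity)]
      ring
    have e2 : T + t - Λ * (‖x‖ ^ 2 + (0:ℝ) ^ 2) = d := by rw [hd]; ring
    have e3 : ‖ρ + (e * s / 2) • h‖ + ρ₁ ≤ r + s * (‖h‖ / 2) := by
      have := norm_add_le ρ ((e * s / 2) • h)
      have h5 : ‖(e * s / 2) • h‖ = s * (‖h‖ / 2) := by
        rw [norm_smul, Real.norm_eq_abs, abs_div, abs_mul, abs_of_pos hs0']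
        rcases he with rfl | rfl <;> simp <;> ring
      linarith
    have e4 : 0 ≤ ‖ρ + (e * s / 2) • h‖ + ρ₁ := by positivity
    rw [e1, e2]
    have e5 : (‖ρ + (e * s / 2) • h‖ + ρ₁) ^ γ ≤ (r + s * (‖h‖ / 2)) ^ γ :=
      Real.rpow_le_rpow e4 e3 hγ.le
    have e6 := Real.rpow_pos_of_pos hp (-m)
    have e7 := mul_le_mul_of_nonneg_left (mul_le_mul_of_nonneg_right e5 e6.le) hK.le
    have e8 : r + 0 * (‖h‖ / 2) = r := by ring
    have e9 : d - Λ * (0 * ⟪x, h⟫ + (0:ℝ) ^ 2 * (‖h‖ ^ 2 / 4)) = d := by ring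
    rw [e8, e9]
    linarith
  have hp1b : ‖p1‖ ≤ K * r ^ γ * d ^ (-m) * (1 + m * Λ) / r := by
    refine norm_le_of_inner hG0 fun v => ?_
    refine hgrad 1 (Or.inl rfl) v _ _ ((hp1 v).sub_const (V t (x - ρ) ξ₂ 0)) fun s => ?_
    simp only [HF]
    congr 2
    · module
    · module
  have hp2b : ‖p2‖ ≤ K * r ^ γ * d ^ (-m) * (1 + m * Λ) / r := by
    rw [← norm_neg]
    refine norm_le_of_inner hG0 fun v => ?_
    rw [inner_neg_left]
    refine hgrad (-1) (Or.inr rfl) v _ _ ((hp2 v).const_sub (V t (x + ρ) ξ₁ 0)) fun s => ?_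
    simp only [HF]
    congr 2
    · module
    · module
  have hsq : ∀ (ξ h : En n), HasDerivAt (fun s : ℝ => k * ‖ξ + s • h‖ ^ 2) (k * (2 * ⟪ξ, h⟫)) 0 := by
    intro ξ h
    have h1 : HasDerivAt (fun s : ℝ => ξ + s • h) h 0 := by
      simpa using ((hasDerivAt_id (0:ℝ)).smul_const h).const_add ξ
    simpa using (h1.norm_sq).const_mul k
  have hin : ∀ ξ : En n, ‖ξ‖ < Z → ∀ h, k * (2 * ⟪ξ, h⟫) ≤ 2 * k * Z * ‖h‖ := by
    intro ξ hξ h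
    have := real_inner_le_norm ξ h
    have : ‖ξ‖ * ‖h‖ ≤ Z * ‖h‖ := by gcongr
    have : k * (2 * ⟪ξ, h⟫) ≤ k * (2 * (Z * ‖h‖)) := by gcongr; linarith
    linarith
  have hZ : 0 ≤ Z := (norm_nonneg _).trans hξ₁.le
  have hq1b : ‖q1‖ ≤ 2 * k * Z := by
    refine norm_le_of_inner (by positivity) fun v => le_trans ?_ (hin ξ₁ hξ₁ v)
    refine deriv_le_right (hq1 v) (hsq ξ₁ v) ?_
    have hc : Tendsto (fun s : ℝ => ((t, x, ρ, ξ₁ + s • v, ξ₂, 0) :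
        ℝ × En n × En n × En n × En n × ℝ)) (𝓝[>] 0) (𝓝 (t, x, ρ, ξ₁, ξ₂, 0)) := by
      have : ContinuousAt (fun s : ℝ => ((t, x, ρ, ξ₁ + s • v, ξ₂, 0) :
        ℝ × En n × En n × En n × En n × ℝ)) 0 := by fun_prop
      have := this.tendsto.mono_left (nhdsWithin_le_nhds (s := Ioi (0:ℝ)))
      simpa using this
    filter_upwards [hc.eventually touch] with s hs
    have h1 := hs le_rfl le_rfl
    simp only [HF, HPhi] at h1
    rw [zero_smul, add_zero]
    linarith
  have hq2b : ‖q2‖ ≤ 2 * k * Z := by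
    rw [← norm_neg]
    refine norm_le_of_inner (by positivity) fun v => le_trans ?_ (hin ξ₂ hξ₂ v)
    rw [inner_neg_left]
    refine deriv_le_right (hq2 v).neg (hsq ξ₂ v) ?_
    have hc : Tendsto (fun s : ℝ => ((t, x, ρ, ξ₁, ξ₂ + s • v, 0) :
        ℝ × En n × En n × En n × En n × ℝ)) (𝓝[>] 0) (𝓝 (t, x, ρ, ξ₁, ξ₂, 0)) := by
      have : ContinuousAt (fun s : ℝ => ((t, x, ρ, ξ₁, ξ₂ + s • v, 0) :
        ℝ × En n × En n × En n × En n × ℝ)) 0 := by fun_prop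
      have := this.tendsto.mono_left (nhdsWithin_le_nhds (s := Ioi (0:ℝ)))
      simpa using this
    filter_upwards [hc.eventually touch] with s hs
    have h1 := hs le_rfl le_rfl
    simp only [HF, HPhi] at h1
    simp only [Pi.neg_apply]
    rw [zero_smul, add_zero]
    linarith
  have hδ1 : δ * (1 + ‖p1‖ + ‖q1‖) ≤ δ * (1 + K * r ^ γ * d ^ (-m) * (1 + m * Λ) / r + 2 * k * Z) := by
    gcongr
  have hδ2 : δ * (1 + ‖p2‖ + ‖q2‖) ≤ δ * (1 + K * r ^ γ * d ^ (-m) * (1 + m * Λ) / r + 2 * k * Z) := by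
    gcongr
  have a1 := (abs_le.1 he1).2
  have a2 := (abs_le.1 he2).1
  have a3 : σ * (l1 - l2) ≤ σ * (-(c * K * r ^ (γ - σ) * d ^ (-m))) := by gcongr
  linarith

/-- truncated modulus -/
def om2 (c γ σ r y : ℝ) : ℝ := min (om c γ σ r y) (r ^ γ)

theorem om_le {c γ σ r y : ℝ} (hσ1 : σ < 1) (hc : 0 ≤ c) (hr : 0 < r) (hy : 0 ≤ y) (hyr : y ≤ r) :
    om c γ σ r y ≤ r ^ γ := by
  rw [om_eq hr hy]
  have h0 : 0 ≤ y / r := by positivity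
  have h1 : y / r ≤ 1 := (div_le_one hr).2 hyr
  have h2 : (y / r) ^ 2 ≤ (y / r) ^ σ := by
    rcases h0.eq_or_lt with h | h
    · rw [← h]; simp [Real.rpow_nonneg]
    · rw [← Real.rpow_natCast]
      exact Real.rpow_le_rpow_of_exponent_ge h h1 (by push_cast; linarith)
  have h3 : 0 < r ^ γ := Real.rpow_pos_of_pos hr γ
  have : c * (y / r) ^ 2 ≤ c * (y / r) ^ σ := by gcongr
  exact mul_le_of_le_one_right h3.le (by linarith)

theorem om_ge {c γ σ r y : ℝ} (hσ1 : σ < 1) (hc : 0 ≤ c) (hr : 0 < r) (hyr : r ≤ y) :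
    r ^ γ ≤ om c γ σ r y := by
  rw [om_eq hr (hr.le.trans hyr)]
  have h1 : 1 ≤ y / r := (one_le_div hr).2 hyr
  have h2 : (y / r) ^ σ ≤ (y / r) ^ 2 := by
    rw [← Real.rpow_natCast]
    exact Real.rpow_le_rpow_of_exponent_le h1 (by push_cast; linarith)
  have h3 : 0 < r ^ γ := Real.rpow_pos_of_pos hr γ
  have : c * (y / r) ^ σ ≤ c * (y / r) ^ 2 := by gcongr
  exact le_mul_of_one_le_right h3.le (by linarith)

theorem om2_half {c γ σ r y : ℝ} (hσ : 0 < σ) (hσ1 : σ < 1) (hc : 0 ≤ c) (hc1 : c ≤ 1 / 2) (hr : 0 < r)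
    (hy : 0 ≤ y) : r ^ γ / 2 ≤ om2 c γ σ r y := by
  have h3 : 0 < r ^ γ := Real.rpow_pos_of_pos hr γ
  refine le_min ?_ (by linarith)
  rcases le_total y r with h | h
  · rw [om_eq hr hy]
    have h0 : 0 ≤ y / r := by positivity
    have h1 : y / r ≤ 1 := (div_le_one hr).2 h
    have h4 : (y / r) ^ σ ≤ 1 := Real.rpow_le_one h0 h1 hσ.le
    have h5 : c * (y / r) ^ σ ≤ c * 1 := by gcongr
    have h6 : 0 ≤ c * (y / r) ^ 2 := by positivity
    have : r ^ γ * (1 / 2) ≤ r ^ γ * (1 - c * (y / r) ^ σ + c * (y / r) ^ 2) := by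
      gcongr; linarith
    linarith
  · have := om_ge (γ := γ) hσ1 hc hr h
    linarith

theorem om2_touch {c γ σ r y : ℝ} (hσ1 : σ < 1) (hc : 0 ≤ c) (hr : 0 < r) (hy : 0 ≤ y) :
    ∃ c', 0 ≤ c' ∧ c' ≤ c ∧ (c' = 0 ∨ y ≤ r) ∧ (y = 0 → c' = c) ∧ om2 c γ σ r y = om c' γ σ r y ∧
      ∀ r' y', om2 c γ σ r' y' ≤ om c' γ σ r' y' := by
  rcases le_or_gt y r with h | h
  · exact ⟨c, hc, le_rfl, Or.inr h, fun _ => rfl, min_eq_left (om_le hσ1 hc hr hy h),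
      fun r' y' => min_le_left _ _⟩
  · refine ⟨0, le_rfl, hc, Or.inl rfl, fun h0 => by linarith, ?_, fun r' y' => ?_⟩
    · rw [om2, min_eq_right (om_ge hσ1 hc hr h.le)]; simp [om]
    · refine (min_le_right _ _).trans (by simp [om])

theorem om2_cont {X : Type*} [TopologicalSpace X] {c γ σ : ℝ} (hσ : 0 < σ) {f g : X → ℝ} {S : Set X}
    (hf : ContinuousOn f S) (hg : ContinuousOn g S) (hf0 : ∀ x ∈ S, 0 < f x) :
    ContinuousOn (fun x => om2 c γ σ (f x) (g x)) S := by
  have hp : ∀ e : ℝ, ContinuousOn (fun x => f x ^ e) S := fun e =>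
    hf.rpow_const fun x hx => Or.inl (hf0 x hx).ne'
  have hq : ContinuousOn (fun x => g x ^ σ) S := hg.rpow_const fun x hx => Or.inr hσ.le
  unfold om2 om
  refine ContinuousOn.inf ?_ (hp γ)
  exact (((hp γ).sub (continuousOn_const.mul (hq.mul (hp _))))).add
    (continuousOn_const.mul ((hg.pow 2).mul (hp _)))

theorem ev_lt {X : Type*} [TopologicalSpace X] {f : X → ℝ} {c : ℝ} (a : X) (hf : Continuous f)
    (h : f a < c) : ∀ᶠ z in 𝓝 a, f z < c := hf.continuousAt.eventually (gt_mem_nhds h)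

theorem ev_gt {X : Type*} [TopologicalSpace X] {f : X → ℝ} {c : ℝ} (a : X) (hf : Continuous f)
    (h : c < f a) : ∀ᶠ z in 𝓝 a, c < f z := hf.continuousAt.eventually (lt_mem_nhds h)

/-- compact domain -/
def HK (n : ℕ) (T R Z Λ : ℝ) : Set (ℝ × En n × En n × En n × En n × ℝ) :=
  (Icc (-T) 0 ×ˢ Metric.closedBall 0 (R / 2) ×ˢ Metric.closedBall 0 (R / 4) ×ˢ
    Metric.closedBall 0 Z ×ˢ Metric.closedBall 0 Z ×ˢ Icc 0 (R / 2)) ∩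
  {z | 0 ≤ T + z.1 - Λ * (‖z.2.1‖ ^ 2 + z.2.2.2.2.2 ^ 2)}

theorem HK_compact (n : ℕ) (T R Z Λ : ℝ) : IsCompact (HK n T R Z Λ) := by
  refine IsCompact.inter_right ?_ ?_
  · exact isCompact_Icc.prod ((isCompact_closedBall _ _).prod ((isCompact_closedBall _ _).prod
      ((isCompact_closedBall _ _).prod ((isCompact_closedBall _ _).prod isCompact_Icc))))
  · exact isClosed_le continuous_const (by fun_prop)

theorem mem_HK {n : ℕ} {T R Z Λ : ℝ} {t : ℝ} {x ρ ξ₁ ξ₂ : En n} {y : ℝ} :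
    (t, x, ρ, ξ₁, ξ₂, y) ∈ HK n T R Z Λ ↔ ((-T ≤ t ∧ t ≤ 0) ∧ ‖x‖ ≤ R / 2 ∧ ‖ρ‖ ≤ R / 4 ∧ ‖ξ₁‖ ≤ Z ∧
      ‖ξ₂‖ ≤ Z ∧ 0 ≤ y ∧ y ≤ R / 2) ∧ 0 ≤ T + t - Λ * (‖x‖ ^ 2 + y ^ 2) := by
  simp only [HK, mem_inter_iff, mem_prod, Metric.mem_closedBall, dist_zero_right, mem_Icc]
  exact Iff.rfl

/-- quotient to be maximized -/
def HT {n : ℕ} (V : ℝ → En n → En n → ℝ → ℝ) (k c γ σ T Λ m ρ₁ : ℝ)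
    (z : ℝ × En n × En n × En n × En n × ℝ) : ℝ :=
  (HF V z - k * (‖z.2.2.2.1‖ ^ 2 + ‖z.2.2.2.2.1‖ ^ 2)) *
    (T + z.1 - Λ * (‖z.2.1‖ ^ 2 + z.2.2.2.2.2 ^ 2)) ^ m /
    om2 c γ σ (‖z.2.2.1‖ + ρ₁) z.2.2.2.2.2

theorem HT_cont {n : ℕ} {σ γ m c Λ T R Z δ k ρ₁ : ℝ} {V : ℝ → En n → En n → ℝ → ℝ}
    (hV : ClassA n σ T R (2 * Z) δ V) (hσ : 0 < σ) (hσ1 : σ < 1) (hm : 0 < m) (hc : 0 ≤ c)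
    (hc1 : c ≤ 1 / 2) (hR : 0 < R) (hZ : 0 < Z) (hρ₁ : 0 < ρ₁) :
    ContinuousOn (HT V k c γ σ T Λ m ρ₁) (HK n T R Z Λ) := by
  unfold HT
  refine ContinuousOn.div (ContinuousOn.mul (ContinuousOn.sub ?_ (by fun_prop)) ?_) ?_ ?_
  · unfold HF
    refine ContinuousOn.sub ?_ ?_
    · refine hV.cont.comp (f := fun z : ℝ × En n × En n × En n × En n × ℝ =>
        (z.1, z.2.1 + z.2.2.1, z.2.2.2.1, z.2.2.2.2.2)) (by fun_prop) ?_
      rintro ⟨t, x, ρ, ξ₁, ξ₂, y⟩ hz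
      obtain ⟨⟨ht, hx, hρ, h1, h2, hy⟩, hd⟩ := mem_HK.1 hz
      have := norm_add_le x ρ
      exact ⟨ht.1, ht.2, by simp only; linarith, by simp only; linarith, hy.1, by simp only; linarith [hy.2]⟩
    · refine hV.cont.comp (f := fun z : ℝ × En n × En n × En n × En n × ℝ =>
        (z.1, z.2.1 - z.2.2.1, z.2.2.2.2.1, z.2.2.2.2.2)) (by fun_prop) ?_
      rintro ⟨t, x, ρ, ξ₁, ξ₂, y⟩ hz
      obtain ⟨⟨ht, hx, hρ, h1, h2, hy⟩, hd⟩ := mem_HK.1 hz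
      have := norm_sub_le x ρ
      exact ⟨ht.1, ht.2, by simp only; linarith, by simp only; linarith, hy.1, by simp only; linarith [hy.2]⟩
  · exact ContinuousOn.rpow_const (by fun_prop) fun x hx => Or.inr hm.le
  · refine om2_cont hσ (by fun_prop) (by fun_prop) fun z hz => by positivity
  · rintro ⟨t, x, ρ, ξ₁, ξ₂, y⟩ hz
    obtain ⟨⟨ht, hx, hρ, h1, h2, hy⟩, hd⟩ := mem_HK.1 hz
    have hr : 0 < ‖ρ‖ + ρ₁ := by positivity
    have := om2_half (γ := γ) hσ hσ1 hc hc1 hr hy.1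
    have := Real.rpow_pos_of_pos hr γ
    simp only
    linarith

set_option maxHeartbeats 1000000 in
theorem HL_max {n : ℕ} {σ γ m c Λ T R Z δ k ρ₁ ε K : ℝ} {V : ℝ → En n → En n → ℝ → ℝ}
    (hV : ClassA n σ T R (2 * Z) δ V) (hσ : 0 < σ) (hγ : σ < γ) (hγ1 : γ < 1)
    (hT : 0 < T) (hT1 : T ≤ 1) (hR : 0 < R) (hR1 : R ≤ 1) (hΛ : Λ = 4 * T / R ^ 2) (hm : m = γ / σ)
    (hc : c = γ * (1 - γ) / 42) (hε : 0 < ε) (hεR : ε ≤ R / 8) (hε1 : m * ε ≤ σ * c / 2)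
    (hε2 : (n * (2 * m * (m + 1) * Λ ^ 2 + 12 * m * Λ) +
      (2 * m * (m + 1) * Λ ^ 2 + 16 * m * Λ)) * ε ≤ γ * (1 - γ) / 3)
    (hK : K * ε ^ m = 4) (hK4 : 4 ≤ K) (hZ : 0 < Z) (hk : k * Z ^ 2 = 3) (hρ₁ : 0 < ρ₁) (hδ : 0 < δ)
    (hδ2 : δ * (2 + 8 * k * Z + 2 * ρ₁ ^ (γ - 1) * (1 + m * Λ)) < σ * c / 2 * ρ₁ ^ (γ - σ))
    (hb : ∀ t ∈ Icc (-T) 0, ∀ x, ‖x‖ < R → ∀ ξ, ‖ξ‖ ≤ Z → ∀ y, 0 ≤ y → y < R → |V t x ξ y| ≤ 1)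
    (ho : ∀ t ∈ Icc (-T) 0, ∀ x, ‖x‖ < R → ∀ ξ₁, ‖ξ₁‖ ≤ Z → ∀ ξ₂, ‖ξ₂‖ ≤ Z → ∀ y, 0 ≤ y → y < R →
      V t x ξ₁ y - V t x ξ₂ y ≤ ρ₁ ^ γ) :
    ∀ z ∈ HK n T R Z Λ, HT V k c γ σ T Λ m ρ₁ z ≤ K := by
  intro z₀ hz₀
  by_contra hcon
  push Not at hcon
  have hσ1 : σ < 1 := hγ.trans hγ1
  have hγ0 : 0 < γ := hσ.trans hγ
  have hm0 : 0 < m := by rw [hm]; positivity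
  have hγγ : 0 < γ * (1 - γ) := mul_pos hγ0 (by linarith)
  have hγγ1 : γ * (1 - γ) ≤ 1 := by
    have := mul_le_of_le_one_left (show 0 ≤ 1 - γ by linarith) hγ1.le
    linarith
  have hc0 : 0 < c := by rw [hc]; positivity
  have hc1 : c ≤ 1 / 2 := by rw [hc]; linarith
  have hΛ0 : 0 < Λ := by rw [hΛ]; positivity
  have hk0 : 0 < k := by
    have : 0 < Z ^ 2 := by positivity
    exact pos_of_mul_pos_left (by rw [hk]; norm_num) this.le
  obtain ⟨⟨t, x, ρ, ξ₁, ξ₂, y⟩, hz, hmax⟩ := (HK_compact n T R Z Λ).exists_isMaxOn ⟨z₀, hz₀⟩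
    (HT_cont hV hσ hσ1 hm0 hc0.le hc1 hR hZ hρ₁ (k := k) (γ := γ))
  set Ks := HT V k c γ σ T Λ m ρ₁ (t, x, ρ, ξ₁, ξ₂, y) with hKs
  have hKK : K < Ks := lt_of_lt_of_le hcon (hmax hz₀)
  have hKs0 : 0 < Ks := by linarith
  obtain ⟨⟨ht, hx, hρ, hξ1, hξ2, hy⟩, hd⟩ := mem_HK.1 hz
  set d := T + t - Λ * (‖x‖ ^ 2 + y ^ 2) with hddef
  set r := ‖ρ‖ + ρ₁ with hrdef
  have hr0 : 0 < r := by positivity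
  have hPr : 0 < r ^ γ := Real.rpow_pos_of_pos hr0 γ
  have hω := om2_half (γ := γ) hσ hσ1 hc0.le hc1 hr0 hy.1
  have hω0 : 0 < om2 c γ σ r y := by linarith
  have hKs' : Ks = (HF V (t, x, ρ, ξ₁, ξ₂, y) - k * (‖ξ₁‖ ^ 2 + ‖ξ₂‖ ^ 2)) * d ^ m / om2 c γ σ r y := rfl
  have hd0 : 0 < d := by
    rcases hd.eq_or_lt with h | h
    · rw [← h, Real.zero_rpow hm0.ne'] at hKs'
      simp at hKs'
      linarith
    · exact h
  have hdm : 0 < d ^ m := Real.rpow_pos_of_pos hd0 m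
  have hd1 : d ≤ 1 := by
    have : 0 ≤ Λ * (‖x‖ ^ 2 + y ^ 2) := by positivity
    linarith [ht.2]
  have hG : (HF V (t, x, ρ, ξ₁, ξ₂, y) - k * (‖ξ₁‖ ^ 2 + ‖ξ₂‖ ^ 2)) * d ^ m = Ks * om2 c γ σ r y := by
    rw [hKs']; field_simp
  have hG0 : 0 < HF V (t, x, ρ, ξ₁, ξ₂, y) - k * (‖ξ₁‖ ^ 2 + ‖ξ₂‖ ^ 2) := by
    have : 0 < Ks * om2 c γ σ r y := by positivity
    rw [← hG] at this
    exact pos_of_mul_pos_left this hdm.le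
  have hxρ1 : ‖x + ρ‖ < R := by have := norm_add_le x ρ; linarith
  have hxρ2 : ‖x - ρ‖ < R := by have := norm_sub_le x ρ; linarith
  have hHF2 : HF V (t, x, ρ, ξ₁, ξ₂, y) ≤ 2 := by
    have h1 := (abs_le.1 (hb t ht _ hxρ1 ξ₁ hξ1 y hy.1 (by linarith [hy.2]))).2
    have h2 := (abs_le.1 (hb t ht _ hxρ2 ξ₂ hξ2 y hy.1 (by linarith [hy.2]))).1
    simp only [HF]
    linarith
  have hkξ1 : 0 ≤ k * ‖ξ₁‖ ^ 2 := by positivity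
  have hkξ2 : 0 ≤ k * ‖ξ₂‖ ^ 2 := by positivity
  have hξ1' : ‖ξ₁‖ < Z := by
    refine lt_of_le_of_ne hξ1 fun h => ?_
    rw [h, mul_add, hk] at hG0
    linarith
  have hξ2' : ‖ξ₂‖ < Z := by
    refine lt_of_le_of_ne hξ2 fun h => ?_
    rw [h, mul_add, hk] at hG0
    linarith
  -- smallness of r
  have hrγ : r ^ γ ≤ (ε * d) ^ m := by
    have h1 : K * (r ^ γ / 2) ≤ Ks * om2 c γ σ r y := by gcongr
    have h2 : (HF V (t, x, ρ, ξ₁, ξ₂, y) - k * (‖ξ₁‖ ^ 2 + ‖ξ₂‖ ^ 2)) * d ^ m ≤ 2 * d ^ m := by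
      gcongr; rw [mul_add]; linarith
    rw [hG] at h2
    rw [Real.mul_rpow hε.le hd0.le]
    have h3 : K * r ^ γ ≤ K * (ε ^ m * d ^ m) := by
      rw [← mul_assoc, hK]; linarith
    exact le_of_mul_le_mul_left h3 (by linarith)
  have hrσ : r ^ σ ≤ ε * d := by
    have h1 : r ^ γ = (r ^ σ) ^ m := by rw [← Real.rpow_mul hr0.le, hm]; field_simp
    rw [h1] at hrγ
    exact (Real.rpow_le_rpow_iff (Real.rpow_nonneg hr0.le _) (by positivity) hm0).1 hrγ
  have hεd1 : ε * d ≤ ε := mul_le_of_le_one_right hε.le hd1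
  have hr1 : r ≤ 1 := by
    by_contra h
    push Not at h
    have := Real.one_le_rpow h.le hσ.le
    linarith
  have hrr : r ≤ r ^ σ := by
    have := Real.rpow_le_rpow_of_exponent_ge hr0 hr1 hσ1.le
    rwa [Real.rpow_one] at this
  have hrε : r ≤ ε * d := hrr.trans hrσ
  have hrd : r ≤ d := hrε.trans (mul_le_of_le_one_left hd0.le (by linarith))
  have hrdε : r / d ≤ ε := (div_le_iff₀ hd0).2 hrε
  have hρr : ‖ρ‖ ≤ r := by linarith
  have hρR : ‖ρ‖ < R / 4 := by linarith
  have hxy : ‖x‖ ^ 2 + y ^ 2 < (R / 2) ^ 2 := by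
    have h1 : Λ * (‖x‖ ^ 2 + y ^ 2) < Λ * (R / 2) ^ 2 := by
      have : Λ * (R / 2) ^ 2 = T := by rw [hΛ]; field_simp; ring
      rw [this]; linarith [ht.2]
    exact lt_of_mul_lt_mul_left h1 hΛ0.le
  have hxR : ‖x‖ < R / 2 := by
    refine lt_of_pow_lt_pow_left₀ 2 (by positivity) ?_
    linarith [sq_nonneg y]
  have hyR : y < R / 2 := by
    refine lt_of_pow_lt_pow_left₀ 2 (by positivity) ?_
    linarith [sq_nonneg ‖x‖]
  have htT : -T < t := by
    have : 0 ≤ Λ * (‖x‖ ^ 2 + y ^ 2) := by positivity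
    linarith
  have hD1 : 1 ≤ d ^ (-m) := Real.one_le_rpow_of_pos_of_le_one_of_nonpos hd0 hd1 (by linarith)
  have hDm : d ^ (-m) * d ^ m = 1 := by rw [← Real.rpow_add hd0]; simp
  have hGe : HF V (t, x, ρ, ξ₁, ξ₂, y) - k * (‖ξ₁‖ ^ 2 + ‖ξ₂‖ ^ 2) = Ks * (om2 c γ σ r y * d ^ (-m)) := by
    have : (Ks * (om2 c γ σ r y * d ^ (-m))) * d ^ m = Ks * om2 c γ σ r y := by
      rw [mul_assoc, mul_assoc, hDm, mul_one]
    exact mul_right_cancel₀ hdm.ne' (hG.trans this.symm)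
  have hρ0 : ρ ≠ 0 := by
    intro h0
    have h1 := ho t ht x (by linarith) ξ₁ hξ1 ξ₂ hξ2 y hy.1 (by linarith)
    have h2 : HF V (t, x, ρ, ξ₁, ξ₂, y) = V t x ξ₁ y - V t x ξ₂ y := by simp [HF, h0]
    rw [h2] at hGe
    have h3 : r = ρ₁ := by rw [hrdef, h0]; simp
    rw [h3] at hω hGe hω0
    have h4 : om2 c γ σ ρ₁ y ≤ om2 c γ σ ρ₁ y * d ^ (-m) := le_mul_of_one_le_right hω0.le hD1
    have h5 : 4 * (om2 c γ σ ρ₁ y * d ^ (-m)) ≤ Ks * (om2 c γ σ ρ₁ y * d ^ (-m)) := by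
      gcongr; linarith
    have h6 : 0 < ρ₁ ^ γ := Real.rpow_pos_of_pos hρ₁ γ
    rw [mul_add] at hGe
    linarith
  obtain ⟨c', hc'0, hc'c, hc'y, hc'e, hωe, hωle⟩ := om2_touch (γ := γ) hσ1 hc0.le hr0 hy.1
  have touch : ∀ᶠ z : ℝ × En n × En n × En n × En n × ℝ in 𝓝 (t, x, ρ, ξ₁, ξ₂, y),
      z.1 ≤ t → 0 ≤ z.2.2.2.2.2 → HF V z - HF V (t, x, ρ, ξ₁, ξ₂, y) ≤
      HPhi k Ks c' γ σ T Λ m ρ₁ z - HPhi k Ks c' γ σ T Λ m ρ₁ (t, x, ρ, ξ₁, ξ₂, y) := by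
    have o1 : ∀ᶠ z : ℝ × En n × En n × En n × En n × ℝ in 𝓝 (t, x, ρ, ξ₁, ξ₂, y), -T < z.1 :=
      ev_gt _ continuous_fst htT
    have o2 : ∀ᶠ z : ℝ × En n × En n × En n × En n × ℝ in 𝓝 (t, x, ρ, ξ₁, ξ₂, y), ‖z.2.1‖ < R / 2 :=
      ev_lt _ (f := fun z : ℝ × En n × En n × En n × En n × ℝ => ‖z.2.1‖) (by fun_prop) hxR
    have o3 : ∀ᶠ z : ℝ × En n × En n × En n × En n × ℝ in 𝓝 (t, x, ρ, ξ₁, ξ₂, y), ‖z.2.2.1‖ < R / 4 :=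
      ev_lt _ (f := fun z : ℝ × En n × En n × En n × En n × ℝ => ‖z.2.2.1‖) (by fun_prop) hρR
    have o4 : ∀ᶠ z : ℝ × En n × En n × En n × En n × ℝ in 𝓝 (t, x, ρ, ξ₁, ξ₂, y), ‖z.2.2.2.1‖ < Z :=
      ev_lt _ (f := fun z : ℝ × En n × En n × En n × En n × ℝ => ‖z.2.2.2.1‖) (by fun_prop) hξ1'
    have o5 : ∀ᶠ z : ℝ × En n × En n × En n × En n × ℝ in 𝓝 (t, x, ρ, ξ₁, ξ₂, y), ‖z.2.2.2.2.1‖ < Z :=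
      ev_lt _ (f := fun z : ℝ × En n × En n × En n × En n × ℝ => ‖z.2.2.2.2.1‖) (by fun_prop) hξ2'
    have o6 : ∀ᶠ z : ℝ × En n × En n × En n × En n × ℝ in 𝓝 (t, x, ρ, ξ₁, ξ₂, y), z.2.2.2.2.2 < R / 2 :=
      ev_lt _ (f := fun z : ℝ × En n × En n × En n × En n × ℝ => z.2.2.2.2.2) (by fun_prop) hyR
    have o7 : ∀ᶠ z : ℝ × En n × En n × En n × En n × ℝ in 𝓝 (t, x, ρ, ξ₁, ξ₂, y),
        0 < T + z.1 - Λ * (‖z.2.1‖ ^ 2 + z.2.2.2.2.2 ^ 2) :=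
      ev_gt _ (f := fun z : ℝ × En n × En n × En n × En n × ℝ => T + z.1 - Λ * (‖z.2.1‖ ^ 2 + z.2.2.2.2.2 ^ 2)) (by fun_prop) hd0
    filter_upwards [o1, o2, o3, o4, o5, o6, o7] with z p1 p2 p3 p4 p5 p6 p7 hzt hzy
    obtain ⟨t', x', ρ', ξ₁', ξ₂', y'⟩ := z
    simp only at p1 p2 p3 p4 p5 p6 p7 hzt hzy
    have hz' : (t', x', ρ', ξ₁', ξ₂', y') ∈ HK n T R Z Λ :=
      mem_HK.2 ⟨⟨⟨p1.le, hzt.trans ht.2⟩, p2.le, p3.le, p4.le, p5.le, hzy, p6.le⟩, p7.le⟩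
    have hle : HT V k c γ σ T Λ m ρ₁ (t', x', ρ', ξ₁', ξ₂', y') ≤ Ks := hmax hz'
    have hr' : 0 < ‖ρ'‖ + ρ₁ := by positivity
    have hω' := om2_half (γ := γ) hσ hσ1 hc0.le hc1 hr' hzy
    have hPr' : 0 < (‖ρ'‖ + ρ₁) ^ γ := Real.rpow_pos_of_pos hr' γ
    have hω0' : 0 < om2 c γ σ (‖ρ'‖ + ρ₁) y' := by linarith
    simp only [HT] at hle
    rw [div_le_iff₀ hω0'] at hle
    set d' := T + t' - Λ * (‖x'‖ ^ 2 + y' ^ 2) with hd'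
    have hdm' : 0 < d' ^ m := Real.rpow_pos_of_pos p7 m
    have hDp' : 0 < d' ^ (-m) := Real.rpow_pos_of_pos p7 (-m)
    have hDm' : d' ^ (-m) * d' ^ m = 1 := by rw [← Real.rpow_add p7]; simp
    have h1 : HF V (t', x', ρ', ξ₁', ξ₂', y') - k * (‖ξ₁'‖ ^ 2 + ‖ξ₂'‖ ^ 2) ≤
        Ks * (om2 c γ σ (‖ρ'‖ + ρ₁) y' * d' ^ (-m)) := by
      have : (Ks * (om2 c γ σ (‖ρ'‖ + ρ₁) y' * d' ^ (-m))) * d' ^ m =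
          Ks * om2 c γ σ (‖ρ'‖ + ρ₁) y' := by
        rw [mul_assoc, mul_assoc, hDm', mul_one]
      rw [← this] at hle
      exact le_of_mul_le_mul_right hle hdm'
    have h2 : Ks * (om2 c γ σ (‖ρ'‖ + ρ₁) y' * d' ^ (-m)) ≤
        Ks * (om c' γ σ (‖ρ'‖ + ρ₁) y' * d' ^ (-m)) := by
      gcongr; exact hωle _ _
    simp only [HPhi, ← hd', ← hddef, ← hrdef]
    rw [hωe] at hGe
    linarith
  rcases hy.1.eq_or_lt with hy0 | hy0
  · -- boundary
    rw [← hy0] at touch hddef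
    have hc'c2 : c' = c := hc'e hy0.symm
    rw [hc'c2] at touch
    have hfin := hl_bd hV hσ hσ1 hγ0 hγ1.le hm0 hΛ0.le hKs0 hk0.le hδ.le ⟨htT, ht.2⟩ hxρ1 hxρ2
      (by linarith) (by linarith) hρ₁.le hrdef hr0 (by rw [hddef]; ring) hd0 hrd (by linarith) touch
    have hD0 : 0 < d ^ (-m) := by linarith
    have a1 : r ^ γ / d ≤ ε * r ^ (γ - σ) := by
      have : r ^ γ = r ^ (γ - σ) * r ^ σ := by rw [← Real.rpow_add hr0]; ring_nf
      rw [this, div_le_iff₀ hd0]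
      have := mul_le_mul_of_nonneg_left hrσ (Real.rpow_nonneg hr0.le (γ - σ))
      linarith
    have hrρ : ρ₁ ≤ r := by linarith [norm_nonneg ρ]
    have a2 : r ^ γ / r ≤ ρ₁ ^ (γ - 1) := by
      have : r ^ γ / r = r ^ (γ - 1) := by rw [Real.rpow_sub hr0, Real.rpow_one]
      rw [this]
      exact Real.rpow_le_rpow_of_nonpos hρ₁ hrρ (by linarith)
    have a3 : ρ₁ ^ (γ - σ) ≤ r ^ (γ - σ) := Real.rpow_le_rpow hρ₁.le hrρ (by linarith)
    have hKD : 0 < Ks * d ^ (-m) := by positivity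
    have hKD1 : 1 ≤ Ks * d ^ (-m) := by
      have := mul_le_mul (show 1 ≤ Ks by linarith) hD1 zero_le_one hKs0.le
      linarith
    have b1 : m * Ks * r ^ γ * d ^ (-m) / d ≤ Ks * d ^ (-m) * (σ * c / 2 * r ^ (γ - σ)) := by
      calc m * Ks * r ^ γ * d ^ (-m) / d = Ks * d ^ (-m) * (m * (r ^ γ / d)) := by ring
        _ ≤ Ks * d ^ (-m) * (m * (ε * r ^ (γ - σ))) := by gcongr
        _ = Ks * d ^ (-m) * (m * ε * r ^ (γ - σ)) := by ring
        _ ≤ _ := by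
          have := Real.rpow_nonneg hr0.le (γ - σ)
          gcongr
    have b2 : δ * (2 + 2 * (Ks * r ^ γ * d ^ (-m) * (1 + m * Λ) / r) + 4 * k * (2 * Z)) ≤
        Ks * d ^ (-m) * (δ * (2 + 8 * k * Z + 2 * ρ₁ ^ (γ - 1) * (1 + m * Λ))) := by
      have e1 : Ks * r ^ γ * d ^ (-m) * (1 + m * Λ) / r ≤ Ks * d ^ (-m) * (ρ₁ ^ (γ - 1) * (1 + m * Λ)) := by
        calc _ = Ks * d ^ (-m) * (r ^ γ / r * (1 + m * Λ)) := by ring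
          _ ≤ _ := by gcongr
      have e2 : 2 + 8 * k * Z ≤ Ks * d ^ (-m) * (2 + 8 * k * Z) :=
        le_mul_of_one_le_left (by positivity) hKD1
      have : (2 + 2 * (Ks * r ^ γ * d ^ (-m) * (1 + m * Λ) / r) + 4 * k * (2 * Z)) ≤
        Ks * d ^ (-m) * ((2 + 8 * k * Z + 2 * ρ₁ ^ (γ - 1) * (1 + m * Λ))) := by
        rw [mul_add (Ks * d ^ (-m)) (2 + 8 * k * Z)]
        linarith
      have := mul_le_mul_of_nonneg_left this hδ.le
      linarith
    have b3 : Ks * d ^ (-m) * (δ * (2 + 8 * k * Z + 2 * ρ₁ ^ (γ - 1) * (1 + m * Λ))) <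
        Ks * d ^ (-m) * (σ * c / 2 * ρ₁ ^ (γ - σ)) := by gcongr
    have b4 : Ks * d ^ (-m) * (σ * c / 2 * ρ₁ ^ (γ - σ)) ≤ Ks * d ^ (-m) * (σ * c / 2 * r ^ (γ - σ)) := by
      gcongr
    linarith
  · have hfin := hl_int hV hσ hγ hγ1 hc'0 (by linarith : c' ≤ 1) hm0 hΛ0.le hKs0 ht hxρ1 hxρ2
      (by linarith : ‖ξ₁‖ < 2 * Z) (by linarith : ‖ξ₂‖ < 2 * Z) hy0 (by linarith) hρ0 hrdef hr0 hr1
      (d₀ := T + t) hddef hd0 hrd (by linarith) (by linarith) hc'y (by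
        have hcc : Tendsto (fun z : En n × En n × ℝ => ((t, z.1, z.2.1, ξ₁, ξ₂, z.2.2) :
            ℝ × En n × En n × En n × En n × ℝ)) (𝓝 (x, ρ, y)) (𝓝 (t, x, ρ, ξ₁, ξ₂, y)) := by
          have : Continuous (fun z : En n × En n × ℝ => ((t, z.1, z.2.1, ξ₁, ξ₂, z.2.2) :
            ℝ × En n × En n × En n × En n × ℝ)) := by fun_prop
          exact this.tendsto _
        have hyy : ∀ᶠ z : En n × En n × ℝ in 𝓝 (x, ρ, y), 0 < z.2.2 :=
          ev_gt _ (f := fun z : En n × En n × ℝ => z.2.2) (by fun_prop) hy0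
        filter_upwards [hcc.eventually touch, hyy] with z hz1 hz2
        have := hz1 le_rfl hz2.le
        simp only [HF, HPhi] at this
        linarith)
    have hCC : 0 ≤ (n * (2 * m * (m + 1) * Λ ^ 2 + 12 * m * Λ) +
      (2 * m * (m + 1) * Λ ^ 2 + 16 * m * Λ)) := by positivity
    have := mul_le_mul_of_nonneg_left hrdε hCC
    rw [hc] at hc'c
    linarith

theorem HL (n : ℕ) {σ γ T R : ℝ} (hσ : 0 < σ) (hγ : σ < γ) (hγ1 : γ < 1)
    (hT : 0 < T) (hT1 : T ≤ 1) (hR : 0 < R) (hR1 : R ≤ 1) :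
    ∃ K' > 0, ∀ ρ₁, 0 < ρ₁ → ∀ Z, 0 < Z → ∃ δ > 0, ∀ V : ℝ → En n → En n → ℝ → ℝ,
      ClassA n σ T R (2 * Z) δ V →
      (∀ t ∈ Icc (-T) 0, ∀ x, ‖x‖ < R → ∀ ξ, ‖ξ‖ ≤ Z → ∀ y, 0 ≤ y → y < R → |V t x ξ y| ≤ 1) →
      (∀ t ∈ Icc (-T) 0, ∀ x, ‖x‖ < R → ∀ ξ₁, ‖ξ₁‖ ≤ Z → ∀ ξ₂, ‖ξ₂‖ ≤ Z → ∀ y, 0 ≤ y → y < R →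
        V t x ξ₁ y - V t x ξ₂ y ≤ ρ₁ ^ γ) →
      ∀ t ∈ Icc (-(T / 4)) 0, ∀ x₁, ‖x₁‖ ≤ R / 8 → ∀ x₂, ‖x₂‖ ≤ R / 8 → ∀ y, 0 ≤ y → y ≤ R / 8 →
        V t x₁ 0 y - V t x₂ 0 y ≤ K' * (‖x₁ - x₂‖ + ρ₁) ^ γ := by
  have hσ1 : σ < 1 := hγ.trans hγ1
  have hγ0 : 0 < γ := hσ.trans hγ
  set Λ := 4 * T / R ^ 2 with hΛ
  set m := γ / σ with hm
  set c := γ * (1 - γ) / 42 with hc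
  have hm0 : 0 < m := by rw [hm]; positivity
  have hγγ : 0 < γ * (1 - γ) := mul_pos hγ0 (by linarith)
  have hγγ1 : γ * (1 - γ) ≤ 1 := by
    have := mul_le_of_le_one_left (show 0 ≤ 1 - γ by linarith) hγ1.le
    linarith
  have hc0 : 0 < c := by rw [hc]; positivity
  have hc1 : c ≤ 1 / 2 := by rw [hc]; linarith
  have hΛ0 : 0 < Λ := by rw [hΛ]; positivity
  set CC := (n * (2 * m * (m + 1) * Λ ^ 2 + 12 * m * Λ) +
      (2 * m * (m + 1) * Λ ^ 2 + 16 * m * Λ)) with hCC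
  have hCC0 : 0 ≤ CC := by positivity
  set ε := min (R / 8) (min (σ * c / 2 / m) (γ * (1 - γ) / 3 / (CC + 1))) with hε
  have hε0 : 0 < ε := by
    rw [hε]; refine lt_min (by positivity) (lt_min (by positivity) (by positivity))
  have hε1 : ε ≤ R / 8 := min_le_left _ _
  have hε2 : m * ε ≤ σ * c / 2 := by
    have : ε ≤ σ * c / 2 / m := (min_le_right _ _).trans (min_le_left _ _)
    rw [le_div_iff₀ hm0] at this
    linarith
  have hε3 : CC * ε ≤ γ * (1 - γ) / 3 := by
    have : ε ≤ γ * (1 - γ) / 3 / (CC + 1) := (min_le_right _ _).trans (min_le_right _ _)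
    rw [le_div_iff₀ (by positivity)] at this
    linarith
  have hεm : 0 < ε ^ m := Real.rpow_pos_of_pos hε0 m
  set K := 4 / ε ^ m with hK
  have hK1 : K * ε ^ m = 4 := by rw [hK]; field_simp
  have hK4 : 4 ≤ K := by
    rw [hK, le_div_iff₀ hεm]
    have : ε ^ m ≤ 1 := Real.rpow_le_one hε0.le (by linarith) hm0.le
    linarith
  have hTm : 0 < (T / 2) ^ (-m) := Real.rpow_pos_of_pos (by positivity) _
  refine ⟨K * (T / 2) ^ (-m), by positivity, fun ρ₁ hρ₁ Z hZ => ?_⟩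
  set k := 3 / Z ^ 2 with hk
  have hk1 : k * Z ^ 2 = 3 := by rw [hk]; field_simp
  have hk0 : 0 < k := by rw [hk]; positivity
  have hρσ : 0 < ρ₁ ^ (γ - σ) := Real.rpow_pos_of_pos hρ₁ _
  have hρg : 0 < ρ₁ ^ (γ - 1) := Real.rpow_pos_of_pos hρ₁ _
  set W := 2 + 8 * k * Z + 2 * ρ₁ ^ (γ - 1) * (1 + m * Λ) with hW
  have hW0 : 0 < W := by positivity
  have hδ0 : 0 < σ * c / 4 * ρ₁ ^ (γ - σ) / W := by positivity
  refine ⟨σ * c / 4 * ρ₁ ^ (γ - σ) / W, hδ0, fun V hV hb ho t ht x₁ hx1 x₂ hx2 y hy hyR => ?_⟩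
  have hmax := HL_max (k := k) hV hσ hγ hγ1 hT hT1 hR hR1 hΛ hm hc hε0 hε1 hε2 hε3 hK1 hK4 hZ hk1 hρ₁ hδ0
    (by
      rw [← hW, div_mul_cancel₀ _ hW0.ne']
      have : 0 < σ * c * ρ₁ ^ (γ - σ) := by positivity
      linarith) hb ho
  set x : En n := (1 / 2 : ℝ) • (x₁ + x₂) with hx
  set ρ : En n := (1 / 2 : ℝ) • (x₁ - x₂) with hρ
  have e1 : x + ρ = x₁ := by rw [hx, hρ]; module
  have e2 : x - ρ = x₂ := by rw [hx, hρ]; module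
  have nx : ‖x‖ ≤ R / 8 := by
    rw [hx, norm_smul, Real.norm_of_nonneg (by norm_num)]
    have := norm_add_le x₁ x₂
    linarith
  have nρ : ‖ρ‖ = ‖x₁ - x₂‖ / 2 := by
    rw [hρ, norm_smul, Real.norm_of_nonneg (by norm_num)]; ring
  have nρ2 : ‖x₁ - x₂‖ ≤ R / 4 := by
    have := norm_sub_le x₁ x₂
    linarith
  have hd : T / 2 ≤ T + t - Λ * (‖x‖ ^ 2 + y ^ 2) := by
    have h1 : ‖x‖ ^ 2 + y ^ 2 ≤ (R / 8) ^ 2 + (R / 8) ^ 2 := by gcongr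
    have h2 : Λ * (‖x‖ ^ 2 + y ^ 2) ≤ Λ * ((R / 8) ^ 2 + (R / 8) ^ 2) := by gcongr
    have h3 : Λ * ((R / 8) ^ 2 + (R / 8) ^ 2) = T / 8 := by rw [hΛ]; field_simp; ring
    linarith [ht.1]
  have hz : (t, x, ρ, (0 : En n), (0 : En n), y) ∈ HK n T R Z Λ := by
    refine mem_HK.2 ⟨⟨⟨by linarith [ht.1], ht.2⟩, by linarith, by rw [nρ]; linarith, by simpa using hZ.le,
      by simpa using hZ.le, hy, by linarith⟩, by linarith⟩
  have hle := hmax _ hz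
  have hr' : 0 < ‖ρ‖ + ρ₁ := by positivity
  have hω' := om2_half (γ := γ) hσ hσ1 hc0.le hc1 hr' hy
  have hPr' : 0 < (‖ρ‖ + ρ₁) ^ γ := Real.rpow_pos_of_pos hr' γ
  have hω0' : 0 < om2 c γ σ (‖ρ‖ + ρ₁) y := by linarith
  simp only [HT, HF] at hle
  rw [div_le_iff₀ hω0', e1, e2] at hle
  simp only [norm_zero, ne_eq, OfNat.ofNat_ne_zero, not_false_eq_true, zero_pow, add_zero, mul_zero,
    sub_zero] at hle
  set d := T + t - Λ * (‖x‖ ^ 2 + y ^ 2)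
  have hd0 : 0 < d := by linarith
  have hdm : 0 < d ^ m := Real.rpow_pos_of_pos hd0 m
  have hdD : d ^ (-m) ≤ (T / 2) ^ (-m) := Real.rpow_le_rpow_of_nonpos (by positivity) hd (by linarith)
  have hD0 : 0 < d ^ (-m) := Real.rpow_pos_of_pos hd0 _
  have hDm : d ^ m * d ^ (-m) = 1 := by rw [← Real.rpow_add hd0]; simp
  have h1 : om2 c γ σ (‖ρ‖ + ρ₁) y ≤ (‖x₁ - x₂‖ + ρ₁) ^ γ := by
    refine (min_le_right _ _).trans (Real.rpow_le_rpow hr'.le ?_ hγ0.le)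
    rw [nρ]; linarith [norm_nonneg (x₁ - x₂)]
  calc V t x₁ 0 y - V t x₂ 0 y = ((V t x₁ 0 y - V t x₂ 0 y) * d ^ m) * d ^ (-m) := by
        rw [mul_assoc, hDm, mul_one]
    _ ≤ (K * om2 c γ σ (‖ρ‖ + ρ₁) y) * d ^ (-m) := by gcongr
    _ ≤ (K * (‖x₁ - x₂‖ + ρ₁) ^ γ) * (T / 2) ^ (-m) := by gcongr
    _ = _ := by ring

theorem ClassA.mono_delta {n : ℕ} {σ T R Z δ δ' : ℝ} {V : ℝ → En n → En n → ℝ → ℝ}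
    (h : ClassA n σ T R Z δ V) (hδ : δ ≤ δ') : ClassA n σ T R Z δ' V := by
  refine ⟨h.cont, h.int, fun t ht x hx ξ hξ => ?_⟩
  obtain ⟨τ, l, p, q, h1, h2, h3, h4, h5⟩ := h.bdry t ht x hx ξ hξ
  exact ⟨τ, l, p, q, h1, h2, h3, h4, h5.trans (by gcongr)⟩

/-- bounded by one -/
def Bd1 (n : ℕ) (T R : ℝ) (u : ℝ → En n → ℝ → ℝ) : Prop :=
  ∀ t ∈ Icc (-T) 0, ∀ x, ‖x‖ < R → ∀ y, 0 ≤ y → y < R → |u t x y| ≤ 1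

theorem SD (n : ℕ) {σ γ : ℝ} (hσ : 0 < σ) (hγ : σ < γ) (hγ1 : γ < 1) :
    ∃ C > 0, ∀ r, 0 < r → r ≤ 1 → ∃ δ₀ > 0, ∀ δ, 0 ≤ δ → δ ≤ δ₀ → ∀ u : ℝ → En n → ℝ → ℝ,
      ClassU n σ 1 (1/2) δ 0 u → Bd1 n 1 (1/2) u →
      (∀ t ∈ Icc (-(1/4 : ℝ)) 0, ∀ x₁, ‖x₁‖ ≤ 1/16 → ∀ x₂, ‖x₂‖ ≤ 1/16 → ∀ y, 0 ≤ y → y ≤ 1/16 →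
        |u t x₁ y - u t x₂ y| ≤ C * (‖x₁ - x₂‖ + r) ^ γ) ∧
      (∀ t ∈ Icc (-(1/16 : ℝ)) 0, ∀ x₁, ‖x₁‖ ≤ 1/256 → ∀ x₂, ‖x₂‖ ≤ 1/256 → ∀ ξ, ‖ξ‖ ≤ 1/256 →
        ∀ y, 0 ≤ y → y ≤ 1/256 →
        (u t (x₁ + ξ) y - u t (x₁ - ξ) y) - (u t (x₂ + ξ) y - u t (x₂ - ξ) y) ≤
          C * (‖ξ‖ + r) ^ γ * (‖x₁ - x₂‖ + r) ^ γ) := by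
  have hγ0 : 0 < γ := hσ.trans hγ
  obtain ⟨K₁, hK₁, HL1⟩ := HL n hσ hγ hγ1 (T := 1) (R := 1/2) (by norm_num) le_rfl (by norm_num) (by norm_num)
  obtain ⟨K₂, hK₂, HL2⟩ := HL n hσ hγ hγ1 (T := 1/4) (R := 1/32) (by norm_num) (by norm_num) (by norm_num) (by norm_num)
  have h2γ : 0 < (2:ℝ) ^ γ := Real.rpow_pos_of_pos (by norm_num) _
  refine ⟨K₁ + K₁ * 2 ^ γ * K₂, by positivity, fun r hr hr1 => ?_⟩
  have hrγ : 0 < r ^ γ := Real.rpow_pos_of_pos hr _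
  have h2rγ : 0 < (2 * r) ^ γ := Real.rpow_pos_of_pos (by positivity) _
  set β := ((2 * r) ^ γ * r ^ γ / 2) ^ (1 / γ) with hβ
  have hβ0 : 0 < β := by positivity
  set η := min (β / 3) (min (r / 4) (1 / 256)) with hη
  have hη0 : 0 < η := lt_min (by positivity) (lt_min (by positivity) (by norm_num))
  have hηr : η ≤ r / 4 := (min_le_right _ _).trans (min_le_left _ _)
  have hη256 : η ≤ 1 / 256 := (min_le_right _ _).trans (min_le_right _ _)
  have hη3 : 2 * (3 * η) ^ γ ≤ (2 * r) ^ γ * r ^ γ := by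
    have h1 : 3 * η ≤ β := by have : η ≤ β / 3 := min_le_left _ _; linarith
    have h2 : (3 * η) ^ γ ≤ β ^ γ := Real.rpow_le_rpow (by positivity) h1 hγ0.le
    have h3 : β ^ γ = (2 * r) ^ γ * r ^ γ / 2 := by
      rw [hβ, ← Real.rpow_mul (by positivity), one_div, inv_mul_cancel₀ hγ0.ne', Real.rpow_one]
    linarith
  obtain ⟨δ₁, hδ₁, H1⟩ := HL1 η hη0 1 one_pos
  obtain ⟨δ₂, hδ₂, H2⟩ := HL2 r hr η hη0
  set cm := 1 / (K₁ * (2 * r) ^ γ) with hcm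
  have hcm0 : 0 < cm := by positivity
  refine ⟨min δ₁ (δ₂ / (2 * cm + 1)), lt_min hδ₁ (by positivity), fun δ hδ0 hδ u hu hb => ?_⟩
  have hδ1 : δ ≤ δ₁ := hδ.trans (min_le_left _ _)
  have hδ2 : δ * (2 * cm + 1) ≤ δ₂ := by
    rw [← le_div_iff₀ (by positivity)]; exact hδ.trans (min_le_right _ _)
  have S1 : ∀ t ∈ Icc (-(1/4 : ℝ)) 0, ∀ x₁, ‖x₁‖ ≤ 1/16 → ∀ x₂, ‖x₂‖ ≤ 1/16 → ∀ y, 0 ≤ y → y ≤ 1/16 →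
        u t x₁ y - u t x₂ y ≤ K₁ * (‖x₁ - x₂‖ + η) ^ γ := by
    intro t ht x₁ h1 x₂ h2 y hy hy1
    have := H1 (fun t x _ y => u t x y) ((hu.toA (Z := 2 * 1)).mono_delta hδ1)
      (fun t ht x hx _ _ y hy hy1 => hb t ht x hx y hy hy1)
      (fun t ht x hx _ _ _ _ y hy hy1 => by rw [sub_self]; positivity)
      t ht x₁ (by linarith) x₂ (by linarith) y hy (by linarith)
    exact this
  have S1' : ∀ t ∈ Icc (-(1/4 : ℝ)) 0, ∀ x₁, ‖x₁‖ ≤ 1/16 → ∀ x₂, ‖x₂‖ ≤ 1/16 → ∀ y, 0 ≤ y → y ≤ 1/16 →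
        |u t x₁ y - u t x₂ y| ≤ K₁ * (‖x₁ - x₂‖ + η) ^ γ := by
    intro t ht x₁ h1 x₂ h2 y hy hy1
    have a1 := S1 t ht x₁ h1 x₂ h2 y hy hy1
    have a2 := S1 t ht x₂ h2 x₁ h1 y hy hy1
    rw [norm_sub_rev] at a2
    exact abs_le.2 ⟨by linarith, a1⟩
  refine ⟨fun t ht x₁ h1 x₂ h2 y hy hy1 => (S1' t ht x₁ h1 x₂ h2 y hy hy1).trans ?_, ?_⟩
  · have : (‖x₁ - x₂‖ + η) ^ γ ≤ (‖x₁ - x₂‖ + r) ^ γ := by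
      refine Real.rpow_le_rpow (by positivity) (by linarith) hγ0.le
    have h0 : 0 ≤ (‖x₁ - x₂‖ + r) ^ γ := by positivity
    have h1 : K₁ * (‖x₁ - x₂‖ + η) ^ γ ≤ K₁ * (‖x₁ - x₂‖ + r) ^ γ := by gcongr
    have h2 : 0 ≤ K₁ * 2 ^ γ * K₂ * (‖x₁ - x₂‖ + r) ^ γ := by positivity
    linarith
  intro t ht x₁ h1 x₂ h2 ξ hξ y hy hy1
  set N := K₁ * (2 * (‖ξ‖ + r)) ^ γ with hN
  have hN0 : 0 < N := by positivity
  have hNm : K₁ * (2 * r) ^ γ ≤ N := by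
    rw [hN]
    have : (2 * r) ^ γ ≤ (2 * (‖ξ‖ + r)) ^ γ :=
      Real.rpow_le_rpow (by positivity) (by linarith [norm_nonneg ξ]) hγ0.le
    gcongr
  have hcN : 1 / N ≤ cm := by rw [hcm]; gcongr
  have hA := (hu.mono (T' := 1/4) (R' := 1/2) (by norm_num) le_rfl).pair (c := 1 / N) (ε := -1) (μ := 1)
    (R := 1/32) (Z := 2 * η) (ξ₀ := ξ) hδ0 (by positivity) (Or.inr rfl) (Or.inl rfl) (by linarith) (by norm_num)
  have hA2 := hA.mono_delta (δ' := δ₂) (le_trans (by gcongr) hδ2)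
  have key := H2 _ hA2 (by
      intro t ht x hx ζ hζ y hy hy1
      have nζ := norm_add_le ξ ζ
      have n1 : ‖x + (ξ + ζ)‖ ≤ 1/16 := by have := norm_add_le x (ξ + ζ); linarith
      have n2 : ‖x - (ξ + ζ)‖ ≤ 1/16 := by have := norm_sub_le x (ξ + ζ); linarith
      have := S1' t ht _ n1 _ n2 y hy (by linarith)
      rw [one_smul, abs_mul, abs_of_pos (by positivity : 0 < 1 / N)]
      have e1 : x + (ξ + ζ) - (x - (ξ + ζ)) = (2:ℝ) • (ξ + ζ) := by module
      rw [e1, norm_smul, Real.norm_of_nonneg (by norm_num)] at this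
      have h3 : (2 * ‖ξ + ζ‖ + η) ^ γ ≤ (2 * (‖ξ‖ + r)) ^ γ :=
        Real.rpow_le_rpow (by positivity) (by linarith) hγ0.le
      have h4 : |u t (x + (ξ + ζ)) y + -1 * u t (x - (ξ + ζ)) y| ≤ N := by
        have : u t (x + (ξ + ζ)) y + -1 * u t (x - (ξ + ζ)) y =
          u t (x + (ξ + ζ)) y - u t (x - (ξ + ζ)) y := by ring
        rw [this]
        refine (S1' t ht _ n1 _ n2 y hy (by linarith)).trans ?_
        rw [e1, norm_smul, Real.norm_of_nonneg (by norm_num), hN]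
        gcongr
      rw [one_div, inv_mul_le_iff₀ hN0, mul_one]
      exact h4) (by
      intro t ht x hx ζ hζ ζ' hζ' y hy hy1
      have nζ := norm_add_le ξ ζ
      have n1 : ‖x + (ξ + ζ)‖ ≤ 1/16 := by have := norm_add_le x (ξ + ζ); linarith
      have n2 : ‖x - (ξ + ζ)‖ ≤ 1/16 := by have := norm_sub_le x (ξ + ζ); linarith
      have nζ' := norm_add_le ξ ζ'
      have n1' : ‖x + (ξ + ζ')‖ ≤ 1/16 := by have := norm_add_le x (ξ + ζ'); linarith
      have n2' : ‖x - (ξ + ζ')‖ ≤ 1/16 := by have := norm_sub_le x (ξ + ζ'); linarith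
      have q1 := S1 t ht _ n1 _ n1' y hy (by linarith)
      have q2 := S1 t ht _ n2' _ n2 y hy (by linarith)
      have e1 : x + (ξ + ζ) - (x + (ξ + ζ')) = ζ - ζ' := by abel
      have e2 : x - (ξ + ζ') - (x - (ξ + ζ)) = ζ - ζ' := by abel
      rw [e1] at q1
      rw [e2] at q2
      have n3 := norm_sub_le ζ ζ'
      have h3 : (‖ζ - ζ'‖ + η) ^ γ ≤ (3 * η) ^ γ :=
        Real.rpow_le_rpow (by positivity) (by linarith) hγ0.le
      have h4 : K₁ * (‖ζ - ζ'‖ + η) ^ γ ≤ K₁ * (3 * η) ^ γ := by gcongr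
      rw [one_smul, one_smul, ← mul_sub, one_div, inv_mul_le_iff₀ hN0]
      have h5 : K₁ * (2 * (3 * η) ^ γ) ≤ K₁ * ((2 * r) ^ γ * r ^ γ) := by gcongr
      have h6 : K₁ * (2 * r) ^ γ * r ^ γ ≤ N * r ^ γ := by gcongr
      linarith) t (by constructor <;> [linarith [ht.1]; exact ht.2]) x₁ (by linarith) x₂ (by linarith) y hy (by linarith)
  rw [one_smul, one_smul, add_zero, ← mul_sub, one_div, inv_mul_le_iff₀ hN0] at key
  have e3 : N = K₁ * 2 ^ γ * (‖ξ‖ + r) ^ γ := by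
    rw [hN, Real.mul_rpow (by norm_num) (by positivity), mul_assoc]
  rw [e3] at key
  have h0 : 0 ≤ K₁ * (‖ξ‖ + r) ^ γ * (‖x₁ - x₂‖ + r) ^ γ := by positivity
  linarith

/-- strict supersolution data for a stationary barrier -/
structure Barr (n : ℕ) (σ R₁ h L B : ℝ) (S : En n → ℝ → ℝ) : Prop where
  cont : ContinuousOn (fun q : En n × ℝ => S q.1 q.2) {q | ‖q.1‖ ≤ R₁ ∧ 0 ≤ q.2 ∧ q.2 ≤ h}
  int : ∀ x : En n, ‖x‖ < R₁ → ∀ y, 0 < y → y < h →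
    ∃ (m BS : En n → ℝ) (my By : ℝ), (∀ v, T2 (fun s => S (x + s • v) y) (m v) (BS v)) ∧
      T2 (fun s => S x (y + s)) my By ∧
      (∑ i, BS (EuclideanSpace.basisFun (Fin n) ℝ i)) + By + (1 - σ) / y * my < 0
  bdry : ∀ x : En n, ‖x‖ < R₁ → ∃ (l : ℝ) (p : En n), l ≤ L ∧ ‖p‖ ≤ B ∧
    (∀ v, HasDerivAt (fun s : ℝ => S (x + s • v) 0) ⟪p, v⟫ 0) ∧
    Tendsto (fun y => (S x y - S x 0) / y ^ σ) (𝓝[>] 0) (𝓝 l)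

theorem hasDeriv_normsq {n : ℕ} (k : ℝ) (ξ h : En n) :
    HasDerivAt (fun s : ℝ => k * ‖ξ + s • h‖ ^ 2) (k * (2 * ⟪ξ, h⟫)) 0 := by
  have h1 : HasDerivAt (fun s : ℝ => ξ + s • h) h 0 := by
    simpa using ((hasDerivAt_id (0:ℝ)).smul_const h).const_add ξ
  simpa using (h1.norm_sq).const_mul k

set_option maxHeartbeats 1000000 in
theorem CL {n : ℕ} {σ T R Z δ R₁ h L B z k lam M t' : ℝ} {V : ℝ → En n → En n → ℝ → ℝ}
    {S : En n → ℝ → ℝ}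
    (hV : ClassA n σ T R Z δ V) (hS : Barr n σ R₁ h L B S) (hσ : 0 < σ) (hδ : 0 ≤ δ)
    (hR : R₁ < R) (hh : h < R) (hh0 : 0 ≤ h) (hz : z < Z) (hz0 : 0 ≤ z) (hk : 0 ≤ k) (hR0 : 0 ≤ R₁) (ht' : -T ≤ t')
    (hlam : σ * L + δ * (1 + B + 2 * k * z) < lam)
    (hini : ∀ x, ‖x‖ ≤ R₁ → ∀ ξ, ‖ξ‖ ≤ z → V t' x ξ 0 ≤ S x 0 + k * ‖ξ‖ ^ 2 + M)
    (hside : ∀ τ ∈ Icc t' 0, ∀ x, ‖x‖ ≤ R₁ → ∀ ξ, ‖ξ‖ ≤ z → ∀ y, 0 ≤ y → y ≤ h →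
      (‖x‖ = R₁ ∨ ‖ξ‖ = z ∨ y = h) →
      ∃ x' ξ' y', ‖x'‖ ≤ R₁ ∧ ‖ξ'‖ ≤ z ∧ 0 ≤ y' ∧ y' ≤ h ∧
        V τ x ξ y - (S x y + k * ‖ξ‖ ^ 2) < V τ x' ξ' y' - (S x' y' + k * ‖ξ'‖ ^ 2)) :
    ∀ τ ∈ Icc t' 0, ∀ x, ‖x‖ ≤ R₁ → ∀ ξ, ‖ξ‖ ≤ z → ∀ y, 0 ≤ y → y ≤ h →
      V τ x ξ y ≤ S x y + k * ‖ξ‖ ^ 2 + lam * (τ - t') + M := by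
  intro τ₀ hτ₀ x₀ hx₀ ξ₀ hξ₀ y₀ hy₀ hy₀'
  set Kc : Set (ℝ × En n × En n × ℝ) :=
    Icc t' 0 ×ˢ Metric.closedBall 0 R₁ ×ˢ Metric.closedBall 0 z ×ˢ Icc 0 h with hKc
  have hcomp : IsCompact Kc := isCompact_Icc.prod ((isCompact_closedBall _ _).prod
    ((isCompact_closedBall _ _).prod isCompact_Icc))
  have memK : ∀ τ x ξ y, (τ, x, ξ, y) ∈ Kc ↔ (t' ≤ τ ∧ τ ≤ 0) ∧ ‖x‖ ≤ R₁ ∧ ‖ξ‖ ≤ z ∧ 0 ≤ y ∧ y ≤ h := by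
    intro τ x ξ y
    simp [hKc]
  set G : ℝ × En n × En n × ℝ → ℝ := fun q =>
    V q.1 q.2.1 q.2.2.1 q.2.2.2 - (S q.2.1 q.2.2.2 + k * ‖q.2.2.1‖ ^ 2 + lam * (q.1 - t')) with hG
  have hGc : ContinuousOn G Kc := by
    refine ContinuousOn.sub (hV.cont.mono ?_) (ContinuousOn.add (ContinuousOn.add
      (hS.cont.comp (f := fun q : ℝ × En n × En n × ℝ => (q.2.1, q.2.2.2)) (by fun_prop) ?_)
      (by fun_prop)) (by fun_prop))
    · rintro ⟨τ, x, ξ, y⟩ hq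
      obtain ⟨h1, h2, h3, h4, h5⟩ := (memK _ _ _ _).1 hq
      exact ⟨ht'.trans h1.1, h1.2, lt_of_le_of_lt h2 hR, lt_of_le_of_lt h3 hz, h4, lt_of_le_of_lt h5 hh⟩
    · rintro ⟨τ, x, ξ, y⟩ hq
      obtain ⟨h1, h2, h3, h4, h5⟩ := (memK _ _ _ _).1 hq
      exact ⟨h2, h4, h5⟩
  have hq0 : (τ₀, x₀, ξ₀, y₀) ∈ Kc := (memK _ _ _ _).2 ⟨hτ₀, hx₀, hξ₀, hy₀, hy₀'⟩
  obtain ⟨⟨τ, x, ξ, y⟩, hq, hmax⟩ := hcomp.exists_isMaxOn ⟨_, hq0⟩ hGc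
  have hmax' : ∀ τ₁ x₁ ξ₁ y₁, t' ≤ τ₁ → τ₁ ≤ 0 → ‖x₁‖ ≤ R₁ → ‖ξ₁‖ ≤ z → 0 ≤ y₁ → y₁ ≤ h →
      V τ₁ x₁ ξ₁ y₁ - (S x₁ y₁ + k * ‖ξ₁‖ ^ 2 + lam * (τ₁ - t')) ≤
      V τ x ξ y - (S x y + k * ‖ξ‖ ^ 2 + lam * (τ - t')) := fun τ₁ x₁ ξ₁ y₁ a b c d e f =>
    hmax ((memK _ _ _ _).2 ⟨⟨a, b⟩, c, d, e, f⟩)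
  obtain ⟨hτ, hx, hξ, hy, hyh⟩ := (memK _ _ _ _).1 hq
  suffices hsuff : V τ x ξ y - (S x y + k * ‖ξ‖ ^ 2 + lam * (τ - t')) ≤ M by
    have := hmax' τ₀ x₀ ξ₀ y₀ hτ₀.1 hτ₀.2 hx₀ hξ₀ hy₀ hy₀'
    linarith
  have hns : ¬ (‖x‖ = R₁ ∨ ‖ξ‖ = z ∨ y = h) := by
    intro hs
    obtain ⟨x', ξ', y', h1, h2, h3, h4, h5⟩ := hside τ hτ x hx ξ hξ y hy hyh hs
    have := hmax' τ x' ξ' y' hτ.1 hτ.2 h1 h2 h3 h4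
    linarith
  push Not at hns
  have hxs : ‖x‖ < R₁ := lt_of_le_of_ne hx hns.1
  have hξs : ‖ξ‖ < z := lt_of_le_of_ne hξ hns.2.1
  have hys : y < h := lt_of_le_of_ne hyh hns.2.2
  have evx : ∀ v : En n, ∀ᶠ s : ℝ in 𝓝 0, ‖x + s • v‖ < R₁ := fun v =>
    ev_lt _ (f := fun s : ℝ => ‖x + s • v‖) (by fun_prop) (by simpa using hxs)
  have evξ : ∀ v : En n, ∀ᶠ s : ℝ in 𝓝 0, ‖ξ + s • v‖ < z := fun v =>
    ev_lt _ (f := fun s : ℝ => ‖ξ + s • v‖) (by fun_prop) (by simpa using hξs)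
  rcases hy.eq_or_lt with hy0 | hy0
  · subst hy0
    rcases hτ.1.eq_or_lt with h0 | h0
    · subst h0
      have := hini x hx ξ hξ
      rw [sub_self, mul_zero]
      linarith
    · exfalso
      obtain ⟨τ1, l, p, q, e1, e2, e3, e4, e5⟩ := hV.bdry τ ⟨lt_of_le_of_lt ht' h0, hτ.2⟩ x (by linarith) ξ
        (by linarith)
      obtain ⟨l', p', hl', hp', f1, f2⟩ := hS.bdry x hxs
      have b1 : lam ≤ τ1 := by
        have hg : HasDerivAt (fun t : ℝ => lam * (t - t')) lam τ := by
          simpa using ((hasDerivAt_id τ).sub_const t').const_mul lam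
        refine deriv_le_left e1 hg ?_
        have : ∀ᶠ s in 𝓝[<] τ, t' < s := nhdsWithin_le_nhds (lt_mem_nhds h0)
        filter_upwards [this, self_mem_nhdsWithin] with s hs1 hs2
        have hs2' : s < τ := hs2
        have := hmax' s x ξ 0 hs1.le (by linarith [hτ.2]) hx hξ le_rfl hyh
        linarith
      have b2 : l ≤ l' := by
        refine le_of_tendsto_of_tendsto e4 f2 ?_
        have : ∀ᶠ s in 𝓝[>] (0:ℝ), s < h := nhdsWithin_le_nhds (gt_mem_nhds hys)
        filter_upwards [this, self_mem_nhdsWithin] with s hs1 hs2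
        have hs2' : 0 < s := hs2
        have := hmax' τ x ξ s hτ.1 hτ.2 hx hξ hs2'.le hs1.le
        refine (div_le_div_iff_of_pos_right (Real.rpow_pos_of_pos hs2' σ)).2 ?_
        linarith
      have hB0 : 0 ≤ B := (norm_nonneg _).trans hp'
      have b3 : ‖p‖ ≤ B := by
        refine norm_le_of_inner hB0 fun v => ?_
        have h5 : ⟪p, v⟫ ≤ ⟪p', v⟫ := by
          refine deriv_le_right (e2 v) (f1 v) ?_
          filter_upwards [nhdsWithin_le_nhds (evx v)] with s hs
          have := hmax' τ (x + s • v) ξ 0 hτ.1 hτ.2 hs.le hξ le_rfl hyh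
          rw [zero_smul, add_zero]
          linarith
        have := real_inner_le_norm p' v
        have h6 : ‖p'‖ * ‖v‖ ≤ B * ‖v‖ := by gcongr
        linarith
      have b4 : ‖q‖ ≤ 2 * k * z := by
        refine norm_le_of_inner (by positivity) fun v => ?_
        have h5 : ⟪q, v⟫ ≤ k * (2 * ⟪ξ, v⟫) := by
          refine deriv_le_right (e3 v) (hasDeriv_normsq k ξ v) ?_
          filter_upwards [nhdsWithin_le_nhds (evξ v)] with s hs
          have := hmax' τ x (ξ + s • v) 0 hτ.1 hτ.2 hx hs.le le_rfl hyh
          rw [zero_smul, add_zero]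
          linarith
        have := real_inner_le_norm ξ v
        have h6 : ‖ξ‖ * ‖v‖ ≤ z * ‖v‖ := by gcongr
        have h7 : k * (2 * ⟪ξ, v⟫) ≤ k * (2 * (z * ‖v‖)) := by gcongr; linarith
        linarith
      have b5 := (abs_le.1 e5).2
      have b6 : δ * (1 + ‖p‖ + ‖q‖) ≤ δ * (1 + B + 2 * k * z) := by gcongr
      have b7 : σ * l ≤ σ * L := by gcongr; linarith
      linarith
  · exfalso
    obtain ⟨m, B₁, my, By, e1, e2, e3⟩ := hV.int τ ⟨ht'.trans hτ.1, hτ.2⟩ x (by linarith) ξ (by linarith) y hy0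
      (by linarith)
    obtain ⟨m', B', my', By', f1, f2, f3⟩ := hS.int x hxs y hy0 hys
    have g1 : ∀ v, B₁ v ≤ B' v := by
      intro v
      refine ((e1 v).touch (f1 v) ?_).2
      filter_upwards [evx v] with s hs
      have := hmax' τ (x + s • v) ξ y hτ.1 hτ.2 hs.le hξ hy hyh
      rw [zero_smul, add_zero]
      linarith
    have g2 := e2.touch f2 (by
      have h1 : ∀ᶠ s : ℝ in 𝓝 0, 0 < y + s := ev_gt _ (f := fun s : ℝ => y + s) (by fun_prop) (by simpa using hy0)
      have h2 : ∀ᶠ s : ℝ in 𝓝 0, y + s < h := ev_lt _ (f := fun s : ℝ => y + s) (by fun_prop) (by simpa using hys)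
      filter_upwards [h1, h2] with s hs1 hs2
      have := hmax' τ x ξ (y + s) hτ.1 hτ.2 hx hξ hs1.le hs2.le
      rw [add_zero]
      linarith)
    have g3 := e3 (EuclideanSpace.basisFun (Fin n) ℝ)
    have g4 : ∑ i, B₁ (EuclideanSpace.basisFun (Fin n) ℝ i) ≤ ∑ i, B' (EuclideanSpace.basisFun (Fin n) ℝ i) :=
      Finset.sum_le_sum fun i _ => g1 _
    rw [g2.1] at g3
    linarith [g2.2]

theorem norm_line {n : ℕ} (x v : En n) (s : ℝ) :
    ‖x + s • v‖ ^ 2 = ‖x‖ ^ 2 + 2 * ⟪x, v⟫ * s + ‖v‖ ^ 2 * s ^ 2 := by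
  rw [norm_add_sq_real, inner_smul_right, norm_smul, mul_pow, Real.norm_eq_abs, sq_abs]; ring

theorem T2.ypow {y : ℝ} (hy : 0 < y) (e : ℝ) :
    T2 (fun s => (y + s) ^ e) (e * y ^ e / y) (e * (e - 1) * y ^ e / y ^ 2) := by
  have h := (T2.quad y 1 0).rpow (by simpa using hy) e
  refine (h.congr_ev (Eventually.of_forall fun s => ?_)).congr_val ?_ ?_
  · simp
  · simp
  · simp

theorem barr1 {n : ℕ} {σ K1 K2 R₁ h : ℝ} (hσ : 0 < σ) (hσ1 : σ < 1) (hK1 : 0 < K1) :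
    Barr n σ R₁ h K2 (2 * K1 * R₁)
      (fun x y => K1 * (‖x‖ ^ 2 - (n + 1) * y ^ 2) + K2 * y ^ σ) where
  cont := by
    have : Continuous fun y : ℝ => y ^ σ := Real.continuous_rpow_const hσ.le
    have h2 : Continuous fun q : En n × ℝ => q.2 ^ σ := this.comp continuous_snd
    exact Continuous.continuousOn (by fun_prop)
  int := by
    intro x hx y hy hy1
    refine ⟨fun v => K1 * (2 * ⟪x, v⟫), fun v => K1 * (2 * ‖v‖ ^ 2),
      K1 * (-(n + 1) * 2 * y) + K2 * (σ * y ^ σ / y),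
      K1 * (-(n + 1) * 2) + K2 * (σ * (σ - 1) * y ^ σ / y ^ 2), fun v => ?_, ?_, ?_⟩
    · have h1 := ((T2.quad (‖x‖ ^ 2 - (n + 1) * y ^ 2) (2 * ⟪x, v⟫) (‖v‖ ^ 2)).const_mul K1).add
        (T2.const (K2 * y ^ σ))
      refine (h1.congr_ev (Eventually.of_forall fun s => ?_)).congr_val (by ring) (by ring)
      simp only [norm_line]; ring
    · have h1 := ((T2.quad (‖x‖ ^ 2 - (n + 1) * y ^ 2) (-(n + 1) * 2 * y) (-(n + 1))).const_mul K1).add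
        ((T2.ypow hy σ).const_mul K2)
      refine (h1.congr_ev (Eventually.of_forall fun s => ?_)).congr_val (by ring) (by ring)
      ring
    · have h1 : ∀ i, ‖EuclideanSpace.basisFun (Fin n) ℝ i‖ = 1 := fun i =>
        (EuclideanSpace.basisFun (Fin n) ℝ).orthonormal.1 i
      simp only [h1, Finset.sum_const, Finset.card_univ, Fintype.card_fin, nsmul_eq_mul]
      have : (n : ℝ) * (K1 * (2 * 1 ^ 2)) + (K1 * (-(n + 1) * 2) + K2 * (σ * (σ - 1) * y ^ σ / y ^ 2)) +
        (1 - σ) / y * (K1 * (-(n + 1) * 2 * y) + K2 * (σ * y ^ σ / y)) =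
        - (K1 * (2 + (n + 1) * 2 * (1 - σ))) := by field_simp; ring
      rw [this]
      have : 0 < 1 - σ := by linarith
      have : 0 < K1 * (2 + (n + 1) * 2 * (1 - σ)) := by positivity
      linarith
  bdry := by
    intro x hx
    refine ⟨K2, (2 * K1) • x, le_rfl, ?_, fun v => ?_, ?_⟩
    · rw [norm_smul, Real.norm_eq_abs, abs_of_pos (by linarith)]
      exact mul_le_mul_of_nonneg_left hx.le (by linarith)
    · have h1 := ((T2.quad (‖x‖ ^ 2 - (n + 1) * 0 ^ 2) (2 * ⟪x, v⟫) (‖v‖ ^ 2)).const_mul K1).add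
        (T2.const (K2 * 0 ^ σ))
      have h2 := (h1.congr_ev (g := fun s => K1 * (‖x + s • v‖ ^ 2 - (n + 1) * 0 ^ 2) + K2 * 0 ^ σ)
        (Eventually.of_forall fun s => by simp only [norm_line]; ring)).hasDerivAt
      refine h2.congr_deriv ?_
      rw [real_inner_smul_left]; ring
    · have hA : HasDerivAt (fun y : ℝ => K1 * (‖x‖ ^ 2 - (n + 1) * y ^ 2)) (K1 * (-((n + 1) * 0))) 0 := by
        have := (((hasDerivAt_pow 2 (0:ℝ)).const_mul ((n:ℝ) + 1)).const_sub (‖x‖ ^ 2)).const_mul K1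
        simpa using this
      have := flux_lim hσ hσ1 hA (C := fun _ => K2) continuousAt_const
      refine this.congr fun y => ?_
      ring

theorem barr2 {n : ℕ} {σ γ K3 K ε R₁ h : ℝ} (hσ : 0 < σ) (hσ1 : σ < γ) (hγ : γ < 1) (hK3 : 0 < K3)
    (hε : 0 < ε) :
    Barr n σ R₁ h (K3 * K) (K3 * (γ * (ε ^ 2) ^ (γ / 2 - 1)) * R₁)
      (fun x y => K3 * ((‖x‖ ^ 2 + y ^ 2 + ε ^ 2) ^ (γ / 2) + K * y ^ σ - (n + 3) / (γ - σ) * y ^ γ)) where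
  cont := by
    have hγ0 : 0 < γ := hσ.trans hσ1
    have h1 : Continuous fun q : En n × ℝ => q.2 ^ σ := (Real.continuous_rpow_const hσ.le).comp continuous_snd
    have h2 : Continuous fun q : En n × ℝ => q.2 ^ γ := (Real.continuous_rpow_const hγ0.le).comp continuous_snd
    have h3 : Continuous fun q : En n × ℝ => (‖q.1‖ ^ 2 + q.2 ^ 2 + ε ^ 2) ^ (γ / 2) :=
      (Real.continuous_rpow_const (by positivity : 0 ≤ γ / 2)).comp (by fun_prop)
    exact Continuous.continuousOn (by fun_prop)
  int := by
    intro x hx y hy hy1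
    have hγ0 : 0 < γ := hσ.trans hσ1
    set q := ‖x‖ ^ 2 + y ^ 2 + ε ^ 2 with hq
    have hq0 : 0 < q := by positivity
    set P := q ^ (γ / 2) with hP
    have hP0 : 0 < P := by positivity
    set k := ((n:ℝ) + 3) / (γ - σ) with hk
    refine ⟨fun v => K3 * (γ / 2 * P / q * (2 * ⟪x, v⟫)),
      fun v => K3 * (γ / 2 * (γ / 2 - 1) * P / q ^ 2 * (2 * ⟪x, v⟫) ^ 2 + γ / 2 * P / q * (2 * ‖v‖ ^ 2)),
      K3 * (γ / 2 * P / q * (2 * y) + K * (σ * y ^ σ / y) - k * (γ * y ^ γ / y)),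
      K3 * (γ / 2 * (γ / 2 - 1) * P / q ^ 2 * (2 * y) ^ 2 + γ / 2 * P / q * (2 * 1)
        + K * (σ * (σ - 1) * y ^ σ / y ^ 2) - k * (γ * (γ - 1) * y ^ γ / y ^ 2)), fun v => ?_, ?_, ?_⟩
    · have h1 := ((((T2.quad q (2 * ⟪x, v⟫) (‖v‖ ^ 2)).rpow (by simpa using hq0) (γ / 2)).add
        (T2.const (K * y ^ σ))).sub (T2.const (k * y ^ γ))).const_mul K3
      refine (h1.congr_ev (Eventually.of_forall fun s => ?_)).congr_val ?_ ?_
      · simp only [norm_line, hq]; ring_nf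
      · simp [hP]
      · simp [hP]
    · have h1 := ((((T2.quad q (2 * y) 1).rpow (by simpa using hq0) (γ / 2)).add
        ((T2.ypow hy σ).const_mul K)).sub ((T2.ypow hy γ).const_mul k)).const_mul K3
      refine (h1.congr_ev (Eventually.of_forall fun s => ?_)).congr_val ?_ ?_
      · simp only [hq]; ring_nf
      · simp [hP]
      · simp [hP]
    · have h1 : ∀ i, ‖EuclideanSpace.basisFun (Fin n) ℝ i‖ = 1 := fun i =>
        (EuclideanSpace.basisFun (Fin n) ℝ).orthonormal.1 i
      have hs : ∑ i, (K3 * (γ / 2 * (γ / 2 - 1) * P / q ^ 2 * (2 * ⟪x, EuclideanSpace.basisFun (Fin n) ℝ i⟫) ^ 2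
          + γ / 2 * P / q * (2 * ‖EuclideanSpace.basisFun (Fin n) ℝ i‖ ^ 2)))
          ≤ n * (K3 * (γ * (P / q))) := by
        have : ∀ i ∈ Finset.univ, (K3 * (γ / 2 * (γ / 2 - 1) * P / q ^ 2 * (2 * ⟪x, EuclideanSpace.basisFun (Fin n) ℝ i⟫) ^ 2
          + γ / 2 * P / q * (2 * ‖EuclideanSpace.basisFun (Fin n) ℝ i‖ ^ 2))) ≤ K3 * (γ * (P / q)) := by
          intro i _
          rw [h1]
          refine mul_le_mul_of_nonneg_left ?_ hK3.le
          have h2 : γ / 2 * (γ / 2 - 1) * P / q ^ 2 * (2 * ⟪x, EuclideanSpace.basisFun (Fin n) ℝ i⟫) ^ 2 ≤ 0 := by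
            refine mul_nonpos_of_nonpos_of_nonneg ?_ (sq_nonneg _)
            refine div_nonpos_of_nonpos_of_nonneg ?_ (sq_nonneg _)
            exact mul_nonpos_of_nonpos_of_nonneg (mul_nonpos_of_nonneg_of_nonpos (by positivity) (by linarith)) hP0.le
          have h3 : γ / 2 * P / q * (2 * 1 ^ 2) = γ * (P / q) := by ring
          linarith
        simpa using Finset.sum_le_sum this
      have hPq : P / q ≤ y ^ γ / y ^ 2 := by
        have e1 : P / q = q ^ (γ / 2 - 1) := by rw [Real.rpow_sub hq0, Real.rpow_one]
        have e2 : y ^ γ / y ^ 2 = (y ^ 2) ^ (γ / 2 - 1) := by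
          rw [Real.rpow_sub (by positivity), Real.rpow_one, ← Real.rpow_natCast y 2, ← Real.rpow_mul hy.le]
          congr 2
          push_cast; ring
        rw [e1, e2]
        refine Real.rpow_le_rpow_of_nonpos (by positivity) ?_ (by linarith)
        have := sq_nonneg ‖x‖
        have := sq_nonneg ε
        linarith
      have h2 : γ / 2 * (γ / 2 - 1) * P / q ^ 2 * (2 * y) ^ 2 ≤ 0 := by
        refine mul_nonpos_of_nonpos_of_nonneg ?_ (sq_nonneg _)
        refine div_nonpos_of_nonpos_of_nonneg ?_ (sq_nonneg _)
        exact mul_nonpos_of_nonpos_of_nonneg (mul_nonpos_of_nonneg_of_nonpos (by positivity) (by linarith)) hP0.le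
      set W := γ / 2 * (γ / 2 - 1) * P / q ^ 2 * (2 * y) ^ 2 with hW
      set Y := y ^ γ / y ^ 2 with hY
      have hY0 : 0 < Y := by positivity
      set Q := P / q with hQ
      have hQ0 : 0 < Q := by positivity
      have hkk : k * (γ - σ) = n + 3 := by rw [hk]; field_simp [(by linarith : γ - σ ≠ 0)]
      have e3 : K3 * (W + γ / 2 * P / q * (2 * 1)
        + K * (σ * (σ - 1) * y ^ σ / y ^ 2) - k * (γ * (γ - 1) * y ^ γ / y ^ 2)) +
        (1 - σ) / y * (K3 * (γ / 2 * P / q * (2 * y) + K * (σ * y ^ σ / y) - k * (γ * y ^ γ / y)))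
        = K3 * (W + γ * Q * (2 - σ) - k * (γ - σ) * γ * Y) := by
        rw [hQ, hY]; field_simp; ring
      have e4 : γ * Q * (2 - σ) ≤ γ * Y * 2 :=
        mul_le_mul (mul_le_mul_of_nonneg_left hPq hγ0.le) (by linarith) (by linarith) (by positivity)
      have e5 : n * (K3 * (γ * Q)) ≤ n * (K3 * (γ * Y)) := by gcongr
      rw [add_assoc, e3, hkk]
      have e6 : K3 * (W + γ * Q * (2 - σ) - (n + 3) * γ * Y) ≤ K3 * (0 + γ * Y * 2 - (n + 3) * γ * Y) := by
        gcongr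
      have e7 : 0 < K3 * (γ * Y) := by positivity
      linarith
  bdry := by
    intro x hx
    have hγ0 : 0 < γ := hσ.trans hσ1
    set q := ‖x‖ ^ 2 + ε ^ 2 with hq
    have hq0 : 0 < q := by positivity
    have hg0 : (0:ℝ) ^ γ = 0 := Real.zero_rpow hγ0.ne'
    have hs0 : (0:ℝ) ^ σ = 0 := Real.zero_rpow hσ.ne'
    refine ⟨K3 * K, (K3 * (γ * q ^ (γ / 2 - 1))) • x, le_rfl, ?_, fun v => ?_, ?_⟩
    · rw [norm_smul, Real.norm_eq_abs, abs_of_pos (by positivity)]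
      have : q ^ (γ / 2 - 1) ≤ (ε ^ 2) ^ (γ / 2 - 1) := by
        refine Real.rpow_le_rpow_of_nonpos (by positivity) ?_ (by linarith)
        have := sq_nonneg ‖x‖
        linarith
      gcongr
    · have h1 := (((T2.quad q (2 * ⟪x, v⟫) (‖v‖ ^ 2)).rpow (by simpa using hq0) (γ / 2)).const_mul K3)
      have h2 := (h1.congr_ev (g := fun s => K3 * ((‖x + s • v‖ ^ 2 + 0 ^ 2 + ε ^ 2) ^ (γ / 2) + K * 0 ^ σ - (n + 3) / (γ - σ) * 0 ^ γ))
        (Eventually.of_forall fun s => by simp only [norm_line, hg0, hs0, hq]; ring_nf)).hasDerivAt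
      refine h2.congr_deriv ?_
      rw [real_inner_smul_left, Real.rpow_sub hq0, Real.rpow_one]
      simp; ring
    · have hA : HasDerivAt (fun y : ℝ => K3 * (‖x‖ ^ 2 + y ^ 2 + ε ^ 2) ^ (γ / 2)) (K3 * (γ / 2 * q ^ (γ / 2) / q * 0)) 0 := by
        have h1 := (((T2.quad q 0 1).rpow (by simpa using hq0) (γ / 2)).const_mul K3)
        have h2 := (h1.congr_ev (g := fun y : ℝ => K3 * (‖x‖ ^ 2 + y ^ 2 + ε ^ 2) ^ (γ / 2))
          (Eventually.of_forall fun s => by simp only [hq]; ring_nf)).hasDerivAt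
        simpa using h2
      have hC : ContinuousAt (fun y : ℝ => K3 * (K - (n + 3) / (γ - σ) * y ^ (γ - σ))) 0 := by
        have := Real.continuousAt_rpow_const 0 (γ - σ) (Or.inr (by linarith))
        fun_prop
      have := flux_lim hσ (by linarith) hA hC
      have e : K3 * (K - (n + 3) / (γ - σ) * 0 ^ (γ - σ)) = K3 * K := by
        rw [Real.zero_rpow (by linarith)]; ring
      rw [e] at this
      refine this.congr' ?_
      filter_upwards [self_mem_nhdsWithin] with y hy
      have hy' : 0 < y := hy
      have e2 : y ^ γ = y ^ σ * y ^ (γ - σ) := by rw [← Real.rpow_add hy']; congr 1; ring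
      rw [e2, hs0, hg0]
      ring

/-- regularity at resolution `r` -/
structure Reg (n : ℕ) (γ C r : ℝ) (u : ℝ → En n → ℝ → ℝ) : Prop where
  near : ∀ t ∈ Icc (-(1/16 : ℝ)) 0, ∀ x₁, ‖x₁‖ ≤ 1/256 → ∀ x₂, ‖x₂‖ ≤ 1/256 → ‖x₁ - x₂‖ ≤ r ^ 2 / 2 →
    ∀ y, 0 ≤ y → y ≤ 1/256 → |u t x₁ y - u t x₂ y| ≤ C * r ^ (2 * γ)
  first : ∀ t ∈ Icc (-(1/16 : ℝ)) 0, ∀ x₁, ‖x₁‖ ≤ 1/256 → ∀ x₂, ‖x₂‖ ≤ 1/256 →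
    ∀ y, 0 ≤ y → y ≤ 1/256 → |u t x₁ y - u t x₂ y| ≤ C * (‖x₁ - x₂‖ + r) ^ γ
  second : ∀ t ∈ Icc (-(1/16 : ℝ)) 0, ∀ x₁, ‖x₁‖ ≤ 1/256 → ∀ x₂, ‖x₂‖ ≤ 1/256 → ∀ ξ, ‖ξ‖ ≤ 1/256 →
    ∀ y, 0 ≤ y → y ≤ 1/256 →
    (u t (x₁ + ξ) y - u t (x₁ - ξ) y) - (u t (x₂ + ξ) y - u t (x₂ - ξ) y) ≤
      C * (‖ξ‖ + r) ^ γ * (‖x₁ - x₂‖ + r) ^ γ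

theorem Reg.neg {n : ℕ} {γ C r : ℝ} {u : ℝ → En n → ℝ → ℝ} (h : Reg n γ C r u) :
    Reg n γ C r (fun t x y => - u t x y) := by
  refine ⟨fun t ht x₁ h1 x₂ h2 h3 y hy hy1 => ?_, fun t ht x₁ h1 x₂ h2 y hy hy1 => ?_,
    fun t ht x₁ h1 x₂ h2 ξ hξ y hy hy1 => ?_⟩
  · have := h.near t ht x₁ h1 x₂ h2 h3 y hy hy1
    rwa [← abs_neg, (by ring : -(-u t x₁ y - -u t x₂ y) = u t x₁ y - u t x₂ y)]
  · have := h.first t ht x₁ h1 x₂ h2 y hy hy1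
    rwa [← abs_neg, (by ring : -(-u t x₁ y - -u t x₂ y) = u t x₁ y - u t x₂ y)]
  · have := h.second t ht x₂ h2 x₁ h1 ξ hξ y hy hy1
    rw [norm_sub_rev] at this
    linarith

theorem Reg.shift {n : ℕ} {γ C r : ℝ} {u : ℝ → En n → ℝ → ℝ} (h : Reg n γ C r u) (g : ℝ → ℝ → ℝ) :
    Reg n γ C r (fun t x y => u t x y - g t y) := by
  refine ⟨fun t ht x₁ h1 x₂ h2 h3 y hy hy1 => ?_, fun t ht x₁ h1 x₂ h2 y hy hy1 => ?_,
    fun t ht x₁ h1 x₂ h2 ξ hξ y hy hy1 => ?_⟩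
  · simpa using h.near t ht x₁ h1 x₂ h2 h3 y hy hy1
  · simpa using h.first t ht x₁ h1 x₂ h2 y hy hy1
  · simpa using h.second t ht x₁ h1 x₂ h2 ξ hξ y hy hy1

theorem SDReg (n : ℕ) {σ γ : ℝ} (hσ : 0 < σ) (hγ : σ < γ) (hγ1 : γ < 1) :
    ∃ C > 0, ∀ r, 0 < r → r ≤ 1 → ∃ δ₀ > 0, ∀ δ, 0 ≤ δ → δ ≤ δ₀ → ∀ u : ℝ → En n → ℝ → ℝ,
      ClassU n σ 1 (1/2) δ 0 u → Bd1 n 1 (1/2) u → Reg n γ C r u := by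
  obtain ⟨C, hC, H⟩ := SD n hσ hγ hγ1
  refine ⟨C, hC, fun r hr hr1 => ?_⟩
  obtain ⟨d1, hd1, H1⟩ := H r hr hr1
  obtain ⟨d2, hd2, H2⟩ := H (r ^ 2 / 2) (by positivity) (by nlinarith)
  refine ⟨min d1 d2, lt_min hd1 hd2, fun δ hδ0 hδ u hu hb => ?_⟩
  have G1 := H1 δ hδ0 (hδ.trans (min_le_left _ _)) u hu hb
  have G2 := H2 δ hδ0 (hδ.trans (min_le_right _ _)) u hu hb
  refine ⟨fun t ht x₁ h1 x₂ h2 h3 y hy hy1 => ?_, fun t ht x₁ h1 x₂ h2 y hy hy1 => ?_, G1.2⟩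
  · refine (G2.1 t ⟨by linarith [ht.1], ht.2⟩ x₁ (by linarith) x₂ (by linarith) y hy (by linarith)).trans ?_
    refine mul_le_mul_of_nonneg_left ?_ hC.le
    have e : r ^ (2 * γ) = (r ^ 2) ^ γ := by rw [Real.rpow_mul hr.le, Real.rpow_two]
    rw [e]
    exact Real.rpow_le_rpow (by positivity) (by linarith) (by linarith)
  · exact G1.1 t ⟨by linarith [ht.1], ht.2⟩ x₁ (by linarith) x₂ (by linarith) y hy (by linarith)

theorem rpow_two_mul' {r γ : ℝ} (hr : 0 < r) : r ^ (2 * γ) = r ^ γ * r ^ γ := by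
  rw [two_mul, Real.rpow_add hr]

theorem mul_rpow_le {c r γ : ℝ} (hc : 1 ≤ c) (hr : 0 < r) (hγ0 : 0 < γ) (hγ : γ < 1) :
    (c * r) ^ γ ≤ c * r ^ γ := by
  rw [Real.mul_rpow (by linarith) hr.le]
  refine mul_le_mul_of_nonneg_right ?_ (by positivity)
  simpa using Real.rpow_le_rpow_of_exponent_le hc hγ.le

set_option maxHeartbeats 1000000 in
theorem L3 {n : ℕ} {σ γ C r : ℝ} (hσ : 0 < σ) (hγ : σ < γ) (hγ1 : γ < 1) (hC : 0 < C) (hr : 0 < r)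
    (hr1 : r ≤ 1/512) (hrσ : r ^ σ ≤ 1/16) :
    ∃ δ₀ > 0, ∀ δ, 0 ≤ δ → δ ≤ δ₀ → ∀ w : ℝ → En n → ℝ → ℝ,
      ClassU n σ 1 (1/2) δ 0 w → Reg n γ C r w → (∀ τ ∈ Icc (-r ^ σ) 0, w τ 0 r ≤ w τ 0 0) →
      ∀ τ ∈ Icc (-r ^ σ) 0, ∀ y, 0 ≤ y → y ≤ r →
        w τ 0 y - w (-r ^ σ) 0 0 ≤ (21 * (n + 2) + 3) * C * r ^ (2 * γ) := by
  have hσ1 : σ < 1 := by linarith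
  have hγ0 : 0 < γ := by linarith
  set P := r ^ (2 * γ) with hP
  have hP0 : 0 < P := by positivity
  have hrs : 0 < r ^ σ := by positivity
  set K2 : ℝ := 7 * C * (n + 2) with hK2
  have hK20 : 0 < K2 := by positivity
  set k1 := 7 * C * P / r ^ 2 with hk1
  have hk10 : 0 < k1 := by positivity
  set k2 := K2 * P / r ^ σ with hk2
  have hk20 : 0 < k2 := by positivity
  set z := r ^ 2 / 2 with hz
  have hz0 : 0 < z := by positivity
  have hzr : z ≤ r := by rw [hz, sq]; have := mul_le_mul_of_nonneg_left hr1 hr.le; linarith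
  set k := 3 * C * P / z ^ 2 with hk
  have hk0 : 0 < k := by positivity
  set Q := 1 + 2 * k1 * r + 2 * k * z with hQ
  have hQ0 : 0 < Q := by positivity
  refine ⟨σ * k2 / (6 * Q), by positivity, fun δ hδ0 hδ w hw hreg hflat => ?_⟩
  have hV := hw.pair hδ0 (c := 1) one_pos (ε := 1) (Or.inl rfl) (μ := -1) (Or.inr rfl) (ξ₀ := 0)
    (R := 1/8) (Z := 1/8) (by norm_num) (by norm_num)
  have hW : ∀ t x ξ y, (1:ℝ) * (w t (x + (0 + ξ)) y + 1 * w t ((-1 : ℝ) • (x - (0 + ξ))) y)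
      = w t (ξ + x) y + w t (ξ - x) y := by
    intro t x ξ y
    rw [zero_add, add_comm x ξ, one_mul, one_mul, neg_smul, one_smul, neg_sub]
  have hd : δ * Q ≤ σ * k2 / 6 := by
    rw [le_div_iff₀ (by positivity)] at hδ; linarith
  have hik : -(1/16 : ℝ) ≤ -r ^ σ := by linarith
  have hA : ∀ τ ∈ Icc (-r ^ σ) 0, ∀ x, ‖x‖ ≤ r → ∀ ξ, ‖ξ‖ ≤ z → ∀ y, 0 ≤ y → y ≤ r →
      (w τ (ξ + x) y + w τ (ξ - x) y) - (w τ (0 + x) y + w τ (0 - x) y) ≤ 2 * C * P := by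
    intro τ hτ x hx ξ hξ y hy hy1
    have ht : τ ∈ Icc (-(1/16:ℝ)) 0 := ⟨hik.trans hτ.1, hτ.2⟩
    have n1 := norm_add_le ξ x
    have n2 := norm_sub_le ξ x
    have h1 := hreg.near τ ht (ξ + x) (by linarith) (0 + x) (by rw [zero_add]; linarith)
      (by rw [add_sub_add_right_eq_sub, sub_zero]; exact hξ) y hy (by linarith)
    have h2 := hreg.near τ ht (ξ - x) (by linarith) (0 - x) (by rw [zero_sub, norm_neg]; linarith)
      (by rw [sub_sub_sub_cancel_right, sub_zero]; exact hξ) y hy (by linarith)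
    have := (le_abs_self _).trans h1
    have := (le_abs_self _).trans h2
    linarith
  have hB : ∀ τ ∈ Icc (-r ^ σ) 0, ∀ x, ‖x‖ ≤ r → ∀ y, 0 ≤ y → y ≤ r →
      (w τ (0 + x) y + w τ (0 - x) y) - (w τ (0 + 0) y + w τ (0 - 0) y) ≤ 4 * C * P := by
    intro τ hτ x hx y hy hy1
    have ht : τ ∈ Icc (-(1/16:ℝ)) 0 := ⟨hik.trans hτ.1, hτ.2⟩
    have hxn : ‖(1/2 : ℝ) • x‖ = ‖x‖ / 2 := by rw [norm_smul]; norm_num; ring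
    have h1 := hreg.second τ ht ((1/2 : ℝ) • x) (by rw [hxn]; linarith) (-((1/2 : ℝ) • x))
      (by rw [norm_neg, hxn]; linarith) ((1/2 : ℝ) • x) (by rw [hxn]; linarith) y hy (by linarith)
    have e1 : (1/2 : ℝ) • x + (1/2 : ℝ) • x = x := by rw [← add_smul]; norm_num
    rw [sub_neg_eq_add, e1, sub_self, neg_add_cancel, ← neg_add', e1, hxn] at h1
    have h2 : (‖x‖ / 2 + r) ^ γ ≤ 2 * r ^ γ :=
      (Real.rpow_le_rpow (by positivity) (by linarith) hγ0.le).trans (mul_rpow_le (by norm_num) hr hγ0 hγ1)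
    have h3 : (‖x‖ + r) ^ γ ≤ 2 * r ^ γ :=
      (Real.rpow_le_rpow (by positivity) (by linarith) hγ0.le).trans (mul_rpow_le (by norm_num) hr hγ0 hγ1)
    have h4 : C * (‖x‖ / 2 + r) ^ γ * (‖x‖ + r) ^ γ ≤ C * (2 * r ^ γ) * (2 * r ^ γ) := by gcongr
    have h5 : P = r ^ γ * r ^ γ := rpow_two_mul' hr
    rw [h5, zero_add, zero_sub, zero_add, sub_zero]
    linarith
  have hkk : k * z ^ 2 = 3 * C * P := by rw [hk]; field_simp
  have hkr : k1 * r ^ 2 = 7 * C * P := by rw [hk1]; field_simp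
  have hkr2 : k2 * r ^ σ = K2 * P := by rw [hk2]; field_simp
  have h0r : ‖(0 : En n)‖ ≤ r := by simpa using hr.le
  have h0z : ‖(0 : En n)‖ ≤ z := by simpa using hz0.le
  have hys : ∀ y, 0 ≤ y → y ≤ r → k2 * y ^ σ ≤ K2 * P := by
    intro y hy hy1
    rw [← hkr2]; gcongr
  have hCP : 0 < C * P := by positivity
  have key := CL hV (barr1 (n := n) (K1 := k1) (K2 := k2) (R₁ := r) (h := r) hσ hσ1 hk10) hσ (by positivity)
    (by linarith) (by linarith) hr.le (z := z) (by linarith) hz0.le (k := k) hk0.le hr.le (t' := -r ^ σ) (by linarith)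
    (lam := 2 * σ * k2) (M := (w (-r ^ σ) 0 0 + w (-r ^ σ) 0 0) + 6 * C * P) (by
      have h1 : δ * (2 * 1 + 1) * (1 + 2 * k1 * r + 2 * k * z) = 3 * (δ * Q) := by rw [hQ]; ring
      rw [h1]
      have : 0 < σ * k2 := by positivity
      linarith) ?_ ?_
  · intro τ hτ y hy hy1
    have h1 := key τ hτ 0 h0r 0 h0z y hy hy1
    rw [hW] at h1
    simp only [add_zero, sub_zero, norm_zero] at h1
    have h2 : 2 * σ * k2 * (τ - -r ^ σ) ≤ 2 * σ * k2 * r ^ σ :=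
      mul_le_mul_of_nonneg_left (by linarith [hτ.2]) (by positivity)
    have h3 : 2 * σ * k2 * r ^ σ = 2 * σ * (K2 * P) := by rw [← hkr2]; ring
    have h4 : σ * (K2 * P) ≤ 1 * (K2 * P) := mul_le_mul_of_nonneg_right hσ1.le (by positivity)
    have h5 := hys y hy hy1
    have h6 : 0 ≤ k1 * ((n + 1) * y ^ 2) := by positivity
    have h7 : K2 * P = 7 * (n + 2) * C * P := by rw [hK2]; ring
    have h8 : (21 * ((n:ℝ) + 2) + 3) * C * P = 3 * (7 * (n + 2) * C * P) + 3 * C * P := by ring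
    rw [h8, ← h7]
    have h9 : 0 < K2 * P := by positivity
    linarith
  · intro x hx ξ hξ
    have h0 : -r ^ σ ∈ Icc (-r ^ σ) 0 := ⟨le_rfl, by linarith⟩
    have h1 := hA _ h0 x hx ξ hξ 0 le_rfl hr.le
    have h2 := hB _ h0 x hx 0 le_rfl hr.le
    rw [hW]
    rw [add_zero, sub_zero] at h2
    rw [Real.zero_rpow hσ.ne']
    have h3 : 0 ≤ k1 * (‖x‖ ^ 2) := by positivity
    have h4 : 0 ≤ k * ‖ξ‖ ^ 2 := by positivity
    linarith
  · intro τ hτ x hx ξ hξ y hy hy1 hor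
    have h1 := hA τ hτ x hx ξ hξ y hy hy1
    have h2 := hB τ hτ x hx y hy hy1
    have h4 : 0 ≤ k * ‖ξ‖ ^ 2 := by positivity
    rcases hor with hor | hor | hor
    · refine ⟨0, 0, y, h0r, h0z, hy, hy1, ?_⟩
      rw [hW, hW, hor, norm_zero]
      linarith
    · refine ⟨x, 0, y, hx, h0z, hy, hy1, ?_⟩
      rw [hW, hW, hor, norm_zero]
      linarith
    · refine ⟨0, 0, 0, h0r, h0z, le_rfl, hr.le, ?_⟩
      rw [hW, hW, hor, norm_zero]
      rw [hor] at h1 h2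
      have h5 := hflat τ hτ
      rw [add_zero, sub_zero] at h2 ⊢
      rw [Real.zero_rpow hσ.ne', hkr2]
      have h3 : 0 ≤ k1 * (‖x‖ ^ 2) := by positivity
      have h6 : k1 * (‖x‖ ^ 2 - (n + 1) * r ^ 2) + K2 * P = k1 * ‖x‖ ^ 2 + 7 * C * P := by
        have : k1 * (‖x‖ ^ 2 - (n + 1) * r ^ 2) = k1 * ‖x‖ ^ 2 - (n + 1) * (k1 * r ^ 2) := by ring
        rw [this, hkr, hK2]; ring
      rw [h6]
      linarith

set_option maxHeartbeats 1000000 in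
theorem L4 (n : ℕ) {σ γ C : ℝ} (hσ : 0 < σ) (hγ : σ < γ) (hγ1 : γ < 1) (hC : 0 < C) :
    ∃ C' > 0, ∀ r, 0 < r → r ≤ 1/1024 → r ^ γ ≤ (1/512 : ℝ) ^ γ / 2 → r ^ σ ≤ 1/16 →
    ∃ δ₀ > 0, ∀ δ, 0 ≤ δ → δ ≤ δ₀ → ∀ w : ℝ → En n → ℝ → ℝ,
      ClassU n σ 1 (1/2) δ 0 w → Reg n γ C r w →
      ∀ τ ∈ Icc (-r ^ σ) 0, ∀ x, ‖x‖ ≤ r → ∀ y, 0 ≤ y → y ≤ r →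
        (w τ x y - w τ (-x) y) - (w (-r ^ σ) x 0 - w (-r ^ σ) (-x) 0) ≤ C' * r ^ (γ + σ) := by
  have hσ1 : σ < 1 := by linarith
  have hγ0 : 0 < γ := by linarith
  obtain ⟨H, hH⟩ : ∃ H : ℝ, H = 1/512 := ⟨_, rfl⟩
  have hH0 : 0 < H := by linarith
  rw [← hH]
  set K3 : ℝ := 21 * C / H ^ γ with hK3
  have hHγ : 0 < H ^ γ := by positivity
  have hHγ1 : H ^ γ ≤ 1 := Real.rpow_le_one hH0.le (by linarith) hγ0.le
  have hK30 : 0 < K3 := by positivity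
  have hK3H : K3 * H ^ γ = 21 * C := by rw [hK3]; field_simp
  have hK3C : 21 * C ≤ K3 := by rw [hK3, le_div_iff₀ hHγ]; exact mul_le_of_le_one_right (by positivity) hHγ1
  set K : ℝ := (n + 3) / (γ - σ) with hK
  have hK0 : 0 < K := by have : 0 < γ - σ := by linarith
                         positivity
  refine ⟨K3 * (2 + 3 * K) + 2 * C, by positivity, fun r hr hr1 hrγ hrσ => ?_⟩
  set P := r ^ (2 * γ) with hP
  have hP0 : 0 < P := by positivity
  have hrs : 0 < r ^ σ := by positivity
  have hrg : 0 < r ^ γ := by positivity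
  have hPg : P = r ^ γ * r ^ γ := rpow_two_mul' hr
  have hgs : r ^ γ ≤ r ^ σ := Real.rpow_le_rpow_of_exponent_ge hr (by linarith) hγ.le
  set k3 := K3 * r ^ γ with hk3
  have hk30 : 0 < k3 := by positivity
  set z := r ^ 2 / 2 with hz
  have hz0 : 0 < z := by positivity
  have hzr : z ≤ r := by rw [hz, sq]; have := mul_le_mul_of_nonneg_left hr1 hr.le; linarith
  set k := 3 * C * P / z ^ 2 with hk
  have hk0 : 0 < k := by positivity
  set Bb := k3 * (γ * (r ^ 2) ^ (γ / 2 - 1)) * H with hBb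
  have hBb0 : 0 < Bb := by positivity
  set Q := 1 + Bb + 2 * k * z with hQ
  have hQ0 : 0 < Q := by positivity
  refine ⟨σ * (k3 * K) / (6 * Q), by positivity, fun δ hδ0 hδ w hw hreg => ?_⟩
  intro τ₀ hτ₀ ρ hρ y₀ hy₀ hy₀1
  have hV := hw.pair hδ0 (c := 1) one_pos (ε := -1) (Or.inr rfl) (μ := 1) (Or.inl rfl) (ξ₀ := ρ)
    (R := 1/8) (Z := 1/8) (by linarith) (by norm_num)
  have hW : ∀ t x ξ y, (1:ℝ) * (w t (x + (ρ + ξ)) y + -1 * w t ((1 : ℝ) • (x - (ρ + ξ))) y)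
      = w t (x + (ρ + ξ)) y - w t (x - (ρ + ξ)) y := by
    intro t x ξ y
    rw [one_mul, one_smul]; ring
  have hd : δ * Q ≤ σ * (k3 * K) / 6 := by
    rw [le_div_iff₀ (by positivity)] at hδ; linarith
  have hik : -(1/16 : ℝ) ≤ -r ^ σ := by linarith
  have hA : ∀ τ ∈ Icc (-r ^ σ) 0, ∀ x, ‖x‖ ≤ H → ∀ ξ, ‖ξ‖ ≤ z → ∀ y, 0 ≤ y → y ≤ H →
      (w τ (x + (ρ + ξ)) y - w τ (x - (ρ + ξ)) y) - (w τ (x + (ρ + 0)) y - w τ (x - (ρ + 0)) y) ≤ 2 * C * P := by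
    intro τ hτ x hx ξ hξ y hy hy1
    have ht : τ ∈ Icc (-(1/16:ℝ)) 0 := ⟨hik.trans hτ.1, hτ.2⟩
    have n0 := norm_add_le ρ ξ
    have n1 := norm_add_le x (ρ + ξ)
    have n2 := norm_sub_le x (ρ + ξ)
    have n3 := norm_add_le x (ρ + 0)
    have n4 := norm_sub_le x (ρ + 0)
    rw [add_zero] at n3 n4
    have h1 := hreg.near τ ht (x + (ρ + ξ)) (by linarith) (x + (ρ + 0)) (by rw [add_zero]; linarith)
      (by rw [add_sub_add_left_eq_sub, add_sub_add_left_eq_sub, sub_zero]; exact hξ) y hy (by linarith)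
    have h2 := hreg.near τ ht (x - (ρ + ξ)) (by linarith) (x - (ρ + 0)) (by rw [add_zero]; linarith)
      (by rw [sub_sub_sub_cancel_left, add_sub_add_left_eq_sub, zero_sub, norm_neg]; exact hξ) y hy (by linarith)
    have := (le_abs_self _).trans h1
    have := (neg_le_abs _).trans h2
    linarith
  have hB : ∀ τ ∈ Icc (-r ^ σ) 0, ∀ x, ‖x‖ ≤ H → ∀ y, 0 ≤ y → y ≤ H →
      (w τ (x + (ρ + 0)) y - w τ (x - (ρ + 0)) y) - (w τ (0 + (ρ + 0)) y - w τ (0 - (ρ + 0)) y)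
        ≤ 2 * C * r ^ γ * (‖x‖ + r) ^ γ := by
    intro τ hτ x hx y hy hy1
    have ht : τ ∈ Icc (-(1/16:ℝ)) 0 := ⟨hik.trans hτ.1, hτ.2⟩
    have h1 := hreg.second τ ht x (by linarith) 0 (by norm_num) (ρ + 0) (by rw [add_zero]; linarith)
      y hy (by linarith)
    refine h1.trans ?_
    rw [add_zero, sub_zero]
    have h2 : (‖ρ‖ + r) ^ γ ≤ 2 * r ^ γ :=
      (Real.rpow_le_rpow (by positivity) (by linarith) hγ0.le).trans (mul_rpow_le (by norm_num) hr hγ0 hγ1)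
    have : C * (‖ρ‖ + r) ^ γ ≤ 2 * C * r ^ γ := by
      have := mul_le_mul_of_nonneg_left h2 hC.le; linarith
    gcongr
  have hD : ∀ τ ∈ Icc (-r ^ σ) 0, ∀ x, ‖x‖ ≤ H → ∀ ξ, ‖ξ‖ ≤ z → ∀ y, 0 ≤ y → y ≤ H →
      |w τ (x + (ρ + ξ)) y - w τ (x - (ρ + ξ)) y| ≤ 5 * C * r ^ γ := by
    intro τ hτ x hx ξ hξ y hy hy1
    have ht : τ ∈ Icc (-(1/16:ℝ)) 0 := ⟨hik.trans hτ.1, hτ.2⟩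
    have n0 := norm_add_le ρ ξ
    have n1 := norm_add_le x (ρ + ξ)
    have n2 := norm_sub_le x (ρ + ξ)
    refine (hreg.first τ ht (x + (ρ + ξ)) (by linarith) (x - (ρ + ξ)) (by linarith) y hy (by linarith)).trans ?_
    have e : x + (ρ + ξ) - (x - (ρ + ξ)) = (ρ + ξ) + (ρ + ξ) := by abel
    rw [e]
    have n3 := norm_add_le (ρ + ξ) (ρ + ξ)
    have h2 : (‖(ρ + ξ) + (ρ + ξ)‖ + r) ^ γ ≤ 5 * r ^ γ :=
      (Real.rpow_le_rpow (by positivity) (by linarith) hγ0.le).trans (mul_rpow_le (by norm_num) hr hγ0 hγ1)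
    have := mul_le_mul_of_nonneg_left h2 hC.le
    linarith
  have hkk : k * z ^ 2 = 3 * C * P := by rw [hk]; field_simp
  have h0H : ‖(0 : En n)‖ ≤ H := by rw [norm_zero]; exact hH0.le
  have h0z : ‖(0 : En n)‖ ≤ z := by simpa using hz0.le
  have hCP : 0 < C * P := by positivity
  have hs0 : (0:ℝ) ^ σ = 0 := Real.zero_rpow hσ.ne'
  have hg0 : (0:ℝ) ^ γ = 0 := Real.zero_rpow hγ0.ne'
  have hsq : ∀ q : ℝ, 0 ≤ q → (q ^ 2) ^ (γ / 2) = q ^ γ := by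
    intro q hq
    rw [← Real.rpow_natCast q 2, ← Real.rpow_mul hq]; congr 1; push_cast; ring
  have hyK : ∀ y, 0 ≤ y → y ≤ H → 0 ≤ K * y ^ σ - K * y ^ γ := by
    intro y hy hy1
    rcases hy.eq_or_lt with rfl | hy0
    · rw [hs0, hg0]; simp
    · have := Real.rpow_le_rpow_of_exponent_ge hy0 (by linarith) hγ.le
      have := mul_le_mul_of_nonneg_left this hK0.le
      linarith
  have hbig : ∀ τ ∈ Icc (-r ^ σ) 0, ∀ x, ‖x‖ ≤ H → ∀ ξ, ‖ξ‖ ≤ z → ∀ y, 0 ≤ y → y ≤ H →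
      (‖x‖ = H ∨ y = H) →
      w τ (x + (ρ + ξ)) y - w τ (x - (ρ + ξ)) y -
        (k3 * ((‖x‖ ^ 2 + y ^ 2 + r ^ 2) ^ (γ / 2) + K * y ^ σ - K * y ^ γ) + k * ‖ξ‖ ^ 2) <
      w τ (0 + (ρ + 0)) 0 - w τ (0 - (ρ + 0)) 0 -
        (k3 * ((‖(0 : En n)‖ ^ 2 + 0 ^ 2 + r ^ 2) ^ (γ / 2) + K * 0 ^ σ - K * 0 ^ γ) + k * ‖(0 : En n)‖ ^ 2) := by
    intro τ hτ x hx ξ hξ y hy hy1 hor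
    have h1 := (le_abs_self _).trans (hD τ hτ x hx ξ hξ y hy hy1)
    have h2 := (neg_le_abs _).trans (hD τ hτ 0 h0H 0 h0z 0 le_rfl hH0.le)
    have h3 : H ^ γ ≤ (‖x‖ ^ 2 + y ^ 2 + r ^ 2) ^ (γ / 2) := by
      rw [← hsq H hH0.le]
      refine Real.rpow_le_rpow (by positivity) ?_ (by positivity)
      have := sq_nonneg ‖x‖
      have := sq_nonneg y
      have := sq_nonneg r
      rcases hor with h | h <;> rw [h] <;> linarith
    have h4 : 0 ≤ k * ‖ξ‖ ^ 2 := by positivity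
    have h5 : k3 * (H ^ γ) ≤ k3 * ((‖x‖ ^ 2 + y ^ 2 + r ^ 2) ^ (γ / 2) + K * y ^ σ - K * y ^ γ) := by
      refine mul_le_mul_of_nonneg_left ?_ hk30.le
      linarith [hyK y hy hy1]
    have h6 : k3 * r ^ γ ≤ k3 * (H ^ γ / 2) := mul_le_mul_of_nonneg_left hrγ hk30.le
    have h7 : k3 * H ^ γ = 21 * C * r ^ γ := by rw [hk3, mul_right_comm, hK3H]
    have h8 : k3 * ((‖(0 : En n)‖ ^ 2 + 0 ^ 2 + r ^ 2) ^ (γ / 2) + K * 0 ^ σ - K * 0 ^ γ) + k * ‖(0 : En n)‖ ^ 2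
        = k3 * r ^ γ := by
      rw [norm_zero, hs0, hg0, ← hsq r hr.le]; norm_num
    rw [h8]
    have h9 : 0 < C * r ^ γ := by positivity
    linarith
  have key := CL hV (barr2 (n := n) (K3 := k3) (K := K) (ε := r) (R₁ := H) (h := H) hσ hγ hγ1 hk30 hr) hσ (by positivity)
    (by linarith) (by linarith) hH0.le (z := z) (by linarith) hz0.le (k := k) hk0.le hH0.le (t' := -r ^ σ) (by linarith)
    (lam := 2 * σ * (k3 * K)) (M := (w (-r ^ σ) ρ 0 - w (-r ^ σ) (-ρ) 0) + 2 * C * P) (by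
      have h1 : δ * (2 * 1 + 1) * (1 + Bb + 2 * k * z) = 3 * (δ * Q) := by rw [hQ]; ring
      rw [h1]
      have : 0 < σ * (k3 * K) := by positivity
      linarith) ?_ ?_
  · have h1 := key τ₀ hτ₀ 0 h0H 0 h0z y₀ hy₀ (by linarith)
    rw [hW, ← hK] at h1
    simp only [add_zero, zero_add, zero_sub, norm_zero] at h1
    have h2 : 2 * σ * (k3 * K) * (τ₀ - -r ^ σ) ≤ 2 * (k3 * K) * r ^ σ := by
      have a1 : 2 * σ * (k3 * K) ≤ 2 * (k3 * K) := by
        rw [mul_right_comm, mul_assoc]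
        exact mul_le_mul_of_nonneg_left (mul_le_of_le_one_right (by positivity) hσ1.le) (by norm_num)
      have a2 : τ₀ - -r ^ σ ≤ r ^ σ := by linarith [hτ₀.2]
      have a3 : 0 ≤ τ₀ - -r ^ σ := by linarith [hτ₀.1]
      exact mul_le_mul a1 a2 a3 (by positivity)
    have h3 : (0 ^ 2 + y₀ ^ 2 + r ^ 2) ^ (γ / 2) ≤ 2 * r ^ σ := by
      refine (Real.rpow_le_rpow (z := γ / 2) (by positivity) (by have := pow_le_pow_left₀ hy₀ hy₀1 2; have := sq_nonneg r; linarith : 0 ^ 2 + y₀ ^ 2 + r ^ 2 ≤ (2 * r) ^ 2) (by positivity)).trans ?_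
      rw [hsq _ (by positivity)]
      exact (mul_rpow_le (by norm_num) hr hγ0 hγ1).trans (by linarith)
    have h4 : K * y₀ ^ σ ≤ K * r ^ σ := by gcongr
    have h5 : 0 ≤ K * y₀ ^ γ := by positivity
    have h6 : k3 * ((0 ^ 2 + y₀ ^ 2 + r ^ 2) ^ (γ / 2) + K * y₀ ^ σ - K * y₀ ^ γ) ≤ k3 * (2 * r ^ σ + K * r ^ σ) :=
      mul_le_mul_of_nonneg_left (by linarith) hk30.le
    have h7 : C * P ≤ C * (r ^ γ * r ^ σ) := by rw [hPg]; gcongr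
    rw [Real.rpow_add hr]
    have h8 : (K3 * (2 + 3 * K) + 2 * C) * (r ^ γ * r ^ σ) =
      k3 * (2 * r ^ σ + K * r ^ σ) + 2 * (k3 * K) * r ^ σ + 2 * (C * (r ^ γ * r ^ σ)) := by rw [hk3]; ring
    rw [h8]
    linarith
  · intro x hx ξ hξ
    have h0 : -r ^ σ ∈ Icc (-r ^ σ) 0 := ⟨le_rfl, by linarith⟩
    have h1 := hA _ h0 x hx ξ hξ 0 le_rfl hH0.le
    have h2 := hB _ h0 x hx 0 le_rfl hH0.le
    rw [hW, hs0, hg0]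
    rw [add_zero ρ, zero_add, zero_sub] at h2
    rw [add_zero ρ] at h1
    have h4 : 0 ≤ k * ‖ξ‖ ^ 2 := by positivity
    have h5 : (‖x‖ + r) ^ γ ≤ 2 * (‖x‖ ^ 2 + 0 ^ 2 + r ^ 2) ^ (γ / 2) := by
      rw [← hsq _ (by positivity)]
      have a1 : (‖x‖ + r) ^ 2 ≤ 4 * (‖x‖ ^ 2 + 0 ^ 2 + r ^ 2) := by linarith [sq_nonneg (‖x‖ - r), sq_nonneg ‖x‖, sq_nonneg r]
      refine (Real.rpow_le_rpow (by positivity) a1 (by positivity)).trans ?_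
      rw [Real.mul_rpow (by norm_num) (by positivity)]
      refine mul_le_mul_of_nonneg_right ?_ (by positivity)
      rw [(by norm_num : (4:ℝ) = 2 ^ 2), hsq 2 (by norm_num)]
      simpa using Real.rpow_le_rpow_of_exponent_le (by norm_num : (1:ℝ) ≤ 2) hγ1.le
    have h6 : 2 * C * r ^ γ * (‖x‖ + r) ^ γ ≤ k3 * (‖x‖ ^ 2 + 0 ^ 2 + r ^ 2) ^ (γ / 2) := by
      refine (mul_le_mul_of_nonneg_left h5 (by positivity)).trans ?_
      rw [hk3, ← mul_assoc]
      refine mul_le_mul_of_nonneg_right ?_ (by positivity)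
      rw [mul_right_comm]
      refine mul_le_mul_of_nonneg_right ?_ hrg.le
      linarith
    linarith
  · intro τ hτ x hx ξ hξ y hy hy1 hor
    rcases hor with hor | hor | hor
    · refine ⟨0, 0, 0, h0H, h0z, le_rfl, hH0.le, ?_⟩
      rw [hW, hW]
      exact hbig τ hτ x hx ξ hξ y hy hy1 (Or.inl hor)
    · refine ⟨x, 0, y, hx, h0z, hy, hy1, ?_⟩
      have h1 := hA τ hτ x hx ξ hξ y hy hy1
      rw [hW, hW, hor, norm_zero]
      linarith
    · refine ⟨0, 0, 0, h0H, h0z, le_rfl, hH0.le, ?_⟩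
      rw [hW, hW]
      exact hbig τ hτ x hx ξ hξ y hy hy1 (Or.inr hor)

theorem hyers1 {G : ℝ → ℝ} {η Bd : ℝ} (hadd : ∀ s ∈ Icc (-1:ℝ) 1, ∀ t ∈ Icc (-1:ℝ) 1, |G (s + t) - G s - G t| ≤ η)
    (hb : ∀ s ∈ Icc (0:ℝ) 1, |G s| ≤ Bd) (h1 : G 1 = 0) : ∀ s ∈ Icc (-1:ℝ) 1, |G s| ≤ 4 * η := by
  have hη : 0 ≤ η := (abs_nonneg _).trans (hadd 0 (by norm_num) 0 (by norm_num))
  have hG0 : |G 0| ≤ η := by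
    have := hadd 0 (by norm_num) 0 (by norm_num)
    rw [← abs_neg, (by simp : -(G 0) = G (0 + 0) - G 0 - G 0)]; exact this
  set S := sSup ((fun s => |G s|) '' Icc (0:ℝ) 1) with hS
  have hbdd : BddAbove ((fun s => |G s|) '' Icc (0:ℝ) 1) := ⟨Bd, by rintro _ ⟨s, hs, rfl⟩; exact hb s hs⟩
  have hle : ∀ s ∈ Icc (0:ℝ) 1, |G s| ≤ S := fun s hs => le_csSup hbdd ⟨s, hs, rfl⟩
  have hstep : ∀ s ∈ Icc (0:ℝ) 1, |G s| ≤ (S + 2 * η) / 2 := by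
    intro s hs
    have a1 := abs_le.1 (hadd s ⟨by linarith [hs.1], hs.2⟩ s ⟨by linarith [hs.1], hs.2⟩)
    rcases le_total s (1/2) with h | h
    · have a2 := abs_le.1 (hle (s + s) ⟨by linarith [hs.1], by linarith⟩)
      rw [abs_le]; constructor <;> linarith
    · have a2 := abs_le.1 (hle (s + s - 1) ⟨by linarith, by linarith [hs.2]⟩)
      have a3 := abs_le.1 (hadd (s + s - 1) ⟨by linarith, by linarith [hs.2]⟩ 1 (by norm_num))
      rw [sub_add_cancel, h1] at a3
      rw [abs_le]; constructor <;> linarith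
  have hS2 : S ≤ (S + 2 * η) / 2 :=
    csSup_le ⟨_, 0, by norm_num, rfl⟩ (by rintro _ ⟨s, hs, rfl⟩; exact hstep s hs)
  intro s hs
  rcases le_total 0 s with h | h
  · have := hle s ⟨h, hs.2⟩
    linarith
  · have a1 := abs_le.1 (hadd s hs (-s) ⟨by linarith, by linarith [hs.1]⟩)
    have a2 := abs_le.1 (hle (-s) ⟨by linarith, by linarith [hs.1]⟩)
    have a3 := abs_le.1 hG0
    rw [add_neg_cancel] at a1
    rw [abs_le]; constructor <;> linarith

theorem L5 {n : ℕ} {r η Bd : ℝ} (hr : 0 < r) (o : En n → ℝ)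
    (hadd : ∀ x z : En n, ‖x‖ ≤ (n + 1) * r → ‖z‖ ≤ (n + 1) * r → |o (x + z) - o x - o z| ≤ η)
    (hb : ∀ x : En n, ‖x‖ ≤ r → |o x| ≤ Bd) :
    ∃ A : En n, ‖A‖ ≤ n * (Bd / r) ∧ ∀ x : En n, ‖x‖ ≤ r → |o x - ⟪A, x⟫| ≤ (5 * n + 1) * η := by
  set e := EuclideanSpace.basisFun (Fin n) ℝ with he
  have hen : ∀ i, ‖e i‖ = 1 := fun i => e.orthonormal.1 i
  have hη : 0 ≤ η := (abs_nonneg _).trans (hadd 0 0 (by rw [norm_zero]; positivity) (by rw [norm_zero]; positivity))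
  have hrn : r ≤ (n + 1) * r := by have : 0 ≤ (n:ℝ) * r := by positivity
                                   linarith
  have hsn : ∀ i (s : ℝ), ‖s • e i‖ = |s| := fun i s => by rw [norm_smul, hen, mul_one, Real.norm_eq_abs]
  have hone : ∀ i (s : ℝ), |s| ≤ r → |o (s • e i) - s / r * o (r • e i)| ≤ 4 * η := by
    intro i s hs
    have h1 := hyers1 (G := fun s => o ((s * r) • e i) - s * o (r • e i)) (η := η) (Bd := 2 * Bd) ?_ ?_ (by simp)
      (s / r) ?_
    · simpa [div_mul_cancel₀ _ hr.ne'] using h1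
    · have hh : ∀ s ∈ Icc (-1:ℝ) 1, ‖(s * r) • e i‖ ≤ (n + 1) * r := by
        intro s hs
        rw [hsn, abs_mul, abs_of_pos hr]
        exact (mul_le_of_le_one_left hr.le (abs_le.2 hs)).trans hrn
      intro s hs t ht
      have := hadd _ _ (hh s hs) (hh t ht)
      rw [← add_smul, ← add_mul] at this
      convert this using 2
      ring
    · intro s hs
      have a1 := hb ((s * r) • e i) (by
        rw [hsn, abs_mul, abs_of_pos hr]
        exact mul_le_of_le_one_left hr.le (abs_le.2 ⟨by linarith [hs.1], hs.2⟩))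
      have a2 := hb (r • e i) (by rw [hsn, abs_of_pos hr])
      refine (abs_sub _ _).trans ?_
      rw [abs_mul, abs_of_nonneg hs.1]
      have := mul_le_of_le_one_left (abs_nonneg (o (r • e i))) hs.2
      linarith
    · rw [mem_Icc, ← abs_le, abs_div, abs_of_pos hr]
      exact (div_le_one hr).2 hs
  have hBd : 0 ≤ Bd := (abs_nonneg _).trans (hb 0 (by simpa using hr.le))
  refine ⟨∑ i, (o (r • e i) / r) • e i, ?_, fun x hx => ?_⟩
  · refine (norm_sum_le _ _).trans ?_
    have : ∀ i ∈ Finset.univ, ‖(o (r • e i) / r) • e i‖ ≤ Bd / r := by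
      intro i _
      rw [hsn, abs_div, abs_of_pos hr]
      have := hb (r • e i) (by rw [hsn, abs_of_pos hr])
      gcongr
    simpa using Finset.sum_le_sum this
  · have hxi : ∀ i, |⟪e i, x⟫| ≤ r := fun i => by
      refine (abs_real_inner_le_norm _ _).trans ?_
      rw [hen, one_mul]; exact hx
    have hfin : ∀ s : Finset (Fin n), |o (∑ i ∈ s, ⟪e i, x⟫ • e i) - ∑ i ∈ s, o (⟪e i, x⟫ • e i)| ≤ (s.card + 1) * η := by
      intro s
      induction s using Finset.induction_on with
      | empty =>
        have := hadd 0 0 (by rw [norm_zero]; positivity) (by rw [norm_zero]; positivity)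
        rw [add_zero, sub_self, zero_sub, abs_neg] at this
        simpa using this
      | insert a s ha ih =>
        rw [Finset.sum_insert ha, Finset.sum_insert ha, Finset.card_insert_of_notMem ha]
        have hns : ‖∑ i ∈ s, ⟪e i, x⟫ • e i‖ ≤ (n + 1) * r := by
          refine (norm_sum_le _ _).trans ?_
          have : ∀ i ∈ s, ‖⟪e i, x⟫ • e i‖ ≤ r := fun i _ => by rw [hsn]; exact hxi i
          refine (Finset.sum_le_sum this).trans ?_
          rw [Finset.sum_const, nsmul_eq_mul]
          have : (s.card : ℝ) ≤ n := by exact_mod_cast (Finset.card_le_univ s).trans (by simp)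
          exact mul_le_mul_of_nonneg_right (by linarith) hr.le
        have h1 := hadd (⟪e a, x⟫ • e a) (∑ i ∈ s, ⟪e i, x⟫ • e i) (by rw [hsn]; exact (hxi a).trans hrn) hns
        have a1 := abs_le.1 h1
        have a2 := abs_le.1 ih
        push_cast
        rw [abs_le]; constructor <;> linarith
    have h1 := hfin Finset.univ
    rw [e.sum_repr', Finset.card_univ, Fintype.card_fin] at h1
    have h2 : ⟪∑ i, (o (r • e i) / r) • e i, x⟫ = ∑ i, ⟪e i, x⟫ / r * o (r • e i) := by
      rw [sum_inner]
      refine Finset.sum_congr rfl fun i _ => ?_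
      rw [real_inner_smul_left]; ring
    have h3 : |∑ i, o (⟪e i, x⟫ • e i) - ∑ i, ⟪e i, x⟫ / r * o (r • e i)| ≤ n * (4 * η) := by
      rw [← Finset.sum_sub_distrib]
      refine (Finset.abs_sum_le_sum_abs _ _).trans ?_
      simpa using Finset.sum_le_sum fun i (_ : i ∈ Finset.univ) => hone i _ (hxi i)
    rw [h2]
    have a1 := abs_le.1 h1
    have a2 := abs_le.1 h3
    rw [abs_le]; constructor <;> linarith

theorem Reg.four {n : ℕ} {γ C r : ℝ} {u : ℝ → En n → ℝ → ℝ} (h : Reg n γ C r u) (hC : 0 < C) (hr : 0 < r)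
    (hγ0 : 0 < γ) (hγ1 : γ < 1) (hr1 : (n + 1) * r ≤ 1/1024) {t : ℝ} (ht : t ∈ Icc (-(1/16:ℝ)) 0) {x z : En n}
    (hx : ‖x‖ ≤ (n + 1) * r) (hz : ‖z‖ ≤ (n + 1) * r) {y : ℝ} (hy : 0 ≤ y) (hy1 : y ≤ 1/256) :
    |u t (x + z) y - u t x y - u t z y + u t 0 y| ≤ C * (n + 2) ^ 2 * r ^ (2 * γ) := by
  have hn2 : (1:ℝ) ≤ n + 2 := by have : (0:ℝ) ≤ n := by positivity
                                 linarith
  set ξ := (1/2 : ℝ) • z with hξ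
  have hxn : ‖ξ‖ = ‖z‖ / 2 := by rw [hξ, norm_smul]; norm_num; ring
  have e1 : ξ + ξ = z := by rw [hξ, ← add_smul]; norm_num
  have n1 := norm_add_le x ξ
  have q1 : ‖x + ξ‖ ≤ 1/256 := by linarith [norm_nonneg z]
  have q2 : ‖ξ‖ ≤ 1/256 := by linarith [norm_nonneg z]
  have h1 := h.second t ht (x + ξ) q1 ξ q2 ξ q2 y hy hy1
  have h2 := h.second t ht ξ q2 (x + ξ) q1 ξ q2 y hy hy1
  rw [add_assoc, e1, add_sub_cancel_right, sub_self] at h1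
  rw [add_assoc, e1, add_sub_cancel_right, sub_self, norm_sub_rev, add_sub_cancel_right] at h2
  have hb : C * (‖ξ‖ + r) ^ γ * (‖x‖ + r) ^ γ ≤ C * (n + 2) ^ 2 * r ^ (2 * γ) := by
    have a1 : (‖ξ‖ + r) ^ γ ≤ (n + 2) * r ^ γ :=
      (Real.rpow_le_rpow (by positivity) (by linarith [norm_nonneg z]) hγ0.le).trans (mul_rpow_le hn2 hr hγ0 hγ1)
    have a2 : (‖x‖ + r) ^ γ ≤ (n + 2) * r ^ γ :=
      (Real.rpow_le_rpow (by positivity) (by linarith [norm_nonneg z]) hγ0.le).trans (mul_rpow_le hn2 hr hγ0 hγ1)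
    have a3 : C * (‖ξ‖ + r) ^ γ * (‖x‖ + r) ^ γ ≤ C * ((n + 2) * r ^ γ) * ((n + 2) * r ^ γ) := by gcongr
    rw [rpow_two_mul' hr]
    linarith
  rw [abs_le]; constructor <;> linarith

theorem pick_r {σ γ α : ℝ} (hσ : 0 < σ) (hγ0 : 0 < γ) (h1 : 1 + α < γ + σ) (h2 : 1 + α < 2 * γ) (m K : ℝ)
    (hm : 0 < m) :
    ∃ r : ℝ, 0 < r ∧ r ≤ m ∧ r ^ γ ≤ (1/512 : ℝ) ^ γ / 2 ∧ r ^ σ ≤ 1/16 ∧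
      K * r ^ (γ + σ) + K * r ^ (2 * γ) ≤ r ^ (1 + α) := by
  have lim : ∀ e : ℝ, 0 < e → ∀ c > 0, ∀ᶠ r in 𝓝[>] (0:ℝ), r ^ e < c := by
    intro e he c hc
    have hf : Continuous fun r : ℝ => r ^ e := Real.continuous_rpow_const he.le
    exact (ev_lt (0:ℝ) hf (by simpa [Real.zero_rpow he.ne'] using hc)).filter_mono nhdsWithin_le_nhds
  have hK : 0 < 1 / (2 * (|K| + 1)) := by positivity
  obtain ⟨r, hr, a1, a2, a3, a4, a5⟩ := ((eventually_mem_nhdsWithin (a := (0:ℝ)) (s := Ioi 0)).and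
    ((lim 1 one_pos m hm).and ((lim γ hγ0 ((1/512 : ℝ) ^ γ / 2) (by positivity)).and
    ((lim σ hσ (1/16) (by norm_num)).and ((lim (γ + σ - (1 + α)) (by linarith) _ hK).and
      (lim (2 * γ - (1 + α)) (by linarith) _ hK)))))).exists
  have hr0 : 0 < r := hr
  rw [Real.rpow_one] at a1
  refine ⟨r, hr, a1.le, a2.le, a3.le, ?_⟩
  have key : ∀ e, r ^ (e - (1 + α)) < 1 / (2 * (|K| + 1)) → K * r ^ e ≤ r ^ (1 + α) / 2 := by
    intro e he
    have e1 : r ^ e = r ^ (e - (1 + α)) * r ^ (1 + α) := by rw [← Real.rpow_add hr0]; congr 1; ring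
    have hp : 0 < r ^ (1 + α) := by positivity
    have hq : 0 < r ^ (e - (1 + α)) := by positivity
    rw [lt_div_iff₀ (by positivity)] at he
    have : K * r ^ (e - (1 + α)) ≤ 1 / 2 := by
      have := mul_le_mul_of_nonneg_right (le_abs_self K) hq.le
      linarith
    rw [e1, ← mul_assoc]
    have := mul_le_mul_of_nonneg_right this hp.le
    linarith
  have := key _ a4
  have := key _ a5
  linarith

set_option maxHeartbeats 1000000 in
theorem AL (n : ℕ) {σ α : ℝ} (hσ : 0 < σ) (hσ1 : σ < 1) (hα : α < σ) :
    ∃ ϱ C δ : ℝ, 0 < ϱ ∧ ϱ ≤ 1/4 ∧ 0 < C ∧ 0 < δ ∧ ∀ u : ℝ → En n → ℝ → ℝ,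
      ClassU n σ 1 (1/2) δ 0 u → Bd1 n 1 (1/2) u → u 0 0 0 = 0 →
      ∃ (A : En n) (e : ℝ → ℝ), Continuous e ∧ ‖A‖ ≤ C ∧ (∀ t, |e t| ≤ C) ∧
        ∀ t ∈ Icc (-ϱ ^ σ) 0, ∀ x, ‖x‖ ≤ ϱ → ∀ y, 0 ≤ y → y ≤ ϱ →
          |u t x y - ⟪A, x⟫ - (∫ s in (0:ℝ)..t, e s) - e t / σ * y ^ σ| ≤ ϱ ^ (1 + α) := by
  obtain ⟨γ, hγm, hγ1⟩ : ∃ γ, max σ (max ((1 + α) / 2) (1 + α - σ)) < γ ∧ γ < 1 :=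
    exists_between (max_lt hσ1 (max_lt (by linarith) (by linarith)))
  have hγ : σ < γ := (le_max_left _ _).trans_lt hγm
  have hγ2 : 1 + α < 2 * γ := by
    have : (1 + α) / 2 < γ := ((le_max_left _ _).trans (le_max_right _ _)).trans_lt hγm
    linarith
  have hγ3 : 1 + α < γ + σ := by
    have : 1 + α - σ < γ := ((le_max_right _ _).trans (le_max_right _ _)).trans_lt hγm
    linarith
  have hγ0 : 0 < γ := hσ.trans hγ
  obtain ⟨C, hC, hSD⟩ := SDReg n hσ hγ hγ1
  obtain ⟨C4, hC4, hL4⟩ := L4 n hσ hγ hγ1 hC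
  set c3 : ℝ := (21 * (n + 2) + 3) * C with hc3
  set cq : ℝ := C * (n + 2) ^ 2 with hcq
  have hc30 : 0 < c3 := by positivity
  have hcq0 : 0 < cq := by positivity
  set K : ℝ := 2 * c3 + cq + C4 + (5 * n + 1) * cq with hK
  have hmm : (0:ℝ) < 1 / (1024 * (n + 1)) := by positivity
  obtain ⟨r, hr, hrm, hrγ, hrσ, hrK⟩ := pick_r hσ hγ0 hγ3 hγ2 (1 / (1024 * (n + 1))) K hmm
  have hrn : (n + 1) * r ≤ 1/1024 := by
    rw [le_div_iff₀ (by positivity)] at hrm; linarith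
  have hr1 : r ≤ 1/1024 := by
    have : (0:ℝ) ≤ n * r := by positivity
    linarith
  set P := r ^ (2 * γ) with hP
  have hP0 : 0 < P := by positivity
  have hrs : 0 < r ^ σ := by positivity
  obtain ⟨d1, hd1, hSD⟩ := hSD r hr (by linarith)
  obtain ⟨d2, hd2, hL3⟩ := L3 (n := n) hσ hγ hγ1 hC hr (by linarith) hrσ
  obtain ⟨d3, hd3, hL4⟩ := hL4 r hr hr1 hrγ hrσ
  refine ⟨r, n / r + 2 * σ / r ^ σ + 1, min d1 (min d2 d3), hr, by linarith, by positivity,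
    lt_min hd1 (lt_min hd2 hd3), fun u hu hb hu0 => ?_⟩
  set δ := min d1 (min d2 d3) with hδ
  have hδ0 : 0 ≤ δ := (lt_min hd1 (lt_min hd2 hd3)).le
  have hδ1 : δ ≤ d1 := min_le_left _ _
  have hδ2 : δ ≤ d2 := (min_le_right _ _).trans (min_le_left _ _)
  have hδ3 : δ ≤ d3 := (min_le_right _ _).trans (min_le_right _ _)
  have hreg0 := hSD δ hδ0 hδ1 u hu hb
  have hcl : ∀ t : ℝ, -1 ≤ max (-1) (min t 0) ∧ max (-1) (min t 0) ≤ 0 := fun t =>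
    ⟨le_max_left _ _, max_le (by norm_num) (min_le_right _ _)⟩
  set e : ℝ → ℝ := fun t => σ * (u (max (-1) (min t 0)) 0 r - u (max (-1) (min t 0)) 0 0) / r ^ σ with he
  have hec : Continuous e := by
    have h1 : ∀ y, 0 ≤ y → y < 1/2 → Continuous fun t : ℝ => u (max (-1) (min t 0)) 0 y := by
      intro y hy hy1
      have hm : Continuous fun t : ℝ => (max (-1) (min t 0), (0 : En n), y) := by fun_prop
      have := hu.cont.comp hm.continuousOn (s := univ) (fun t _ =>
        ⟨(hcl t).1, (hcl t).2, by rw [norm_zero]; norm_num, hy, hy1⟩)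
      exact continuousOn_univ.1 this
    have a1 := h1 r hr.le (by linarith)
    have a2 := h1 0 le_rfl (by norm_num)
    exact (continuous_const.mul (a1.sub a2)).div_const _
  have heb : ∀ t, |e t| ≤ 2 * σ / r ^ σ := by
    intro t
    have a1 := hb _ ⟨(hcl t).1, (hcl t).2⟩ 0 (by rw [norm_zero]; norm_num) r hr.le (by linarith)
    have a2 := hb _ ⟨(hcl t).1, (hcl t).2⟩ 0 (by rw [norm_zero]; norm_num) 0 le_rfl (by norm_num)
    simp only [he]
    rw [abs_div, abs_mul, abs_of_pos hrs, abs_of_pos hσ]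
    have a3 := (abs_sub (u (max (-1) (min t 0)) 0 r) (u (max (-1) (min t 0)) 0 0)).trans (add_le_add a1 a2)
    have a4 := mul_le_mul_of_nonneg_left a3 hσ.le
    exact div_le_div_of_nonneg_right (by linarith) hrs.le
  set D : ℝ → ℝ := fun t => ∫ s in (0:ℝ)..t, e s with hD
  have hDd : ∀ t, HasDerivAt D (e t) t := fun t => (hec.integral_hasStrictDerivAt 0 t).hasDerivAt
  have hD0 : D 0 = 0 := by simp [hD]
  have hs0 : (0:ℝ) ^ σ = 0 := Real.zero_rpow hσ.ne'
  set w : ℝ → En n → ℝ → ℝ := fun t x y => u t x y - (D t + e t / σ * y ^ σ) with hw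
  have hwU : ClassU n σ 1 (1/2) δ 0 w := by
    have := hu.config hσ hδ0 (0 : En n) hDd hec (ρ := 1) (c := 1) (T' := 1) (R' := 1/2) one_pos (by norm_num)
      (by simp) (by simp) (by norm_num)
    simp only [norm_zero, add_zero, mul_one, Real.one_rpow, one_mul, one_smul, inner_zero_left, sub_zero] at this
    have e1 : w = fun t x y => u t x y - D t - e t / σ * y ^ σ := by
      funext t x y; simp only [hw]; ring
    rw [e1]; exact this
  have hreg : Reg n γ C r w := hreg0.shift (fun t y => D t + e t / σ * y ^ σ)
  have hflat : ∀ τ ∈ Icc (-r ^ σ) 0, w τ 0 r = w τ 0 0 := by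
    intro τ hτ
    have a1 : max (-1) (min τ 0) = τ := by
      rw [min_eq_left hτ.2, max_eq_right (by linarith [hτ.1])]
    simp only [hw, hs0, he, a1]
    field_simp
    ring
  have hw0 : w 0 0 0 = 0 := by simp only [hw, hD0, hu0, hs0]; ring
  have G3 := hL3 δ hδ0 hδ2 w hwU hreg (fun τ hτ => (hflat τ hτ).le)
  have G3' := hL3 δ hδ0 hδ2 _ hwU.neg hreg.neg (fun τ hτ => by rw [hflat τ hτ])
  have G4 := hL4 δ hδ0 hδ3 w hwU hreg
  have G4' := hL4 δ hδ0 hδ3 _ hwU.neg hreg.neg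
  have h0m : (0:ℝ) ∈ Icc (-r ^ σ) 0 := ⟨by linarith, le_rfl⟩
  have hik : ∀ τ ∈ Icc (-r ^ σ) 0, τ ∈ Icc (-(1/16:ℝ)) 0 := fun τ hτ => ⟨by linarith [hτ.1], hτ.2⟩
  have hrr : r ≤ (n + 1) * r := by
    have : (0:ℝ) ≤ n * r := by positivity
    linarith
  have hwu : ∀ x, w 0 x 0 = u 0 x 0 := fun x => by simp only [hw, hD0, hs0]; ring
  obtain ⟨A, hA1, hA2⟩ := L5 (n := n) (r := r) (η := 2 * (cq * P)) (Bd := 2) hr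
    (fun x => w 0 x 0 - w 0 (-x) 0) (by
      intro x z hx hz
      have a1 := abs_le.1 (hreg.four hC hr hγ0 hγ1 hrn (hik 0 h0m) hx hz le_rfl (by norm_num))
      have a2 := abs_le.1 (hreg.four hC hr hγ0 hγ1 hrn (hik 0 h0m) (x := -x) (z := -z) (by rwa [norm_neg])
        (by rwa [norm_neg]) le_rfl (by norm_num))
      rw [← neg_add] at a2
      rw [abs_le]; constructor <;> linarith) (by
      intro x hx
      rw [hwu, hwu]
      have a1 := hb 0 ⟨by norm_num, le_rfl⟩ x (by linarith) 0 le_rfl (by norm_num)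
      have a2 := hb 0 ⟨by norm_num, le_rfl⟩ (-x) (by rw [norm_neg]; linarith) 0 le_rfl (by norm_num)
      refine (abs_sub _ _).trans ?_
      linarith)
  have hpos1 : 0 ≤ n / r := by positivity
  have hpos2 : 0 ≤ 2 * σ / r ^ σ := by positivity
  refine ⟨(1/2 : ℝ) • A, e, hec, ?_, fun t => (heb t).trans (by linarith), ?_⟩
  · rw [norm_smul]
    have : (n:ℝ) * (2 / r) = 2 * (n / r) := by ring
    rw [this] at hA1
    norm_num
    linarith
  · intro τ hτ x hx y hy hy1
    have hxn : ‖x‖ ≤ (n + 1) * r := hx.trans hrr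
    have b1 := G3 τ hτ y hy hy1
    have b2 := G3' τ hτ y hy hy1
    have b3 := G3 0 h0m 0 le_rfl hr.le
    have b4 := G3' 0 h0m 0 le_rfl hr.le
    rw [hw0] at b3 b4
    have b5 := abs_le.1 (hreg.four hC hr hγ0 hγ1 hrn (hik τ hτ) hxn (z := -x) (by rwa [norm_neg]) hy (by linarith))
    rw [add_neg_cancel] at b5
    have b6 := G4 τ hτ x hx y hy hy1
    have b7 := G4' τ hτ x hx y hy hy1
    have b8 := G4 0 h0m x hx 0 le_rfl hr.le
    have b9 := G4' 0 h0m x hx 0 le_rfl hr.le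
    have b10 := abs_le.1 (hA2 x hx)
    have hKs : K * r ^ (γ + σ) + K * P = (2 * c3 * P + cq * P + C4 * r ^ (γ + σ) + (5 * n + 1) * (cq * P)) +
      ((2 * c3 + cq + (5 * n + 1) * cq) * r ^ (γ + σ) + C4 * P) := by rw [hK]; ring
    have hKp : 0 ≤ (2 * c3 + cq + (5 * n + 1) * cq) * r ^ (γ + σ) + C4 * P := by positivity
    have e2 : u τ x y - ⟪(1/2 : ℝ) • A, x⟫ - (∫ s in (0:ℝ)..τ, e s) - e τ / σ * y ^ σ =
      w τ x y - ⟪A, x⟫ / 2 := by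
      rw [real_inner_smul_left]; simp only [hw, hD]; ring
    rw [e2]
    refine le_trans ?_ hrK
    rw [hKs]
    have hcp : 0 < cq * P := by positivity
    rw [abs_le]; constructor <;> linarith

def Err (n : ℕ) (σ α : ℝ) (u : ℝ → En n → ℝ → ℝ) (A : En n) (e : ℝ → ℝ) (K ρ : ℝ) : Prop :=
  ∀ t ∈ Icc (-ρ ^ σ) 0, ∀ x, ‖x‖ < ρ / 2 → ∀ y, 0 ≤ y → y < ρ / 2 →
    |u t x y - ⟪A, x⟫ - (∫ s in (0:ℝ)..t, e s) - e t / σ * y ^ σ| ≤ K * ρ ^ (1 + α)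

def ALc (n : ℕ) (σ α ϱ C d : ℝ) : Prop := ∀ u : ℝ → En n → ℝ → ℝ,
  ClassU n σ 1 (1/2) d 0 u → Bd1 n 1 (1/2) u → u 0 0 0 = 0 →
  ∃ (A : En n) (e : ℝ → ℝ), Continuous e ∧ ‖A‖ ≤ C ∧ (∀ t, |e t| ≤ C) ∧
    ∀ t ∈ Icc (-ϱ ^ σ) 0, ∀ x, ‖x‖ ≤ ϱ → ∀ y, 0 ≤ y → y ≤ ϱ →
      |u t x y - ⟪A, x⟫ - (∫ s in (0:ℝ)..t, e s) - e t / σ * y ^ σ| ≤ ϱ ^ (1 + α)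

theorem AL_step {n : ℕ} {σ α ϱ C d δ : ℝ} (hσ : 0 < σ) (hσ1 : σ < 1) (hα0 : 0 < α) (hϱ : 0 < ϱ)
    (hAL : ALc n σ α ϱ C d) (hδ : 0 ≤ δ) {u : ℝ → En n → ℝ → ℝ}
    (hu : ClassU n σ 1 (1/2) δ (1 - σ + α) u) (hu0 : u 0 0 0 = 0) {ρ : ℝ} (hρ : 0 < ρ) (hρ1 : ρ ≤ 1)
    {A : En n} {e : ℝ → ℝ} (he : Continuous e) (hA : δ * (1 + ‖A‖) ≤ d) (hE : Err n σ α u A e 1 ρ) :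
    ∃ (A' : En n) (e' : ℝ → ℝ), Continuous e' ∧ ‖A' - A‖ ≤ C * ρ ^ α ∧
      (∀ t, |e' t - e t| ≤ C * ρ ^ (1 + α - σ)) ∧ Err n σ α u A' e' 1 (ρ * ϱ) := by
  have hs0 : (0:ℝ) ^ σ = 0 := Real.zero_rpow hσ.ne'
  obtain ⟨P, hP⟩ : ∃ P, P = ρ ^ α := ⟨_, rfl⟩
  obtain ⟨S, hS⟩ : ∃ S, S = ρ ^ σ := ⟨_, rfl⟩
  have hP0 : 0 < P := by rw [hP]; positivity
  have hS0 : 0 < S := by rw [hS]; positivity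
  have hP1 : P ≤ 1 := by rw [hP]; exact Real.rpow_le_one hρ.le hρ1 hα0.le
  have hS1 : S ≤ 1 := by rw [hS]; exact Real.rpow_le_one hρ.le hρ1 hσ.le
  have r1 : ρ ^ (1 + α) = ρ * P := by rw [Real.rpow_add hρ, Real.rpow_one, hP]
  have r2 : ρ ^ (1 + α - σ) = ρ * P / S := by rw [Real.rpow_sub hρ, r1, hS]
  have r3 : ρ ^ (1 - σ + α) = ρ / S * P := by rw [Real.rpow_add hρ, Real.rpow_sub hρ, Real.rpow_one, hP, hS]
  have hDd : ∀ t, HasDerivAt (fun t => ∫ s in (0:ℝ)..t, e s) (e t) t :=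
    fun t => (he.integral_hasStrictDerivAt 0 t).hasDerivAt
  obtain ⟨c, hc⟩ : ∃ c, c = 1 / (ρ * P) := ⟨_, rfl⟩
  have hc0 : 0 < c := by rw [hc]; positivity
  have hcc : c * (ρ * P) = 1 := by rw [hc]; field_simp
  have hw := hu.config hσ hδ A hDd he (ρ := ρ) (c := c) (T' := 1) (R' := 1/2) hρ
    (by
      have : c * ρ = 1 / P := by rw [hc]; field_simp
      rw [this, le_div_iff₀ hP0]; linarith)
    (by
      rw [r3, ← hS]
      have : c * S * (ρ / S * P) = c * (ρ * P) := by field_simp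
      rw [this, hcc])
    (by rw [← hS]; linarith) (by linarith)
  have hw1 := (hw.mono_delta hA).theta_zero ((by positivity : 0 ≤ δ * (1 + ‖A‖)).trans hA) (by linarith) (by norm_num)
  obtain ⟨A1, e1, he1, hA1, hb1, hz⟩ := hAL _ hw1 (by
      intro t ht x hx y hy hy1
      rw [← hS, abs_mul, abs_of_pos hc0]
      have h1 := hE (S * t) ⟨by rw [← hS]; nlinarith [ht.1], mul_nonpos_of_nonneg_of_nonpos hS0.le ht.2⟩ (ρ • x)
        (by rw [norm_smul, Real.norm_of_nonneg hρ.le]; have := mul_lt_mul_of_pos_left hx hρ; linarith) (ρ * y) (by positivity)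
        (by have := mul_lt_mul_of_pos_left hy1 hρ; linarith)
      rw [one_mul, r1] at h1
      exact (mul_le_mul_of_nonneg_left h1 hc0.le).trans hcc.le)
    (by simp [hu0, hs0])
  refine ⟨A + P • A1, fun t => e t + ρ * P / S * e1 (t / S), by fun_prop, ?_, ?_, ?_⟩
  · rw [add_sub_cancel_left, norm_smul, Real.norm_of_nonneg hP0.le, ← hP, mul_comm]
    exact mul_le_mul_of_nonneg_right hA1 hP0.le
  · intro t
    rw [add_sub_cancel_left, r2, abs_mul, abs_of_pos (by positivity), mul_comm]
    exact mul_le_mul_of_nonneg_right (hb1 _) (by positivity)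
  · intro t ht x hx y hy hy1
    rw [Real.mul_rpow hρ.le hϱ.le, ← hS] at ht
    have hϱρ : 0 < ρ * ϱ := by positivity
    have h1 := hz (t / S) ⟨by rw [le_div_iff₀ hS0]; linarith [ht.1], div_nonpos_of_nonpos_of_nonneg ht.2 hS0.le⟩
      (ρ⁻¹ • x) (by rw [norm_smul, norm_inv, Real.norm_of_nonneg hρ.le, inv_mul_le_iff₀ hρ]; linarith) (y / ρ)
      (by positivity) (by rw [div_le_iff₀ hρ]; linarith)
    rw [← hS, mul_div_cancel₀ _ hS0.ne', smul_inv_smul₀ hρ.ne', mul_div_cancel₀ _ hρ.ne', real_inner_smul_right,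
      Real.div_rpow hy hρ.le, ← hS] at h1
    have h2 : (∫ s in (0:ℝ)..t, (e s + ρ * P / S * e1 (s / S))) =
        (∫ s in (0:ℝ)..t, e s) + ρ * P * ∫ s in (0:ℝ)..(t / S), e1 s := by
      rw [intervalIntegral.integral_add (he.intervalIntegrable _ _)
        ((by fun_prop : Continuous fun s => ρ * P / S * e1 (s / S)).intervalIntegrable _ _),
        intervalIntegral.integral_const_mul, intervalIntegral.integral_comp_div _ hS0.ne', zero_div, smul_eq_mul]
      field_simp
    rw [h2, inner_add_left, real_inner_smul_left, Real.mul_rpow hρ.le hϱ.le, r1, one_mul]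
    have h3 := mul_le_mul_of_nonneg_left h1 (by positivity : 0 ≤ ρ * P)
    rw [← abs_of_pos (by positivity : 0 < ρ * P), ← abs_mul, abs_of_pos (by positivity : 0 < ρ * P)] at h3
    refine le_trans (le_of_eq ?_) h3
    congr 1
    rw [hc]
    field_simp
    ring

theorem AL_iter {n : ℕ} {σ α ϱ C d δ : ℝ} (hσ : 0 < σ) (hσ1 : σ < 1) (hα0 : 0 < α) (hϱ : 0 < ϱ) (hϱ1 : ϱ < 1)
    (hC : 0 < C) (hAL : ALc n σ α ϱ C d) (hδ : 0 ≤ δ) (hδd : δ * (1 + C / (1 - ϱ ^ α)) ≤ d)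
    {u : ℝ → En n → ℝ → ℝ} (hu : ClassU n σ 1 (1/2) δ (1 - σ + α) u) (hu0 : u 0 0 0 = 0) (hb : Bd1 n 1 (1/2) u) :
    ∃ (A : En n) (e : ℝ → ℝ), Continuous e ∧ ∀ k : ℕ, Err n σ α u A e
      (1 + C / (1 - ϱ ^ α) + C / (1 - ϱ ^ (1 + α - σ)) * (1 + 1 / σ)) (ϱ ^ k) := by
  obtain ⟨p, hp⟩ : ∃ p, p = ϱ ^ α := ⟨_, rfl⟩
  obtain ⟨q, hq⟩ : ∃ q, q = ϱ ^ (1 + α - σ) := ⟨_, rfl⟩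
  have hp0 : 0 < p := by rw [hp]; positivity
  have hq0 : 0 < q := by rw [hq]; positivity
  have hp1 : p < 1 := by rw [hp]; exact Real.rpow_lt_one hϱ.le hϱ1 hα0
  have hq1 : q < 1 := by rw [hq]; exact Real.rpow_lt_one hϱ.le hϱ1 (by linarith)
  have pw : ∀ (a : ℝ) (k : ℕ), (ϱ ^ k) ^ a = (ϱ ^ a) ^ k := fun a k => by
    rw [← Real.rpow_natCast, ← Real.rpow_mul hϱ.le, mul_comm, Real.rpow_mul hϱ.le, Real.rpow_natCast]
  rw [← hp] at hδd ⊢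
  rw [← hq]
  have hK1 : 0 < C / (1 - p) := div_pos hC (by linarith)
  have hK2 : 0 < C / (1 - q) := div_pos hC (by linarith)
  obtain ⟨K1, hK1e⟩ : ∃ K, K = C / (1 - p) := ⟨_, rfl⟩
  obtain ⟨K2, hK2e⟩ : ∃ K, K = C / (1 - q) := ⟨_, rfl⟩
  have hKC : K1 * (1 - p) = C := by rw [hK1e]; exact div_mul_cancel₀ _ (by linarith)
  rw [← hK1e] at hδd hK1 ⊢
  rw [← hK2e] at hK2 ⊢
  let Inv : ℕ → En n × (ℝ → ℝ) → Prop := fun k s =>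
    Continuous s.2 ∧ ‖s.1‖ ≤ K1 * (1 - p ^ k) ∧ Err n σ α u s.1 s.2 1 (ϱ ^ k)
  have hstep : ∀ k, ∀ s : {s // Inv k s}, ∃ s' : {s // Inv (k + 1) s},
      ‖s'.1.1 - s.1.1‖ ≤ C * p ^ k ∧ ∀ t, |s'.1.2 t - s.1.2 t| ≤ C * q ^ k := by
    rintro k ⟨⟨A, e⟩, h1, h2, h3⟩
    simp only at h1 h2 h3
    have hpk : 0 < p ^ k := by positivity
    have hA : ‖A‖ ≤ K1 := h2.trans (by have : 0 ≤ K1 * p ^ k := by positivity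
                                       linarith)
    obtain ⟨A', e', g1, g2, g3, g4⟩ := AL_step hσ hσ1 hα0 hϱ hAL hδ hu hu0 (ρ := ϱ ^ k) (by positivity)
      (pow_le_one₀ hϱ.le hϱ1.le) h1 ((mul_le_mul_of_nonneg_left (by linarith) hδ).trans hδd) h3
    rw [pw, ← hp] at g2
    rw [pw, ← hq] at g3
    refine ⟨⟨(A', e'), g1, ?_, by rw [pow_succ]; exact g4⟩, g2, g3⟩
    have := norm_add_le A (A' - A)
    rw [add_sub_cancel] at this
    have e1 : K1 * (1 - p ^ (k + 1)) = K1 * (1 - p ^ k) + K1 * (1 - p) * p ^ k := by ring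
    rw [e1, hKC]
    exact this.trans (add_le_add h2 g2)
  have h0 : Inv 0 (0, fun _ => 0) := by
    refine ⟨continuous_const, by simp, ?_⟩
    intro t ht x hx y hy hy1
    simp only [pow_zero, Real.one_rpow] at *
    simpa using hb t ht x hx y hy hy1
  choose nx hnx1 hnx2 using hstep
  let sq : (k : ℕ) → {s // Inv k s} := fun k => Nat.rec ⟨_, h0⟩ nx k
  have d1 : ∀ k, dist (sq k).1.1 (sq (k + 1)).1.1 ≤ C * p ^ k := fun k => by
    rw [dist_comm, dist_eq_norm]; exact hnx1 k (sq k)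
  have d2 : ∀ t k, dist ((sq k).1.2 t) ((sq (k + 1)).1.2 t) ≤ C * q ^ k := fun t k => by
    rw [dist_comm, Real.dist_eq]; exact hnx2 k (sq k) t
  obtain ⟨A, hA⟩ := cauchySeq_tendsto_of_complete (cauchySeq_of_le_geometric p C hp1 d1)
  have := fun t => cauchySeq_tendsto_of_complete (cauchySeq_of_le_geometric q C hq1 (d2 t))
  choose e he using this
  have l1 : ∀ k, ‖(sq k).1.1 - A‖ ≤ K1 * p ^ k := fun k => by
    have := dist_le_of_le_geometric_of_tendsto p C hp1 d1 hA k
    rw [dist_eq_norm, mul_div_right_comm, ← hK1e] at this; exact this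
  have l2 : ∀ k t, |(sq k).1.2 t - e t| ≤ K2 * q ^ k := fun k t => by
    have := dist_le_of_le_geometric_of_tendsto q C hq1 (d2 t) (he t) k
    rw [Real.dist_eq, mul_div_right_comm, ← hK2e] at this; exact this
  have hec : Continuous e := by
    refine TendstoUniformly.continuous (F := fun k => (sq k).1.2) (p := atTop) ?_
      (Frequently.of_forall fun k => (sq k).2.1)
    rw [Metric.tendstoUniformly_iff]
    intro ε hε
    have hlim : Tendsto (fun k : ℕ => K2 * q ^ k) atTop (𝓝 0) := by
      simpa using (tendsto_pow_atTop_nhds_zero_of_lt_one hq0.le hq1).const_mul K2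
    filter_upwards [hlim.eventually_lt_const hε] with k hk t
    rw [dist_comm, Real.dist_eq]; exact (l2 k t).trans_lt hk
  refine ⟨A, e, hec, fun k t ht x hx y hy hy1 => ?_⟩
  have b1 := (sq k).2.2.2 t ht x hx y hy hy1
  have b2 := l1 k
  have b3 := l2 k
  have hce := (sq k).2.1
  generalize (sq k).1.1 = Ak at *
  generalize (sq k).1.2 = ek at *
  obtain ⟨ρ, hρ⟩ : ∃ ρ, ρ = ϱ ^ k := ⟨_, rfl⟩
  have hρ0 : 0 < ρ := by rw [hρ]; positivity
  have c1 : ρ ^ (1 + α) = p ^ k * ρ := by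
    rw [Real.rpow_add hρ0, Real.rpow_one, hρ, pw, ← hp, mul_comm]
  have c2 : ρ ^ (1 + α) = q ^ k * ρ ^ σ := by
    rw [hq, ← pw, ← hρ, ← Real.rpow_add hρ0]; congr 1; ring
  rw [← hρ] at ht hx hy1 b1 ⊢
  rw [one_mul] at b1
  have f1 : |⟪Ak - A, x⟫| ≤ K1 * ρ ^ (1 + α) := by
    refine (abs_real_inner_le_norm _ _).trans ((mul_le_mul b2 (by linarith : ‖x‖ ≤ ρ) (norm_nonneg _)
      (by positivity)).trans ?_)
    rw [c1, mul_assoc]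
  have f2 : |∫ s in (0:ℝ)..t, (ek s - e s)| ≤ K2 * ρ ^ (1 + α) := by
    have := intervalIntegral.norm_integral_le_of_norm_le_const (a := 0) (b := t) (f := fun s => ek s - e s)
      (C := K2 * q ^ k) (fun s _ => b3 s)
    rw [Real.norm_eq_abs, sub_zero, abs_of_nonpos ht.2] at this
    refine this.trans ?_
    rw [c2, ← mul_assoc]
    exact mul_le_mul_of_nonneg_left (by linarith [ht.1]) (by positivity)
  rw [intervalIntegral.integral_sub (hce.intervalIntegrable _ _) (hec.intervalIntegrable _ _)] at f2
  have f3 : |(ek t - e t) / σ * y ^ σ| ≤ K2 * ρ ^ (1 + α) * (1 / σ) := by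
    have hy2 : y ^ σ ≤ ρ ^ σ := Real.rpow_le_rpow hy (by linarith) hσ.le
    have hy0 : 0 ≤ y ^ σ := Real.rpow_nonneg hy _
    rw [abs_mul, abs_div, abs_of_pos hσ, abs_of_nonneg hy0, c2]
    calc |ek t - e t| / σ * y ^ σ ≤ K2 * q ^ k / σ * ρ ^ σ :=
          mul_le_mul (div_le_div_of_nonneg_right (b3 t) hσ.le) hy2 hy0 (by positivity)
      _ = _ := by ring
  rw [inner_sub_left] at f1
  rw [abs_le] at b1 f1 f2 f3 ⊢
  have e1 : e t / σ * y ^ σ = ek t / σ * y ^ σ - (ek t - e t) / σ * y ^ σ := by ring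
  rw [e1]
  constructor <;> linarith

theorem bd1_of_sol {n : ℕ} {u : ℝ → En n × ℝ → ℝ}
    (hc : ContinuousOn (fun q : ℝ × (En n × ℝ) => u q.1 q.2) (Icc (-1 : ℝ) 0 ×ˢ closedHalfBall n 1))
    (h : ∀ t ∈ Icc (-1 : ℝ) 0, ∀ p ∈ halfBall n 1, |u t p| ≤ 1) :
    Bd1 n 1 (1/2) (fun t x y => u t (x, y)) := by
  intro t ht x hx y hy hy1
  have hsq : ∀ z, 0 ≤ z → z < 1/2 → ‖x‖ ^ 2 + z ^ 2 < 1 ^ 2 := by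
    intro z hz hz1
    have a1 := pow_le_pow_left₀ (norm_nonneg x) hx.le 2
    have a2 := pow_le_pow_left₀ hz hz1.le 2
    linarith
  have hcz : ContinuousOn (fun z : ℝ => u t (x, z)) (Ico 0 (1/2)) :=
    hc.comp (f := fun z : ℝ => (t, (x, z))) (by fun_prop) (fun z hz => ⟨ht, (hsq z hz.1 hz.2).le, hz.1⟩)
  have h1 : Tendsto (fun z : ℝ => |u t (x, z)|) (𝓝[Ioo y (1/2)] y) (𝓝 |u t (x, y)|) :=
    ((hcz y ⟨hy, hy1⟩).mono_left (nhdsWithin_mono _ fun z hz => ⟨hy.trans hz.1.le, hz.2⟩)).abs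
  have : (𝓝[Ioo y (1/2)] y).NeBot := left_nhdsWithin_Ioo_neBot hy1
  exact le_of_tendsto h1 (eventually_mem_nhdsWithin.mono fun z hz =>
    h t ht _ ⟨hsq z (hy.trans hz.1.le) hz.2, hy.trans_lt hz.1⟩)

/-- **Lemma 9.1** (the iteration lemma): if `b` and `f` vanish at `x = 0` at rate
`δ |x|^{1-2s+α}` at all scales, `u(0,0,0) = 0` and `‖u‖_∞ ≤ 1`, then `u` separates from a
configuration `A·x + D(t) + (D'(t)/(1-a)) y^{1-a}` by at most
`C (|x| + y + |t|^{1/(2s)})^{1+α}` (here `1 - a = 2s`). -/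
theorem pointwise_C1alpha_at_zero (n : ℕ) (hn : 1 ≤ n) (s : ℝ) (hs : s ∈ Ioo (0 : ℝ) (1/2))
    (α : ℝ) (hα : α ∈ Ioo (0 : ℝ) (2*s)) (M : ℝ) (hM : 0 ≤ M) :
    ∃ δ > 0, ∃ C > 0,
      ∀ (b : ℝ → En n → En n) (f : ℝ → En n → ℝ) (u : ℝ → En n × ℝ → ℝ),
      (∀ t ∈ Icc (-1 : ℝ) 0, (∀ x ∈ flatBall n 1, ‖b t x‖ ≤ M) ∧
        ∀ x ∈ flatBall n 1, ∀ x' ∈ flatBall n 1,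
          ‖b t x - b t x'‖ ≤ M * ‖x - x'‖ ^ (1 - 2*s)) →
      (∀ t ∈ Icc (-1 : ℝ) 0, ∀ x ∈ flatBall n 1, ‖b t x‖ ≤ δ * ‖x‖ ^ (1 - 2*s + α)) →
      (∀ t ∈ Icc (-1 : ℝ) 0, ∀ x ∈ flatBall n 1, |f t x| ≤ δ * ‖x‖ ^ (1 - 2*s + α)) →
      IsExtDDSolution (1 - 2*s) b f u →
      u 0 (0, 0) = 0 →
      (∀ t ∈ Icc (-1 : ℝ) 0, ∀ p ∈ halfBall n 1, |u t p| ≤ 1) →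
      ∃ (A : En n) (D : ℝ → ℝ),
        (∀ t ∈ Icc (-(1:ℝ)/2) 0, DifferentiableWithinAt ℝ D (Icc (-(1:ℝ)/2) 0) t) ∧
        ∀ t ∈ Icc (-(1:ℝ)/2) 0, ∀ p ∈ halfBallWithBase n (1/2),
          |u t p - ⟪A, p.1⟫ - D t -
            (derivWithin D (Icc (-(1:ℝ)/2) 0) t / (2*s)) * p.2 ^ (2*s)| ≤
            C * (‖p.1‖ + p.2 + |t| ^ ((1:ℝ)/(2*s))) ^ (1 + α) := by
  obtain ⟨hs0, hs1⟩ := hs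
  obtain ⟨hα0, hα1⟩ := hα
  obtain ⟨σ, hσe⟩ : ∃ σ, σ = 2 * s := ⟨_, rfl⟩
  rw [← hσe] at hα1 ⊢
  have hσ : 0 < σ := by linarith
  have hσ1 : σ < 1 := by linarith
  obtain ⟨ϱ, C, d, hϱ, hϱ4, hC, hd, hAL⟩ := AL n hσ hσ1 hα1
  have hϱ1 : ϱ < 1 := by linarith
  have hp1 : ϱ ^ α < 1 := Real.rpow_lt_one hϱ.le hϱ1 hα0
  have hq1 : ϱ ^ (1 + α - σ) < 1 := Real.rpow_lt_one hϱ.le hϱ1 (by linarith)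
  have hK1 : 0 < C / (1 - ϱ ^ α) := div_pos hC (by linarith)
  have hK2 : 0 < C / (1 - ϱ ^ (1 + α - σ)) := div_pos hC (by linarith)
  obtain ⟨K, hK⟩ : ∃ K, K = 1 + C / (1 - ϱ ^ α) + C / (1 - ϱ ^ (1 + α - σ)) * (1 + 1 / σ) := ⟨_, rfl⟩
  have hK0 : 0 < K := by rw [hK]; positivity
  refine ⟨d / (1 + C / (1 - ϱ ^ α)), by positivity, K * (3 / ϱ) ^ (1 + α), by positivity,
    fun b f u _ hb hf hu hu0 hub => ?_⟩
  obtain ⟨A, e, hec, hE⟩ := AL_iter hσ hσ1 hα0 hϱ hϱ1 hC hAL (by positivity)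
    (div_mul_cancel₀ d (by positivity : 1 + C / (1 - ϱ ^ α) ≠ 0)).le (classU_of_sol hσ (by positivity) hb hf hu)
    hu0 (bd1_of_sol hu.1 hub)
  rw [← hK] at hE
  have hDd : ∀ t, HasDerivAt (fun t => ∫ s in (0:ℝ)..t, e s) (e t) t :=
    fun t => (hec.integral_hasStrictDerivAt 0 t).hasDerivAt
  refine ⟨A, fun t => ∫ s in (0:ℝ)..t, e s, fun t _ => (hDd t).differentiableAt.differentiableWithinAt, ?_⟩
  rintro t ht ⟨x, y⟩ ⟨hxy, hy⟩
  rw [(hDd t).hasDerivWithinAt.derivWithin (uniqueDiffOn_Icc (by norm_num) t ht)]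
  simp only at hxy hy ⊢
  have hx2 : ‖x‖ < 1/2 := lt_of_pow_lt_pow_left₀ 2 (by norm_num) (by linarith [sq_nonneg y])
  have hy2 : y < 1/2 := lt_of_pow_lt_pow_left₀ 2 (by norm_num) (by linarith [sq_nonneg ‖x‖])
  have hτ0 : 0 ≤ |t| ^ (1 / σ) := by positivity
  have hτσ : (|t| ^ (1 / σ)) ^ σ = -t := by
    rw [← Real.rpow_mul (abs_nonneg t), one_div_mul_cancel hσ.ne', Real.rpow_one, abs_of_nonpos ht.2]
  obtain ⟨m, hm⟩ : ∃ m, m = ‖x‖ + y + |t| ^ (1 / σ) := ⟨_, rfl⟩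
  have hx0 := norm_nonneg x
  rw [← hm]
  have hm0 : 0 ≤ m := by linarith
  rcases hm0.eq_or_lt with h0 | h0
  · have a1 : x = 0 := norm_eq_zero.1 (by linarith)
    have a2 : y = 0 := by linarith
    have a3 : |t| ^ (1 / σ) = 0 := by linarith
    rw [a3, Real.zero_rpow hσ.ne'] at hτσ
    have a4 : t = 0 := by linarith
    rw [← h0, a1, a2, a4, hu0, Real.zero_rpow hσ.ne', Real.zero_rpow (by linarith : 1 + α ≠ 0)]
    simp
  · have key : ∀ k : ℕ, t ∈ Icc (-(ϱ ^ k) ^ σ) 0 → ‖x‖ < ϱ ^ k / 2 → y < ϱ ^ k / 2 → ϱ ^ k ≤ 3 / ϱ * m →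
        |u t (x, y) - ⟪A, x⟫ - (∫ s in (0:ℝ)..t, e s) - e t / σ * y ^ σ| ≤ K * (3 / ϱ) ^ (1 + α) * m ^ (1 + α) := by
      intro k h1 h2 h3 h4
      refine (hE k t h1 x h2 y hy h3).trans ?_
      rw [mul_assoc, ← Real.mul_rpow (by positivity) hm0]
      exact mul_le_mul_of_nonneg_left (Real.rpow_le_rpow (by positivity) h4 (by linarith)) hK0.le
    rcases le_total (3 * m) 1 with h3 | h3
    · obtain ⟨k, hk1, hk2⟩ := exists_nat_pow_near_of_lt_one (by linarith : 0 < 3 * m) h3 hϱ hϱ1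
      refine key k ⟨?_, ht.2⟩ (by linarith) (by linarith) ?_
      · have : (|t| ^ (1 / σ)) ^ σ ≤ (ϱ ^ k) ^ σ := Real.rpow_le_rpow hτ0 (by linarith) hσ.le
        linarith
      · rw [div_mul_eq_mul_div, le_div_iff₀ hϱ, ← pow_succ]; exact hk1.le
    · refine key 0 ?_ (by simpa using hx2) (by simpa using hy2) ?_
      · rw [pow_zero, Real.one_rpow]; exact ⟨by linarith [ht.1], ht.2⟩
      · rw [pow_zero, div_mul_eq_mul_div, le_div_iff₀ hϱ]; linarith

end
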